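/- Let Q be a finite acyclic quiver, 𝒬• = (Q¹,…,Q^ℓ) an admissible, ordered, Dynkin subquiver partition of Q, and β₁,…,β_r a Reineke order on Φ₊(𝒬•), with a chosen vertex i(u) satisfying β_u(i(u)) = 1 for each u ∈ [r]. Then the ℚ-linear map ⊕_{m∈ℕ^r} (𝒜_{β₁,m₁} ⊗ ⋯ ⊗ 𝒜_{β_r,m_r}) → ℋ(Q), induced on each summand by (f₁,…,f_r) ↦ f₁ * ⋯ * f_r (products taken from left to right), is bijective; that is, the *-multiplication induces an isomorphism 𝒜_{β₁} ⊗ ⋯ ⊗ 𝒜_{β_r} ≅ ℋ(Q). -/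

import Mathlib

open MvPolynomial
open scoped Classical

/-- A finite quiver with vertex set `Fin n`: a finite type of arrows together with
head and tail maps. -/
structure FinQuiver (n : ℕ) where
  Arr : Type
  [fintypeArr : Fintype Arr]
  hd : Arr → Fin n
  tl : Arr → Fin n

attribute [instance] FinQuiver.fintypeArr

variable {n : ℕ}

/-- `Q` is acyclic: there is no oriented cycle, i.e. no path
`a₁, …, a_{k+1}` (with `hd aₘ = tl aₘ₊₁`) whose final head equals its initial tail. -/
def FinQuiver.Acyclic (Q : FinQuiver n) : Prop :=
  ∀ (k : ℕ) (c : Fin (k + 1) → Q.Arr),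
    (∀ m : Fin k, Q.hd (c m.castSucc) = Q.tl (c m.succ)) →
    Q.hd (c (Fin.last k)) ≠ Q.tl (c 0)

/-- The Euler form `χ_Q` of the quiver `Q`. -/
def FinQuiver.euler (Q : FinQuiver n) (α β : Fin n → ℕ) : ℤ :=
  ∑ i : Fin n, (α i : ℤ) * β i - ∑ a : Q.Arr, (α (Q.tl a) : ℤ) * β (Q.hd a)

/-- The opposite antisymmetrization `⟨α,β⟩ = χ_Q(β,α) − χ_Q(α,β)`. -/
def FinQuiver.lam (Q : FinQuiver n) (α β : Fin n → ℕ) : ℤ :=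
  Q.euler β α - Q.euler α β

/-- The polynomial ring in the variables `ω_{i,j}`, `i ∈ Q₀`, `j ∈ ℕ` (0-indexed). -/
abbrev PolyQ (n : ℕ) := MvPolynomial (Fin n × ℕ) ℚ

/-- The permutation of the variables at vertex `i` induced by a permutation of `ℕ`. -/
def vertexPerm (i : Fin n) (σ : Equiv.Perm ℕ) : Fin n × ℕ → Fin n × ℕ :=
  fun p => if p.1 = i then (i, σ p.2) else p

/-- `f` is, for each vertex `i`, symmetric in the variables `ω_{i,0},…,ω_{i,γ i − 1}`. -/
def SymmIn (γ : Fin n → ℕ) (f : PolyQ n) : Prop :=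
  ∀ (i : Fin n) (σ : Equiv.Perm ℕ),
    (∀ j : ℕ, σ j ≠ j → j < γ i) → rename (vertexPerm i σ) f = f

lemma vars_smul_subset (c : ℚ) (f : PolyQ n) : (c • f).vars ⊆ f.vars := by
  rw [MvPolynomial.smul_eq_C_mul]
  refine (MvPolynomial.vars_mul _ _).trans ?_
  simp [MvPolynomial.vars_C]

/-- `ℋ_γ`: polynomials using only the variables `ω_{i,j}`, `j < γ i`, which are
symmetric at each vertex.  A `ℚ`-submodule of `PolyQ n`. -/
noncomputable def Hspace (γ : Fin n → ℕ) : Submodule ℚ (PolyQ n) where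
  carrier := {f | (∀ p ∈ f.vars, p.2 < γ p.1) ∧ SymmIn γ f}
  add_mem' := by
    rintro f g ⟨hf1, hf2⟩ ⟨hg1, hg2⟩
    refine ⟨fun p hp => ?_, fun i σ hσ => ?_⟩
    · rcases Finset.mem_union.mp (MvPolynomial.vars_add_subset f g hp) with h | h
      exacts [hf1 p h, hg1 p h]
    · rw [map_add, hf2 i σ hσ, hg2 i σ hσ]
  zero_mem' := by
    refine ⟨fun p hp => ?_, fun i σ hσ => map_zero _⟩
    simp [MvPolynomial.vars_0] at hp
  smul_mem' := by
    rintro c f ⟨hf1, hf2⟩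
    refine ⟨fun p hp => hf1 p (vars_smul_subset c f hp), fun i σ hσ => ?_⟩
    rw [map_smul, hf2 i σ hσ]

/-- Polynomials all of whose variables sit at vertex `i`. -/
noncomputable def onlyVertex (i : Fin n) : Submodule ℚ (PolyQ n) where
  carrier := {f | ∀ p ∈ f.vars, p.1 = i}
  add_mem' := by
    intro f g hf hg p hp
    rcases Finset.mem_union.mp (MvPolynomial.vars_add_subset f g hp) with h | h
    exacts [hf p h, hg p h]
  zero_mem' := by
    intro p hp
    simp [MvPolynomial.vars_0] at hp
  smul_mem' := by
    intro c f hf p hp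
    exact hf p (vars_smul_subset c f hp)

/-- `𝒜_{β,m}`: the subspace of `ℋ_{m·β}` of polynomials depending only on the
variables `ω_{i,0},…,ω_{i,m−1}` at the distinguished vertex `i`. -/
noncomputable def Aspace (β : Fin n → ℕ) (i : Fin n) (m : ℕ) : Submodule ℚ (PolyQ n) :=
  Hspace (fun v => m * β v) ⊓ onlyVertex i

/-- Substitute for the `j`-th variable at vertex `i` the variable `ω_{i,s}` where `s`
is the `j`-th element of `T i` in increasing order. -/
noncomputable def substAlong (T : Fin n → Finset ℕ) : PolyQ n →ₐ[ℚ] PolyQ n :=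
  aeval fun p : Fin n × ℕ => X (p.1, ((T p.1).sort (· ≤ ·)).getD p.2 0)

/-- The index set of the Kontsevich–Soibelman localization sum:
for each vertex, a `γ₁ i`-element subset of `{0,…,γ₁ i + γ₂ i − 1}`. -/
def shuffles (γ₁ γ₂ : Fin n → ℕ) : Finset (Fin n → Finset ℕ) :=
  Fintype.piFinset fun i => (Finset.range (γ₁ i + γ₂ i)).powerset.filter fun s => s.card = γ₁ i

def shuffleCompl (γ₁ γ₂ : Fin n → ℕ) (S : Fin n → Finset ℕ) : Fin n → Finset ℕ :=
  fun i => Finset.range (γ₁ i + γ₂ i) \ S i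

/-- The numerator factor attached to the arrow `a`:
`∏_{j' ∈ S̄_{h a}} ∏_{j ∈ S_{t a}} (ω_{h a, j'} − ω_{t a, j})`. -/
noncomputable def arrowFactor (Q : FinQuiver n) (γ₁ γ₂ : Fin n → ℕ)
    (S : Fin n → Finset ℕ) (a : Q.Arr) : PolyQ n :=
  ∏ j' ∈ shuffleCompl γ₁ γ₂ S (Q.hd a), ∏ j ∈ S (Q.tl a),
    (X (Q.hd a, j') - X (Q.tl a, j))

noncomputable def interactionNum (Q : FinQuiver n) (γ₁ γ₂ : Fin n → ℕ)
    (S : Fin n → Finset ℕ) : PolyQ n :=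
  ∏ a : Q.Arr, arrowFactor Q γ₁ γ₂ S a

noncomputable def interactionDen (γ₁ γ₂ : Fin n → ℕ) (S : Fin n → Finset ℕ) : PolyQ n :=
  ∏ i : Fin n, ∏ j' ∈ shuffleCompl γ₁ γ₂ S i, ∏ j ∈ S i, (X (i, j') - X (i, j))

/-- The Kontsevich–Soibelman localization sum, an element of the field of rational
functions (the fraction field of `PolyQ n`). -/
noncomputable def cohaMulRat (Q : FinQuiver n) (γ₁ γ₂ : Fin n → ℕ) (f₁ f₂ : PolyQ n) :
    FractionRing (PolyQ n) :=
  ∑ S ∈ shuffles γ₁ γ₂,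
    algebraMap (PolyQ n) (FractionRing (PolyQ n))
        (substAlong S f₁ * substAlong (shuffleCompl γ₁ γ₂ S) f₂ * interactionNum Q γ₁ γ₂ S) /
      algebraMap (PolyQ n) (FractionRing (PolyQ n)) (interactionDen γ₁ γ₂ S)

/-- The CoHA product `f₁ * f₂`: the unique polynomial representing the localization
sum (and `0` if the sum were not a polynomial, which never happens). -/
noncomputable def cohaMul (Q : FinQuiver n) (γ₁ γ₂ : Fin n → ℕ) (f₁ f₂ : PolyQ n) : PolyQ n :=
  if h : ∃ P : PolyQ n,
      algebraMap (PolyQ n) (FractionRing (PolyQ n)) P = cohaMulRat Q γ₁ γ₂ f₁ f₂ then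
    h.choose
  else 0

/-- Iterated, left-to-right, CoHA product of a list of dimension-vector/polynomial pairs.
Returns the total dimension vector together with the product. -/
noncomputable def cohaProd (Q : FinQuiver n) :
    List ((Fin n → ℕ) × PolyQ n) → (Fin n → ℕ) × PolyQ n
  | [] => (fun _ => 0, 1)
  | x :: xs => xs.foldl (fun acc y => (acc.1 + y.1, cohaMul Q acc.1 y.1 acc.2 y.2)) x

/-- Left-to-right CoHA product `f 0 * f 1 * ⋯ * f (r−1)` with `f u ∈ ℋ_{γ u}`. -/
noncomputable def cohaProdFin (Q : FinQuiver n) {r : ℕ} (γ : Fin r → Fin n → ℕ)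
    (f : Fin r → PolyQ n) : PolyQ n :=
  (cohaProd Q (List.ofFn fun u => (γ u, f u))).2

/-- The quiver with one vertex and no arrows. -/
def A1 : FinQuiver 1 := { Arr := Empty, hd := Empty.elim, tl := Empty.elim }

/-- `ψ_p = x₁ ^ p ∈ ℋ₁(A₁)`. -/
noncomputable def psi (p : ℕ) : PolyQ 1 := X ((0 : Fin 1), 0) ^ p

def oneDim : Fin 1 → ℕ := fun _ => 1

/-- The simple dimension vector `e_i`. -/
def simpleDim (i : Fin n) : Fin n → ℕ := fun v => if v = i then 1 else 0

/-- A subquiver of `Q`. -/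
structure Subquiver (Q : FinQuiver n) where
  verts : Finset (Fin n)
  arrows : Finset Q.Arr
  hd_mem : ∀ a ∈ arrows, Q.hd a ∈ verts
  tl_mem : ∀ a ∈ arrows, Q.tl a ∈ verts

def Subquiver.Full {Q : FinQuiver n} (Q' : Subquiver Q) : Prop :=
  ∀ a : Q.Arr, Q.hd a ∈ Q'.verts → Q.tl a ∈ Q'.verts → a ∈ Q'.arrows

/-- Adjacency in the underlying undirected graph of a subquiver. -/
def Subquiver.Adj {Q : FinQuiver n} (Q' : Subquiver Q) (x y : Fin n) : Prop :=
  ∃ a ∈ Q'.arrows, (Q.hd a = x ∧ Q.tl a = y) ∨ (Q.hd a = y ∧ Q.tl a = x)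

def Subquiver.Connected {Q : FinQuiver n} (Q' : Subquiver Q) : Prop :=
  ∀ x ∈ Q'.verts, ∀ y ∈ Q'.verts, Relation.ReflTransGen Q'.Adj x y

/-- The Euler form of the subquiver `Q'` (on `ℤ`-valued vectors). -/
def Subquiver.eulerZ {Q : FinQuiver n} (Q' : Subquiver Q) (α β : Fin n → ℤ) : ℤ :=
  ∑ i ∈ Q'.verts, α i * β i - ∑ a ∈ Q'.arrows, α (Q.tl a) * β (Q.hd a)

/-- Positive definiteness of the Tits form of `Q'` on vectors supported on `Q'`. -/
def Subquiver.PosDefTits {Q : FinQuiver n} (Q' : Subquiver Q) : Prop :=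
  ∀ β : Fin n → ℤ, (∀ i, i ∉ Q'.verts → β i = 0) → β ≠ 0 → 0 < Q'.eulerZ β β

/-- A connected full subquiver with positive definite Tits form. -/
def Subquiver.IsDynkin {Q : FinQuiver n} (Q' : Subquiver Q) : Prop :=
  Q'.Connected ∧ Q'.Full ∧ Q'.PosDefTits

/-- A positive root of `Q'`: a nonzero dimension vector supported on `Q'` with
Tits form equal to `1`. -/
def Subquiver.IsPosRoot {Q : FinQuiver n} (Q' : Subquiver Q) (β : Fin n → ℕ) : Prop :=
  (∀ i, i ∉ Q'.verts → β i = 0) ∧ β ≠ 0 ∧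
    Q'.eulerZ (fun i => (β i : ℤ)) (fun i => (β i : ℤ)) = 1

/-- A subquiver regarded as a quiver in its own right (on the ambient vertex set). -/
def Subquiver.toQuiver {Q : FinQuiver n} (Q' : Subquiver Q) : FinQuiver n :=
  { Arr := {a : Q.Arr // a ∈ Q'.arrows}, hd := fun a => Q.hd a.1, tl := fun a => Q.tl a.1 }

/-- An (ordered list) subquiver partition `𝒬• = (Q¹,…,Q^ℓ)`: nonempty connected
subquivers whose vertex sets partition `Q₀`. -/
structure SubqPartition (Q : FinQuiver n) (ℓ : ℕ) where
  part : Fin ℓ → Subquiver Q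
  nonempty' : ∀ j, (part j).verts.Nonempty
  connected' : ∀ j, (part j).Connected
  cover : ∀ i : Fin n, ∃! j, i ∈ (part j).verts

/-- The set `𝒬•₁` of arrows belonging to one of the parts. -/
noncomputable def SubqPartition.arrs {Q : FinQuiver n} {ℓ : ℕ} (P : SubqPartition Q ℓ) : Finset Q.Arr :=
  Finset.univ.biUnion fun j => (P.part j).arrows

/-- The partition is admissible and ordered: every arrow not inside a part goes from a
later part to an earlier part (head before tail). -/
def SubqPartition.Ordered {Q : FinQuiver n} {ℓ : ℕ} (P : SubqPartition Q ℓ) : Prop :=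
  ∀ a : Q.Arr, a ∉ P.arrs → ∀ i j : Fin ℓ,
    Q.hd a ∈ (P.part i).verts → Q.tl a ∈ (P.part j).verts → i < j

/-- Every part is a Dynkin subquiver. -/
def SubqPartition.Dynkin {Q : FinQuiver n} {ℓ : ℕ} (P : SubqPartition Q ℓ) : Prop :=
  ∀ j, (P.part j).IsDynkin

/-- `β : Fin r → (Fin n → ℕ)` is a Reineke-ordered enumeration of `Φ₊(𝒬•)`, with
`blk u` the part to which `β u` belongs: block-monotone, enumerating all positive roots
without repetition, and within each block `u < v → ⟨β u, β v⟩ ≥ 0`. -/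
def IsReinekeOrder {Q : FinQuiver n} {ℓ : ℕ} (P : SubqPartition Q ℓ) {r : ℕ}
    (β : Fin r → Fin n → ℕ) (blk : Fin r → Fin ℓ) : Prop :=
  Monotone blk ∧
  (∀ u, (P.part (blk u)).IsPosRoot (β u)) ∧
  Function.Injective β ∧
  (∀ j (b : Fin n → ℕ), (P.part j).IsPosRoot b → ∃ u, β u = b) ∧
  (∀ u v : Fin r, u < v → blk u = blk v → 0 ≤ Q.lam (β u) (β v))

open scoped TensorProduct DirectSum

namespace CoH
set_option linter.unusedSectionVars false
set_option linter.unusedSimpArgs false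
open Finset (add_sum_erase card_eq_zero card_erase_of_mem card_image_of_injOn card_image_of_injective card_insert_of_notMem card_le_card card_sdiff_add_card_eq_card card_sdiff_of_subset card_union_of_disjoint card_val coe_subset disjoint_left insert_erase inter_subset_right mem_biUnion mem_coe mem_erase mem_filter mem_image mem_insert mem_inter mem_powersetCard mem_range mem_sdiff mem_sigma mem_union mem_univ mul_prod_erase mul_sum ne_of_mem_erase not_subset powersetCard_zero prod_comm prod_congr prod_const prod_const_one prod_eq_one prod_eq_zero prod_image prod_insert prod_mul_distrib prod_ne_zero_iff prod_sdiff prod_union sdiff_subset subset_univ sum_add_distrib sum_biUnion sum_bij' sum_comm sum_congr sum_eq_zero sum_filter sum_image sum_insert sum_mul sum_nonneg sum_range sum_range_succ sum_range_succ' sum_sdiff sum_sigma' sum_singleton sum_sub_distrib sum_subset sum_union)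
open Function (update_of_ne update_self)
open Sum (inl inr)
section E
variable {R : Type*} [CommRing R] [Algebra ℚ R]
noncomputable def Ec (p : ℕ → R) : ℕ → R
  | 0 => 1
  | d + 1 => -((1 / (d + 1 : ℚ)) • ∑ k : Fin (d + 1), p k * Ec p (d - k))
lemma Ec_zero (p : ℕ → R) : Ec p 0 = 1 := by rw [Ec]
lemma Ec_succ (p : ℕ → R) (d : ℕ) :
    ((d : ℚ) + 1) • Ec p (d + 1) = -∑ k ∈ Finset.range (d + 1), p k * Ec p (d - k) := by
  have h : ((d : ℚ) + 1) ≠ 0 := by positivity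
  rw [Ec, smul_neg, smul_smul, mul_one_div_cancel h, one_smul, sum_range]
lemma smul_inj' {c : ℚ} (hc : c ≠ 0) {x y : R} (h : c • x = c • y) : x = y := by
  have := congrArg (fun z => c⁻¹ • z) h
  simpa [smul_smul, hc] using this
lemma Ec_unique (p : ℕ → R) (a : ℕ → R) (h0 : a 0 = 1)
    (h : ∀ d : ℕ, ((d : ℚ) + 1) • a (d + 1) = -∑ k ∈ Finset.range (d + 1), p k * a (d - k)) :
    ∀ d, a d = Ec p d := by
  intro d
  induction d using Nat.strong_induction_on with
  | _ d ih =>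
    cases d with
    | zero => rw [h0, Ec_zero]
    | succ d =>
      apply smul_inj' (c := (d : ℚ) + 1) (by positivity)
      rw [h, Ec_succ]
      congr 1
      apply sum_congr rfl
      intro k hk
      rw [ih _ (by omega)]
lemma map_Ec {S : Type*} [CommRing S] [Algebra ℚ S] (f : R →ₐ[ℚ] S) (p : ℕ → R) (d : ℕ) :
    f (Ec p d) = Ec (fun k => f (p k)) d := by
  apply Ec_unique (fun k => f (p k)) (fun d => f (Ec p d))
  · simp [Ec_zero]
  · intro d
    rw [← map_smul, Ec_succ]; simp
/-- integer-indexed version -/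
noncomputable def Ez (p : ℕ → R) (d : ℤ) : R := if 0 ≤ d then Ec p d.toNat else 0
lemma Ez_neg (p : ℕ → R) {d : ℤ} (h : d < 0) : Ez p d = 0 := by
  rw [Ez, if_neg (by omega)]
lemma Ez_nat (p : ℕ → R) (d : ℕ) : Ez p (d : ℤ) = Ec p d := by
  rw [Ez, if_pos (by omega)]; simp
lemma Ez_zero (p : ℕ → R) : Ez p 0 = 1 := by
  rw [Ez, if_pos le_rfl]; simp [Ec_zero]
lemma map_Ez {S : Type*} [CommRing S] [Algebra ℚ S] (f : R →ₐ[ℚ] S) (p : ℕ → R) (d : ℤ) :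
    f (Ez p d) = Ez (fun k => f (p k)) d := by
  unfold Ez; split_ifs
  · rw [map_Ec]
  · simp
lemma Ez_add_single (p : ℕ → R) (x : R) (d : ℤ) :
    Ez (fun k => p k + x ^ (k + 1)) d = Ez p d - x * Ez p (d - 1) := by
  rcases lt_or_ge d 0 with h | h
  · rw [Ez_neg _ h, Ez_neg _ h, Ez_neg _ (by omega)]; simp
  · obtain ⟨d, rfl⟩ := Int.eq_ofNat_of_zero_le h
    rw [Ez_nat]
    symm
    set a : ℕ → R := fun d => Ez p (d : ℤ) - x * Ez p ((d : ℤ) - 1) with ha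
    have ha0 : a 0 = 1 := by
      rw [ha]; simp only [Nat.cast_zero]; rw [Ez_zero, Ez_neg _ (by omega)]; simp
    have has : ∀ d : ℕ, a (d + 1) = Ec p (d + 1) - x * Ec p d := by
      intro d
      rw [ha]; simp only
      rw [Ez_nat]
      have : ((d + 1 : ℕ) : ℤ) - 1 = (d : ℤ) := by push_cast; ring
      rw [this, Ez_nat]
    have key : ∀ d, a d = Ec (fun k => p k + x ^ (k + 1)) d := by
      apply Ec_unique _ a ha0
      intro d
      have h1 : ∀ d : ℕ, ∑ k ∈ Finset.range (d + 1), x ^ (k + 1) * a (d - k) = x * Ec p d := by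
        intro d
        induction d with
        | zero => simp [ha0, Ec_zero]
        | succ d ih =>
          rw [sum_range_succ']
          have : ∑ k ∈ Finset.range (d + 1), x ^ (k + 1 + 1) * a (d + 1 - (k + 1))
              = x * (x * Ec p d) := by
            rw [← ih, mul_sum]
            apply sum_congr rfl
            intro k _
            rw [Nat.add_sub_add_right]; ring
          rw [this]
          simp only [Nat.sub_zero, has]
          ring
      have h2 : ∑ k ∈ Finset.range (d + 1), p k * a (d - k)
          = -(((d : ℚ) + 1) • Ec p (d + 1)) + x * ((d : ℚ) • Ec p d) := by
        cases d with
        | zero =>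
          have := Ec_succ p 0
          simp only [Nat.cast_zero] at this ⊢
          rw [this]
          simp [ha0, Ec_zero]
        | succ d =>
          rw [sum_range_succ]
          have e1 := Ec_succ p (d + 1)
          rw [sum_range_succ] at e1
          have e2 := Ec_succ p d
          have : ∑ k ∈ Finset.range (d + 1), p k * a (d + 1 - k)
            = ∑ k ∈ Finset.range (d + 1), p k * Ec p (d + 1 - k)
              - x * ∑ k ∈ Finset.range (d + 1), p k * Ec p (d - k) := by
            rw [mul_sum, ← sum_sub_distrib]
            apply sum_congr rfl
            intro k hk
            have hk' : d + 1 - k = (d - k) + 1 := by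
              have := mem_range.mp hk; omega
            rw [hk', has]; ring
          rw [this, e1]
          have e3 : ((d + 1 : ℕ) : ℚ) • Ec p (d + 1)
             = -∑ k ∈ Finset.range (d + 1), p k * Ec p (d - k) := by
            rw [← e2]; push_cast; rfl
          rw [e3]
          simp [ha0, Ec_zero]
          ring
      have h3 : ∑ k ∈ Finset.range (d + 1), (p k + x ^ (k + 1)) * a (d - k)
         = -(((d : ℚ) + 1) • Ec p (d + 1)) + x * ((d : ℚ) • Ec p d) + x * Ec p d := by
        rw [← h1, ← h2, ← sum_add_distrib]
        apply sum_congr rfl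
        intros; ring
      rw [h3, has, smul_sub, add_smul (d : ℚ) 1 (x * Ec p d), mul_smul_comm, one_smul]
      ring
    exact key d
lemma Ez_congr {p q : ℕ → R} (h : ∀ k, p k = q k) (d : ℤ) : Ez p d = Ez q d := by
  rw [show p = q from funext h]
lemma Ez_zero_fun (d : ℤ) : Ez (fun _ => (0 : R)) d = if d = 0 then 1 else 0 := by
  split_ifs with h
  · rw [h, Ez_zero]
  · rcases lt_or_ge d 0 with h' | h'
    · exact Ez_neg _ h'
    · obtain ⟨d, rfl⟩ := Int.eq_ofNat_of_zero_le h'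
      rw [Ez_nat]
      cases d with
      | zero => simp at h
      | succ d => rw [Ec]; simp
end E
/-- power sums of a multiset -/
def ps {R : Type*} [CommRing R] (s : Multiset R) : ℕ → R := fun k => (s.map (fun x => x ^ (k + 1))).sum
section PS
variable {R : Type*} [CommRing R]
lemma ps_zero : ps (0 : Multiset R) = 0 := by funext k; simp [ps]
lemma ps_cons (x : R) (s : Multiset R) (k : ℕ) : ps (x ::ₘ s) k = ps s k + x ^ (k + 1) := by
  simp [ps, add_comm]
lemma ps_add (s t : Multiset R) : ps (s + t) = ps s + ps t := by funext k; simp [ps]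
lemma ps_finset (s : Finset R) (k : ℕ) : ps s.val k = ∑ x ∈ s, x ^ (k + 1) := by simp [ps]
variable [Algebra ℚ R]
lemma Ez_ps_large (s : Multiset R) {d : ℤ} (h : (s.card : ℤ) < d) : Ez (ps s) d = 0 := by
  induction s using Multiset.induction_on generalizing d with
  | empty => rw [Ez_congr (q := fun _ => 0) (by simp [ps_zero]), Ez_zero_fun, if_neg]; simp at h; omega
  | cons x s ih =>
    rw [Multiset.card_cons] at h; push_cast at h
    rw [Ez_congr (ps_cons x s), Ez_add_single, ih (by omega), ih (by omega)]; simp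
lemma Ez_ps_top (s : Multiset R) : Ez (ps s) (s.card : ℤ) = (-1) ^ s.card * s.prod := by
  induction s using Multiset.induction_on with
  | empty => simp [Ez_zero]
  | cons x s ih =>
    rw [Ez_congr (ps_cons x s), Ez_add_single, Multiset.card_cons]
    have : ((s.card + 1 : ℕ) : ℤ) - 1 = s.card := by push_cast; ring
    rw [this, ih, Ez_ps_large s (by push_cast; omega), Multiset.prod_cons]; ring
lemma prod_eq_Ez (s : Multiset R) (y : R) :
    (s.map (fun x => y - x)).prod = ∑ l ∈ Finset.range (s.card + 1), Ez (ps s) (l : ℤ) * y ^ (s.card - l) := by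
  induction s using Multiset.induction_on with
  | empty => simp [Ez_zero]
  | cons x s ih =>
    rw [Multiset.map_cons, Multiset.prod_cons, ih, Multiset.card_cons,
      sum_range_succ' _ (s.card + 1), sub_mul]
    have h1 : ∀ l : ℕ, Ez (ps (x ::ₘ s)) ((l + 1 : ℕ) : ℤ) =
      Ez (ps s) ((l + 1 : ℕ) : ℤ) - x * Ez (ps s) (l : ℤ) := by
      intro l
      rw [Ez_congr (ps_cons x s), Ez_add_single]; congr 3; push_cast; ring
    simp only [h1, sub_mul, sum_sub_distrib]
    have h2 : ∑ l ∈ Finset.range (s.card + 1), x * Ez (ps s) (l : ℤ) * y ^ (s.card + 1 - (l + 1))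
       = x * ∑ l ∈ Finset.range (s.card + 1), Ez (ps s) (l : ℤ) * y ^ (s.card - l) := by
      rw [mul_sum]; apply sum_congr rfl; intro l _
      rw [Nat.add_sub_add_right]; ring
    have h3 : y * ∑ l ∈ Finset.range (s.card + 1), Ez (ps s) (l : ℤ) * y ^ (s.card - l)
      = ∑ l ∈ Finset.range (s.card + 1), Ez (ps s) ((l + 1 : ℕ) : ℤ) * y ^ (s.card + 1 - (l + 1))
        + Ez (ps (x ::ₘ s)) ((0 : ℕ) : ℤ) * y ^ (s.card + 1 - 0) := by
      have : Ez (ps (x ::ₘ s)) ((0 : ℕ) : ℤ) = Ez (ps s) ((0 : ℕ) : ℤ) := by simp [Ez_zero]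
      rw [this, ← sum_range_succ' (fun l => Ez (ps s) (l : ℤ) * y ^ (s.card + 1 - l)),
        sum_range_succ _ (s.card + 1), Ez_ps_large s (by push_cast; omega), zero_mul, add_zero,
        mul_sum]
      apply sum_congr rfl
      intro l hl
      have : s.card + 1 - l = (s.card - l) + 1 := by have := mem_range.mp hl; omega
      rw [this, pow_succ]; ring
    rw [h2, h3]; ring
end PS
/-- residue weights -/
def wt (R : Finset ℚ) (r : ℚ) : ℚ := ∏ x ∈ R.erase r, (r - x)⁻¹
lemma wt_erase {R : Finset ℚ} {x r : ℚ} (hx : x ∈ R) (h : r ≠ x) :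
    wt R r * (r - x) = wt (R.erase x) r := by
  unfold wt
  rw [Finset.erase_right_comm, ← mul_prod_erase (R.erase r) _ (mem_erase.mpr ⟨h.symm, hx⟩)]
  have : r - x ≠ 0 := sub_ne_zero.mpr h
  field_simp
lemma sum_wt_mul_sub {R : Finset ℚ} {x : ℚ} (hx : x ∈ R) (f : ℚ → ℚ) :
    ∑ r ∈ R, wt R r * (r - x) * f r = ∑ r ∈ R.erase x, wt (R.erase x) r * f r := by
  rw [← add_sum_erase R _ hx]
  simp only [sub_self, mul_zero, zero_mul, zero_add]
  apply sum_congr rfl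
  intro r hr
  rw [wt_erase hx (ne_of_mem_erase hr)]
lemma sum_wt (R : Finset ℚ) : ∑ r ∈ R, wt R r = if R.card = 1 then 1 else 0 := by
  induction hk : R.card using Nat.strong_induction_on generalizing R with
  | _ k ih =>
    rcases lt_trichotomy k 1 with h | h | h
    · have : R = ∅ := by rw [← card_eq_zero]; omega
      subst this; simp; omega
    · subst h
      obtain ⟨x, rfl⟩ := Finset.card_eq_one.mp hk
      simp [wt]
    · obtain ⟨x, y, hx, hy, hxy⟩ : ∃ x y, x ∈ R ∧ y ∈ R ∧ x ≠ y := by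
        obtain ⟨x, hx, y, hy, h⟩ := Finset.one_lt_card.mp (hk ▸ h)
        exact ⟨x, y, hx, hy, h⟩
      have h1 := sum_wt_mul_sub hx (fun _ => 1)
      have h2 := sum_wt_mul_sub hy (fun _ => 1)
      simp only [mul_one] at h1 h2
      have c1 := card_erase_of_mem hx
      have c2 := card_erase_of_mem hy
      rw [ih (k - 1) (by omega) _ (by omega)] at h1 h2
      rw [← h2] at h1
      have h3 : (y - x) * ∑ r ∈ R, wt R r = 0 := by
        rw [mul_sum, ← sub_eq_zero.mpr h1, ← sum_sub_distrib]
        apply sum_congr rfl; intros; ring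
      rw [if_neg (by omega)]
      exact (mul_eq_zero.mp h3).resolve_left (sub_ne_zero.mpr hxy.symm)
lemma res_base (R : Finset ℚ) (s : ℕ) :
    ∑ r ∈ R, wt R r * r ^ s = Ez (fun k => - ps R.val k) ((s : ℤ) + 1 - R.card) := by
  induction s generalizing R with
  | zero =>
    simp only [pow_zero, mul_one]
    rw [sum_wt]
    split_ifs with h
    · rw [h]; simp [Ez_zero]
    · rcases Nat.eq_zero_or_pos R.card with h0 | h0
      · have : R = ∅ := card_eq_zero.mp h0
        subst this
        rw [Ez_congr (q := fun _ => 0) (by simp [ps_zero]), Ez_zero_fun]; simp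
      · rw [Ez_neg _ (by push_cast; omega)]
  | succ s ih =>
    rcases R.eq_empty_or_nonempty with rfl | ⟨x, hx⟩
    · rw [Ez_congr (q := fun _ => 0) (by simp [ps_zero]), Ez_zero_fun]; simp; omega
    · have h1 := sum_wt_mul_sub hx (fun r => r ^ s)
      rw [ih] at h1
      have h2 : ∑ r ∈ R, wt R r * r ^ (s + 1) = ∑ r ∈ R, wt R r * (r - x) * r ^ s
          + x * ∑ r ∈ R, wt R r * r ^ s := by
        rw [mul_sum, ← sum_add_distrib]
        apply sum_congr rfl; intros; ring
      rw [h2, h1, ih]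
      have h3 : ∀ k, - ps (R.erase x).val k = - ps R.val k + x ^ (k + 1) := by
        intro k
        rw [ps_finset, ps_finset, ← add_sum_erase R _ hx]; ring
      rw [Ez_congr h3, Ez_add_single, card_erase_of_mem hx]
      have c : 0 < R.card := Finset.card_pos.mpr ⟨x, hx⟩
      have e1 : ((s : ℤ) + 1 - ((R.card - 1 : ℕ) : ℤ)) = ((s + 1 : ℕ) : ℤ) + 1 - R.card := by
        push_cast [Nat.cast_sub c]; ring
      rw [e1]
      have e2 : ((s + 1 : ℕ) : ℤ) + 1 - R.card - 1 = (s : ℤ) + 1 - R.card := by push_cast; ring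
      rw [e2]; ring
lemma residue (R : Finset ℚ) (B : Multiset ℚ) (s : ℕ) :
    ∑ r ∈ R, wt R r * r ^ s * (B.map (fun b => r - b)).prod
      = Ez (fun k => ps B k - ps R.val k) ((s : ℤ) + 1 + B.card - R.card) := by
  induction B using Multiset.induction_on generalizing s with
  | empty =>
    simp only [Multiset.map_zero, Multiset.prod_zero, mul_one, res_base, Multiset.card_zero, ps_zero]
    simp
  | cons b B ih =>
    have h : ∀ k, ps (b ::ₘ B) k - ps R.val k = (ps B k - ps R.val k) + b ^ (k + 1) := by
      intro k; rw [ps_cons]; ring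
    rw [Ez_congr h, Ez_add_single]
    have e1 : (s : ℤ) + 1 + (b ::ₘ B).card - R.card = ((s + 1 : ℕ) : ℤ) + 1 + B.card - R.card := by
      rw [Multiset.card_cons]; push_cast; ring
    have e2 : ((s + 1 : ℕ) : ℤ) + 1 + B.card - R.card - 1 = (s : ℤ) + 1 + B.card - R.card := by
      push_cast; ring
    rw [e1, e2, ← ih, ← ih, mul_sum, ← sum_sub_distrib]
    apply sum_congr rfl
    intro r _
    rw [Multiset.map_cons, Multiset.prod_cons]; ring
/-- polynomials in formal power sums `p_{i,k+1}` -/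
abbrev Lam (ι : Type) := MvPolynomial (ι × ℕ) ℚ
/-- evaluation at a virtual point -/
noncomputable def ev {ι : Type} (θ : ι → ℕ → ℚ) : Lam ι →ₐ[ℚ] ℚ := aeval (fun p => θ p.1 p.2)
@[simp] lemma ev_X {ι : Type} (θ : ι → ℕ → ℚ) (p : ι × ℕ) : ev θ (X p) = θ p.1 p.2 := by simp [ev]
/-- shift of a point -/
def shp {ι : Type} (θ : ι → ℕ → ℚ) (τ : ι → ℚ) (p : ℕ → ℚ) : ι → ℕ → ℚ :=
  fun i k => θ i k + τ i * p k
noncomputable def shf {ι : Type} (τ : ι → ℚ) : Lam ι →ₐ[ℚ] Polynomial (Lam ι) :=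
  aeval (fun p => Polynomial.C (X p) + Polynomial.C (C (τ p.1)) * Polynomial.X ^ (p.2 + 1))
lemma shf_eval {ι : Type} (τ : ι → ℚ) (θ : ι → ℕ → ℚ) (r : ℚ) (G : Lam ι) :
    Polynomial.eval₂ (ev θ : Lam ι →+* ℚ) r (shf τ G) = ev (shp θ τ (fun k => r ^ (k + 1))) G := by
  let f : Lam ι →+* ℚ := (Polynomial.eval₂RingHom (ev θ : Lam ι →+* ℚ) r).comp (shf τ : Lam ι →+* _)
  have : f = (ev (shp θ τ (fun k => r ^ (k + 1))) : Lam ι →+* ℚ) := by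
    apply MvPolynomial.ringHom_ext
    · intro c
      exact DFunLike.congr_fun (RingHom.ext_rat (f.comp C) ((ev (shp θ τ (fun k => r ^ (k + 1))) : Lam ι →+* ℚ).comp C)) c
    · intro p
      simp [f, shf, shp, Polynomial.eval₂_mul, Polynomial.eval₂_pow]
  exact DFunLike.congr_fun this G
variable {ι : Type} [Fintype ι]
noncomputable def lin (ℓ : ι → ℚ) (k : ℕ) : Lam ι := ∑ j, C (ℓ j) * X (j, k)
lemma ev_lin (ℓ : ι → ℚ) (θ : ι → ℕ → ℚ) (k : ℕ) : ev θ (lin ℓ k) = ∑ j, ℓ j * θ j k := by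
  simp [lin, ev]
noncomputable def Dop (τ ℓ : ι → ℚ) (d : ℤ) (G : Lam ι) : Lam ι :=
  ∑ s ∈ (shf τ G).support, (shf τ G).coeff s * Ez (lin ℓ) (s + 1 + d)
lemma ev_Dop (τ ℓ : ι → ℚ) (d : ℤ) (G : Lam ι) (θ : ι → ℕ → ℚ) (R : Finset ℚ) (B : Multiset ℚ)
    (h : ∀ k, ∑ j, ℓ j * θ j k = ps B k - ps R.val k) (hd : d = B.card - R.card) :
    ev θ (Dop τ ℓ d G) =
      ∑ r ∈ R, wt R r * (B.map (fun b => r - b)).prod * ev (shp θ τ (fun k => r ^ (k + 1))) G := by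
  unfold Dop
  rw [map_sum]
  simp only [← shf_eval, Polynomial.eval₂_eq_sum, Polynomial.sum, mul_sum]
  rw [sum_comm]
  apply sum_congr rfl
  intro s _
  rw [map_mul, map_Ez]
  rw [Ez_congr (q := fun k => ps B k - ps R.val k) (fun k => by rw [ev_lin, h])]
  rw [show (s : ℤ) + 1 + d = (s : ℤ) + 1 + B.card - R.card by rw [hd]; ring, ← residue, mul_sum]
  apply sum_congr rfl
  intro r _
  simp only [RingHom.coe_coe]
  ring
/-- weight of a subset -/
def WW (R Y : Finset ℚ) : ℚ := ∏ y ∈ Y, ∏ x ∈ R \ Y, (y - x)⁻¹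
lemma WW_insert {R Y : Finset ℚ} {r : ℚ} (hY : Y ⊆ R) (hr : r ∈ R) (hrY : r ∉ Y) :
    WW R (insert r Y) = (-1) ^ Y.card * WW R Y * wt R r * (∏ y ∈ Y, (r - y)) ^ 2 := by
  unfold WW wt
  rw [prod_insert hrY]
  have e1 : R \ Y = insert r (R \ insert r Y) := by
    ext x; simp only [mem_sdiff, mem_insert]
    constructor
    · rintro ⟨h1, h2⟩; by_cases h : x = r
      · exact Or.inl h
      · exact Or.inr ⟨h1, by tauto⟩
    · rintro (rfl | ⟨h1, h2⟩)
      · exact ⟨hr, hrY⟩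
      · exact ⟨h1, by tauto⟩
  have hn : r ∉ R \ insert r Y := by simp
  have e2 : R.erase r = Y ∪ (R \ insert r Y) := by
    ext x; simp only [mem_erase, mem_union, mem_sdiff, mem_insert]
    constructor
    · rintro ⟨h1, h2⟩; by_cases h : x ∈ Y <;> tauto
    · rintro (h | ⟨h1, h2⟩)
      · exact ⟨fun h' => hrY (h' ▸ h), hY h⟩
      · exact ⟨by tauto, h1⟩
  have hdisj : Disjoint Y (R \ insert r Y) := by
    rw [disjoint_left]; intro x hx; simp [hx]
  rw [e1, e2, prod_union hdisj]
  simp only [prod_insert hn, prod_mul_distrib]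
  have h1 : ∏ y ∈ Y, (y - r)⁻¹ = (-1) ^ Y.card * ∏ y ∈ Y, (r - y)⁻¹ := by
    rw [← prod_const, ← prod_mul_distrib]
    apply prod_congr rfl; intro y _
    rw [← neg_sub r y, inv_neg]; ring
  have h2 : (∏ y ∈ Y, (r - y)⁻¹) * ∏ y ∈ Y, (r - y) = 1 := by
    rw [← prod_mul_distrib]
    apply prod_eq_one
    intro y hy
    have : r - y ≠ 0 := sub_ne_zero.mpr (fun h => hrY (h ▸ hy))
    field_simp
  have h3 : ((-1 : ℚ) ^ Y.card) * (-1) ^ Y.card = 1 := by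
    rw [← mul_pow]; simp
  rw [h1]
  generalize ∏ y ∈ Y, (r - y)⁻¹ = a at *
  generalize ∏ y ∈ Y, (r - y) = b at *
  generalize (-1 : ℚ) ^ Y.card = e at *
  generalize ∏ x ∈ R \ insert r Y, (r - x)⁻¹ = c at *
  generalize ∏ y ∈ Y, ∏ x ∈ R \ insert r Y, (y - x)⁻¹ = f at *
  linear_combination (-c * f * (a * b + 1)) * h2 + (- f * c * a * a * b * b) * h3
/-- the summand -/
noncomputable def tm (τ : ι → ℚ) (R : Finset ℚ) (B : Multiset ℚ) (θ : ι → ℕ → ℚ) (Y : Finset ℚ)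
    (G : Lam ι) : ℚ :=
  (-1) ^ (Y.card.choose 2) * WW R Y * (∏ y ∈ Y, (B.map (fun b => y - b)).prod) *
    ev (shp θ τ (ps Y.val)) G
lemma tm_step (τ ℓ : ι → ℚ) (hτ : ∑ j, ℓ j * τ j = 2) (R : Finset ℚ) (B : Multiset ℚ)
    (θ : ι → ℕ → ℚ) (h : ∀ k, ∑ j, ℓ j * θ j k = ps B k - ps R.val k) (d : ℤ)
    (hd : d = B.card - R.card) (Y : Finset ℚ) (hY : Y ⊆ R) (G : Lam ι) :
    ∑ r ∈ R \ Y, tm τ R B θ (insert r Y) G = tm τ R B θ Y (Dop τ ℓ (d + 2 * Y.card) G) := by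
  have key := ev_Dop τ ℓ (d + 2 * Y.card) G (shp θ τ (ps Y.val)) R (B + Y.val + Y.val) (by
      intro k
      have : ∑ j, ℓ j * shp θ τ (ps Y.val) j k = ∑ j, ℓ j * θ j k + (∑ j, ℓ j * τ j) * ps Y.val k := by
        rw [sum_mul, ← sum_add_distrib]
        apply sum_congr rfl; intros; simp only [shp]; ring
      rw [this, h, hτ, ps_add, ps_add]; simp only [Pi.add_apply]; ring) (by
      rw [hd]; simp; ring)
  conv_rhs => rw [tm]
  rw [key, mul_sum]
  rw [← sum_sdiff hY]
  rw [sum_eq_zero (s := Y), add_zero]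
  · apply sum_congr rfl
    intro r hr
    rw [mem_sdiff] at hr
    unfold tm
    rw [WW_insert hY hr.1 hr.2, card_insert_of_notMem hr.2, prod_insert hr.2]
    have e1 : (Y.card + 1).choose 2 = Y.card + Y.card.choose 2 := by
      rw [Nat.choose_succ_succ' Y.card 1]; simp
    have e2 : shp θ τ (ps (insert r Y).val) = shp (shp θ τ (ps Y.val)) τ (fun k => r ^ (k + 1)) := by
      funext j k
      simp only [shp]
      rw [Finset.insert_val_of_notMem hr.2, ps_cons]; ring
    have h3 : ((-1 : ℚ) ^ Y.card) * (-1) ^ Y.card = 1 := by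
      rw [← mul_pow]; simp
    rw [e1, e2, pow_add]
    simp only [Multiset.map_add, Multiset.prod_add]
    rw [show (Multiset.map (fun b => r - b) Y.val).prod = ∏ y ∈ Y, (r - y) from rfl]
    generalize (-1 : ℚ) ^ Y.card = e at *
    linear_combination ((-1 : ℚ) ^ (Y.card.choose 2) * WW R Y * wt R r * (∏ y ∈ Y, (r - y)) ^ 2 * ((Multiset.map (fun b => r - b) B).prod * ∏ x ∈ Y, (Multiset.map (fun b => x - b) B).prod) * ev (shp (shp θ τ (ps Y.val)) τ (fun k => r ^ (k + 1))) G) * h3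
  · intro r hr
    have : (Multiset.map (fun b => r - b) (B + Y.val + Y.val)).prod = 0 := by
      apply Multiset.prod_eq_zero
      rw [Multiset.mem_map]
      exact ⟨r, by simp [hr], by simp⟩
    rw [this]; ring
lemma dcount (R : Finset ℚ) (l : ℕ) (g : Finset ℚ → ℚ) :
    ∑ Y ∈ R.powersetCard l, ∑ r ∈ R \ Y, g (insert r Y) =
      ((l : ℚ) + 1) * ∑ Y ∈ R.powersetCard (l + 1), g Y := by
  have h1 : ((l : ℚ) + 1) * ∑ Y ∈ R.powersetCard (l + 1), g Y
     = ∑ Y ∈ R.powersetCard (l + 1), ∑ r ∈ Y, g Y := by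
    rw [mul_sum]
    apply sum_congr rfl
    intro Y hY
    rw [Finset.sum_const, (mem_powersetCard.mp hY).2]; simp
  rw [h1, sum_sigma', sum_sigma']
  refine sum_bij' (fun x _ => (⟨insert x.2 x.1, x.2⟩ : (_ : Finset ℚ) × ℚ))
    (fun x _ => (⟨x.1.erase x.2, x.2⟩ : (_ : Finset ℚ) × ℚ)) ?_ ?_ ?_ ?_ ?_
  · rintro ⟨Y, r⟩ h
    simp only [mem_sigma, mem_powersetCard, mem_sdiff] at h ⊢
    refine ⟨⟨Finset.insert_subset h.2.1 h.1.1, ?_⟩, Finset.mem_insert_self _ _⟩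
    rw [card_insert_of_notMem h.2.2, h.1.2]
  · rintro ⟨Y, r⟩ h
    simp only [mem_sigma, mem_powersetCard, mem_sdiff] at h ⊢
    refine ⟨⟨(Finset.erase_subset _ _).trans h.1.1, ?_⟩, h.1.1 h.2, Finset.notMem_erase _ _⟩
    rw [card_erase_of_mem h.2, h.1.2]; rfl
  · rintro ⟨Y, r⟩ h
    simp only [mem_sigma, mem_powersetCard, mem_sdiff] at h
    simp [Finset.erase_insert h.2.2]
  · rintro ⟨Y, r⟩ h
    simp only [mem_sigma, mem_powersetCard] at h
    simp [insert_erase h.2]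
  · intros; rfl
/-- hybrid sums -/
noncomputable def SS (τ : ι → ℚ) (U Ω : Finset ℚ) (B : Multiset ℚ) (θ : ι → ℕ → ℚ) (a b : ℕ) (G : Lam ι) : ℚ :=
  ∑ Y1 ∈ U.powersetCard a, ∑ Y2 ∈ Ω.powersetCard b, tm τ (U ∪ Ω) B θ (Y1 ∪ Y2) G
lemma SS_step (τ ℓ : ι → ℚ) (hτ : ∑ j, ℓ j * τ j = 2) (U Ω : Finset ℚ) (hUΩ : Disjoint U Ω)
    (B : Multiset ℚ) (θ : ι → ℕ → ℚ)
    (h : ∀ k, ∑ j, ℓ j * θ j k = ps B k - ps (U ∪ Ω).val k) (d : ℤ)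
    (hd : d = B.card - (U ∪ Ω).card) (a b : ℕ) (G : Lam ι) :
    ((a : ℚ) + 1) * SS τ U Ω B θ (a + 1) b G + ((b : ℚ) + 1) * SS τ U Ω B θ a (b + 1) G
      = SS τ U Ω B θ a b (Dop τ ℓ (d + 2 * (a + b : ℕ)) G) := by
  unfold SS
  have e1 : ((a : ℚ) + 1) * ∑ Y1 ∈ U.powersetCard (a + 1), ∑ Y2 ∈ Ω.powersetCard b, tm τ (U ∪ Ω) B θ (Y1 ∪ Y2) G
     = ∑ Y1 ∈ U.powersetCard a, ∑ Y2 ∈ Ω.powersetCard b, ∑ r ∈ U \ Y1, tm τ (U ∪ Ω) B θ (insert r (Y1 ∪ Y2)) G := by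
    rw [← dcount U a (fun Y => ∑ Y2 ∈ Ω.powersetCard b, tm τ (U ∪ Ω) B θ (Y ∪ Y2) G)]
    apply sum_congr rfl
    intro Y1 _
    rw [sum_comm]
    simp only [Finset.insert_union]
  have e2 : ((b : ℚ) + 1) * ∑ Y1 ∈ U.powersetCard a, ∑ Y2 ∈ Ω.powersetCard (b + 1), tm τ (U ∪ Ω) B θ (Y1 ∪ Y2) G
     = ∑ Y1 ∈ U.powersetCard a, ∑ Y2 ∈ Ω.powersetCard b, ∑ r ∈ Ω \ Y2, tm τ (U ∪ Ω) B θ (insert r (Y1 ∪ Y2)) G := by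
    rw [mul_sum]
    apply sum_congr rfl
    intro Y1 _
    rw [← dcount Ω b (fun Y => tm τ (U ∪ Ω) B θ (Y1 ∪ Y) G)]
    simp only [Finset.union_insert]
  rw [e1, e2, ← sum_add_distrib]
  apply sum_congr rfl
  intro Y1 hY1
  rw [← sum_add_distrib]
  apply sum_congr rfl
  intro Y2 hY2
  rw [mem_powersetCard] at hY1 hY2
  have hc : (Y1 ∪ Y2).card = a + b := by
    rw [card_union_of_disjoint (hUΩ.mono hY1.1 hY2.1), hY1.2, hY2.2]
  rw [← hc, ← tm_step τ ℓ hτ (U ∪ Ω) B θ h d hd (Y1 ∪ Y2) (Finset.union_subset_union hY1.1 hY2.1)]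
  rw [← sum_union (hUΩ.mono sdiff_subset sdiff_subset)]
  apply sum_congr _ (fun _ _ => rfl)
  have hd1 := disjoint_left.mp hUΩ
  ext x
  simp only [mem_union, mem_sdiff]
  constructor
  · rintro (⟨h1, h2⟩ | ⟨h1, h2⟩)
    · exact ⟨Or.inl h1, fun h => h.elim h2 (fun h => hd1 h1 (hY2.1 h))⟩
    · exact ⟨Or.inr h1, fun h => h.elim (fun h => hd1 (hY1.1 h) h1) h2⟩
  · rintro ⟨h1 | h1, h2⟩ <;> tauto
lemma tm_smul (τ : ι → ℚ) (R : Finset ℚ) (B : Multiset ℚ) (θ : ι → ℕ → ℚ) (Y : Finset ℚ) (c : ℚ) (G : Lam ι) :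
    tm τ R B θ Y (c • G) = c * tm τ R B θ Y G := by simp [tm]; ring
lemma SS_smul (τ : ι → ℚ) (U Ω : Finset ℚ) (B : Multiset ℚ) (θ : ι → ℕ → ℚ) (a b : ℕ) (c : ℚ) (G : Lam ι) :
    SS τ U Ω B θ a b (c • G) = c * SS τ U Ω B θ a b G := by simp [SS, tm_smul, mul_sum]
/-- iterated operators -/
noncomputable def Epow (τ ℓ : ι → ℚ) : ℤ → ℕ → Lam ι → Lam ι
  | _, 0, G => G
  | e, c + 1, G => ((1 : ℚ) / (c + 1)) • Epow τ ℓ (e - 2) c (Dop τ ℓ (e - 2) G)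
/-- transfer sums over subsets of `U` to sums over subsets of `Ω` -/
lemma SS_hybrid (τ ℓ : ι → ℚ) (hτ : ∑ j, ℓ j * τ j = 2)
    (U Ω : Finset ℚ) (hU : Disjoint U Ω) (B : Multiset ℚ) (θ : ι → ℕ → ℚ)
    (h : ∀ k, ∑ j, ℓ j * θ j k = ps B k - ps (U ∪ Ω).val k) (d : ℤ)
    (hd : d = B.card - (U ∪ Ω).card) (a : ℕ) :
    ∀ (b : ℕ) (G : Lam ι),
    SS τ U Ω B θ a b G = ∑ c ∈ Finset.range (a + 1), (-1) ^ (a - c) * ((a - c + b).choose b : ℚ) *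
      SS τ U Ω B θ 0 (a + b - c) (Epow τ ℓ (d + 2 * (a + b : ℕ)) c G) := by
  induction a with
  | zero => intro b G; simp [Epow]
  | succ a ih =>
    intro b G
    have ha : (a : ℚ) + 1 ≠ 0 := by positivity
    have e := SS_step τ ℓ hτ U Ω hU B θ h d hd a b G
    have e' : SS τ U Ω B θ (a + 1) b G = (1 / (a + 1 : ℚ)) * (SS τ U Ω B θ a b (Dop τ ℓ (d + 2 * (a + b : ℕ)) G) -
        (b + 1) * SS τ U Ω B θ a (b + 1) G) := by
      rw [← e]; field_simp; ring
    rw [e', ih, ih]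
    rw [sum_range_succ' _ (a + 1)]
    have h1 : ∀ c ∈ Finset.range (a + 1), (-1 : ℚ) ^ (a + 1 - (c + 1)) * ((a + 1 - (c + 1) + b).choose b : ℚ) *
      SS τ U Ω B θ 0 (a + 1 + b - (c + 1)) (Epow τ ℓ (d + 2 * (a + 1 + b : ℕ)) (c + 1) G)
      = (1 / (c + 1 : ℚ)) * ((-1 : ℚ) ^ (a - c) * ((a - c + b).choose b : ℚ) *
      SS τ U Ω B θ 0 (a + b - c) (Epow τ ℓ (d + 2 * (a + b : ℕ)) c (Dop τ ℓ (d + 2 * (a + b : ℕ)) G))) := by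
      intro c _
      rw [Epow, SS_smul]
      have : d + 2 * ((a + 1 + b : ℕ) : ℤ) - 2 = d + 2 * (a + b : ℕ) := by push_cast; ring
      rw [this, Nat.add_sub_add_right, show a + 1 + b - (c + 1) = a + b - c by omega]; ring
    rw [sum_congr rfl h1]
    set x : ℕ → ℚ := fun c => SS τ U Ω B θ 0 (a + b + 1 - c) (Epow τ ℓ (d + 2 * (a + b + 1 : ℕ)) c G) with hx
    have hx1 : ∀ c, SS τ U Ω B θ 0 (a + b - c) (Epow τ ℓ (d + 2 * (a + b : ℕ)) c (Dop τ ℓ (d + 2 * (a + b : ℕ)) G))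
       = (c + 1 : ℚ) * x (c + 1) := by
      intro c
      simp only [hx]
      rw [Epow, SS_smul, show a + b + 1 - (c + 1) = a + b - c by omega]
      have : d + 2 * ((a + b + 1 : ℕ) : ℤ) - 2 = d + 2 * (a + b : ℕ) := by push_cast; ring
      rw [this]
      have hc : (c : ℚ) + 1 ≠ 0 := by positivity
      field_simp
    have hx2 : ∀ c, SS τ U Ω B θ 0 (a + (b + 1) - c) (Epow τ ℓ (d + 2 * (a + (b + 1) : ℕ)) c G) = x c := by
      intro c; rfl
    have hx3 : SS τ U Ω B θ 0 (a + 1 + b - 0) (Epow τ ℓ (d + 2 * (a + 1 + b : ℕ)) 0 G) = x 0 := by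
      simp only [hx, Epow]; rw [show a + 1 + b - 0 = a + b + 1 - 0 by omega]
    simp only [hx1, hx2, hx3]
    have h2 : ∀ c ∈ Finset.range (a + 1), (1 / (c + 1 : ℚ)) * ((-1 : ℚ) ^ (a - c) * ((a - c + b).choose b : ℚ) *
       ((c + 1 : ℚ) * x (c + 1))) = (-1 : ℚ) ^ (a - c) * ((a - c + b).choose b : ℚ) * x (c + 1) := by
      intro c _
      have hc : (c : ℚ) + 1 ≠ 0 := by positivity
      field_simp
    rw [sum_congr rfl h2]
    set y : ℕ → ℚ := fun c => (-1 : ℚ) ^ (a + 1 - c) * ((a + 1 - c + b).choose b : ℚ) * x c with hy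
    have h3 : ∀ c, c ≤ a → (-1 : ℚ) ^ (a - c) * ((a - c + b).choose b : ℚ) * x (c + 1) = y (c + 1) := by
      intro c _; simp only [hy]; rw [Nat.add_sub_add_right]
    have h4 : ∀ c, c ≤ a → ((b : ℚ) + 1) * ((-1 : ℚ) ^ (a - c) * ((a - c + (b + 1)).choose (b + 1) : ℚ) * x c)
        = - (a + 1 - c : ℚ) * y c := by
      intro c hc
      simp only [hy]
      have e5 : a + 1 - c = (a - c) + 1 := by omega
      rw [e5, pow_succ]
      have := Nat.choose_succ_right_eq (a - c + b + 1) b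
      rw [show a - c + b + 1 - b = a - c + 1 by omega] at this
      have h6 : ((a - c + (b + 1)).choose (b + 1) : ℚ) * (b + 1) = ((a - c + 1 + b).choose b : ℚ) * (a - c + 1) := by
        rw [show a - c + (b + 1) = a - c + b + 1 by ring, show a - c + 1 + b = a - c + b + 1 by ring]
        have h7 : ((a - c + 1 : ℕ) : ℚ) = (a : ℚ) - c + 1 := by push_cast [Nat.cast_sub hc]; ring
        rw [← h7]
        exact_mod_cast this
      linear_combination (-1 : ℚ) ^ (a - c) * x c * h6
    have h5 : (-1 : ℚ) ^ (a + 1 - 0) * ((a + 1 - 0 + b).choose b : ℚ) * x 0 = y 0 := rfl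
    rw [h5, sum_congr rfl (fun c hc => h3 c (by have := mem_range.mp hc; omega))]
    rw [mul_sum (a := (b : ℚ) + 1)]
    rw [sum_congr rfl (fun c hc => h4 c (by have := mem_range.mp hc; omega))]
    rw [sum_congr rfl (fun (c : ℕ) (hc : c ∈ Finset.range (a + 1)) => show (-1 : ℚ) ^ (a - c) * ((a - c + b).choose b : ℚ) *
       ((c + 1 : ℚ) * x (c + 1)) = ((c + 1 : ℕ) : ℚ) * y (c + 1) by
         rw [← h3 c (by have := mem_range.mp hc; omega)]; push_cast; ring)]
    have h6 : ∑ c ∈ Finset.range (a + 1), ((c + 1 : ℕ) : ℚ) * y (c + 1) - ∑ c ∈ Finset.range (a + 1), - (a + 1 - c : ℚ) * y c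
       = (a + 1) * (∑ c ∈ Finset.range (a + 1), y (c + 1) + y 0) := by
      have e1 := sum_range_succ' (fun c : ℕ => (c : ℚ) * y c) (a + 1)
      have e2 := sum_range_succ (fun c : ℕ => (c : ℚ) * y c) (a + 1)
      have e3 := sum_range_succ' y (a + 1)
      have e4 := sum_range_succ y (a + 1)
      simp only [Nat.cast_zero, zero_mul, add_zero] at e1
      rw [← e1, ← e3, e2, e4]
      have e7 : ∑ c ∈ Finset.range (a + 1), - (a + 1 - c : ℚ) * y c = -(a + 1) * ∑ c ∈ Finset.range (a + 1), y c
        + ∑ c ∈ Finset.range (a + 1), (c : ℚ) * y c := by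
        rw [mul_sum, ← sum_add_distrib]; apply sum_congr rfl; intros; ring
      rw [e7]; push_cast; ring
    rw [h6]; field_simp
/-- universal formula for subset sums -/
lemma SS_univ (τ ℓ : ι → ℚ) (hτ : ∑ j, ℓ j * τ j = 2) (d : ℤ) (l : ℕ) :
    ∀ (G : Lam ι), ∃ H : Lam ι, 
    ∀ (R : Finset ℚ) (B : Multiset ℚ) (θ : ι → ℕ → ℚ)
    (_ : ∀ k, ∑ j, ℓ j * θ j k = ps B k - ps R.val k)
    (_ : d = B.card - R.card),
    ∑ Y ∈ R.powersetCard l, tm τ R B θ Y G = ev θ H := by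
  induction l with
  | zero =>
    intro G
    refine ⟨G, fun R B θ _ _ => ?_⟩
    have : shp θ τ (ps 0) = θ := by funext j k; simp [shp, ps_zero]
    simp [tm, WW, this]
  | succ l ih =>
    intro G
    obtain ⟨H, hH⟩ := ih (Dop τ ℓ (d + 2 * l) G)
    refine ⟨((1 : ℚ) / (l + 1)) • H, fun R B θ h hd => ?_⟩
    rw [map_smul, ← hH R B θ h hd]
    have e := dcount R l (fun Y => tm τ R B θ Y G)
    have e2 : ∑ Y ∈ R.powersetCard l, ∑ r ∈ R \ Y, tm τ R B θ (insert r Y) G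
       = ∑ Y ∈ R.powersetCard l, tm τ R B θ Y (Dop τ ℓ (d + 2 * l) G) := by
      apply sum_congr rfl
      intro Y hY
      rw [mem_powersetCard] at hY
      rw [tm_step τ ℓ hτ R B θ h d hd Y hY.1, hY.2]
    rw [← e2, e, smul_eq_mul]
    have ha : (l : ℚ) + 1 ≠ 0 := by positivity
    field_simp
section Result
variable {ι : Type} [Fintype ι]
@[simp] lemma ev_C {ι : Type} (θ : ι → ℕ → ℚ) (c : ℚ) : ev θ (C c) = c := by simp [ev]
lemma ev_congr {θ θ' : ι → ℕ → ℚ} (h : ∀ i k, θ i k = θ' i k) (G : Lam ι) : ev θ G = ev θ' G := by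
  rw [show θ = θ' from funext fun i => funext fun k => h i k]
/-- resultants are polynomials in power sums -/
lemma exists_resultant (ℓ1 ℓ2 : ι → ℚ) (k m : ℕ) : ∃ F : Lam ι, ∀ (θ : ι → ℕ → ℚ) (A B : Multiset ℚ),
    A.card = k → B.card = m → (∀ s, ∑ j, ℓ1 j * θ j s = ps A s) → (∀ s, ∑ j, ℓ2 j * θ j s = ps B s) →
    ev θ F = (A.map (fun y => (B.map (fun x => y - x)).prod)).prod := by
  let f : Polynomial (Lam ι) := ∑ l ∈ Finset.range (m + 1),
    Polynomial.C (Ez (lin ℓ2) (l : ℤ)) * Polynomial.X ^ (m - l)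
  let P : ℕ → Lam ι := fun j => match j with | 0 => C (k : ℚ) | j + 1 => lin ℓ1 j
  let q : ℕ → Lam ι := fun s => ∑ j ∈ (f ^ (s + 1)).support, (f ^ (s + 1)).coeff j * P j
  refine ⟨C ((-1) ^ k) * Ez q k, fun θ A B hA hB h1 h2 => ?_⟩
  set g : ℚ → ℚ := fun y => (B.map (fun x => y - x)).prod with hg
  have hf : ∀ y, Polynomial.eval₂ (ev θ : Lam ι →+* ℚ) y f = g y := by
    intro y
    simp only [f, g]
    rw [prod_eq_Ez, Polynomial.eval₂_finsetSum, hB]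
    apply sum_congr rfl
    intro l _
    simp only [Polynomial.eval₂_mul, Polynomial.eval₂_C, Polynomial.eval₂_pow, Polynomial.eval₂_X,
      RingHom.coe_coe]
    rw [map_Ez, Ez_congr (q := ps B) (fun k => by rw [ev_lin, h2])]
  have hP : ∀ j, ev θ (P j) = (A.map (fun y => y ^ j)).sum := by
    intro j
    cases j with
    | zero => simp [P, hA, ev]
    | succ j => simp only [P]; rw [ev_lin, h1]; rfl
  have hq : ∀ s, ev θ (q s) = ps (A.map g) s := by
    intro s
    simp only [q, map_sum, map_mul, hP, ps, Multiset.map_map, Function.comp_def, ← hf]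
    simp only [← Polynomial.eval₂_pow]
    simp only [Polynomial.eval₂_eq_sum, Polynomial.sum, RingHom.coe_coe]
    rw [Multiset.sum_map_sum]
    simp only [Multiset.sum_map_mul_left]
  rw [map_mul, map_Ez, Ez_congr (q := ps (A.map g)) hq]
  have := Ez_ps_top (A.map g)
  rw [Multiset.card_map, hA] at this
  rw [this]
  have h3 : ((-1 : ℚ) ^ k) * (-1) ^ k = 1 := by
    rw [← mul_pow]; simp
  simp only [ev, map_pow, map_neg, map_one]
  linear_combination (A.map g).prod * h3
end Result
abbrev L1 (n : ℕ) := Lam (Fin n)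
abbrev L2 (n : ℕ) := Lam (Fin n ⊕ Fin n)
def psv (ω : Fin n → Finset ℚ) : Fin n → ℕ → ℚ := fun i => ps (ω i).val
/-- subsets of integer cardinality -/
def pcz (A : Finset ℚ) (d : ℤ) : Finset (Finset ℚ) := if 0 ≤ d then A.powersetCard d.toNat else ∅
lemma mem_pcz {A Y : Finset ℚ} {d : ℤ} : Y ∈ pcz A d ↔ Y ⊆ A ∧ (Y.card : ℤ) = d := by
  unfold pcz
  split_ifs with h
  · rw [mem_powersetCard]; apply and_congr_right; intro _; omega
  · simp only [Finset.notMem_empty, false_iff]; rintro ⟨_, h2⟩; omega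
def subs (ω : Fin n → Finset ℚ) (δ : Fin n → ℤ) : Finset (Fin n → Finset ℚ) :=
  Fintype.piFinset (fun i => pcz (ω i) (δ i))
lemma mem_subs {ω N : Fin n → Finset ℚ} {δ : Fin n → ℤ} :
    N ∈ subs ω δ ↔ ∀ i, N i ⊆ ω i ∧ ((N i).card : ℤ) = δ i := by
  simp [subs, Fintype.mem_piFinset, mem_pcz]
noncomputable def arr (Q : FinQuiver n) (ω N : Fin n → Finset ℚ) : ℚ :=
  ∏ a : Q.Arr, ∏ y ∈ N (Q.hd a), ∏ x ∈ ω (Q.tl a) \ N (Q.tl a), (y - x)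
noncomputable def kern (Q : FinQuiver n) (ω N : Fin n → Finset ℚ) : ℚ :=
  arr Q ω N * ∏ i, WW (ω i) (N i)
noncomputable def Isum (Q : FinQuiver n) (ω : Fin n → Finset ℚ) (δ : Fin n → ℤ) (G : L2 n) : ℚ :=
  ∑ N ∈ subs ω δ, kern Q ω N * ev (Sum.elim (psv ω) (psv N)) G
def pts (γ : Fin n → ℤ) (ω : Fin n → Finset ℚ) : Prop := ∀ i, ((ω i).card : ℤ) = γ i
def IsI (Q : FinQuiver n) (γ δ : Fin n → ℤ) (G : L2 n) (b : L1 n) : Prop :=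
  ∀ ω, pts γ ω → ev (psv ω) b = Isum Q ω δ G
lemma sum_piFinset_update {n : ℕ} {α : Type} (t : Fin n → Finset α) (i : Fin n) (e : α) (f : (Fin n → α) → ℚ) :
    ∑ N ∈ Fintype.piFinset t, f N =
      ∑ N ∈ Fintype.piFinset (Function.update t i {e}), ∑ Y ∈ t i, f (Function.update N i Y) := by
  rw [sum_sigma']
  refine sum_bij' (fun N _ => (⟨Function.update N i e, N i⟩ : (_ : Fin n → α) × α))
    (fun x _ => Function.update x.1 i x.2) ?_ ?_ ?_ ?_ ?_
  · intro N hN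
    simp only [Fintype.mem_piFinset, mem_sigma] at hN ⊢
    refine ⟨fun j => ?_, hN i⟩
    by_cases h : j = i
    · subst h; simp
    · simp [update_of_ne h, hN j]
  · rintro ⟨N, Y⟩ h
    simp only [Fintype.mem_piFinset, mem_sigma] at h ⊢
    intro j
    by_cases hj : j = i
    · subst hj; simpa using h.2
    · have := h.1 j
      rwa [update_of_ne hj] at this ⊢
  · intro N _; simp
  · rintro ⟨N, Y⟩ h
    simp only [Fintype.mem_piFinset, mem_sigma] at h
    have := h.1 i
    simp only [update_self, Finset.mem_singleton] at this
    simp [← this]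
  · intro N _; simp
lemma exists_elim (i : Fin n) (γi δi : ℤ) (G : L2 n) : ∃ H : L2 n,
    ∀ (v w : Fin n → ℕ → ℚ) (A : Finset ℚ), (A.card : ℤ) = γi → v i = ps A.val → w i = 0 →
      ∑ Y ∈ pcz A δi, WW A Y * ev (Sum.elim v (Function.update w i (ps Y.val))) G
        = ev (Sum.elim v w) H := by
  by_cases hδ : 0 ≤ δi
  swap
  · exact ⟨0, fun v w A _ _ _ => by rw [pcz, if_neg hδ, Finset.sum_empty, map_zero]⟩
  let τ : Fin n ⊕ Fin n → ℚ := Pi.single (inr i) 1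
  let ℓ : Fin n ⊕ Fin n → ℚ := fun j => 2 * (Pi.single (inr i) 1 : Fin n ⊕ Fin n → ℚ) j -
    (Pi.single (inl i) 1 : Fin n ⊕ Fin n → ℚ) j
  have hτ : ∑ j, ℓ j * τ j = 2 := by
    rw [Finset.sum_eq_single (inr i)]
    · simp [ℓ, τ]
    · intro b _ hb; simp [τ, Pi.single_apply, hb]
    · simp
  obtain ⟨H, hH⟩ := SS_univ τ ℓ hτ (-γi) δi.toNat G
  refine ⟨C ((-1) ^ (δi.toNat.choose 2)) * H, fun v w A hA hv hw => ?_⟩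
  rw [map_mul, ← hH A 0 (Sum.elim v w) (by
    intro k
    simp only [ℓ, Fintype.sum_sum_type]
    simp [Pi.single_apply, sub_mul, sum_sub_distrib, hw, hv, ps_zero]) (by simp [hA])]
  rw [pcz, if_pos hδ, mul_sum]
  apply sum_congr rfl
  intro Y hY
  rw [tm, (mem_powersetCard.mp hY).2]
  have h3 : ((-1 : ℚ) ^ (δi.toNat.choose 2)) * (-1) ^ (δi.toNat.choose 2) = 1 := by
    rw [← mul_pow]; simp
  have h4 : ev (shp (Sum.elim v w) τ (ps Y.val)) G = ev (Sum.elim v (Function.update w i (ps Y.val))) G := by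
    apply ev_congr
    intro j k
    rcases j with j | j
    · simp [shp, τ]
    · by_cases h : j = i
      · subst h; simp [shp, τ, hw]
      · simp [shp, τ, Pi.single_apply, h]
  rw [h4]
  simp only [ev_C, Multiset.map_zero, Multiset.prod_zero, prod_const_one]
  linear_combination (-WW A Y * ev (Sum.elim v (Function.update w i (ps Y.val))) G) * h3
lemma psv_update (N : Fin n → Finset ℚ) (i : Fin n) (Y : Finset ℚ) :
    psv (Function.update N i Y) = Function.update (psv N) i (ps Y.val) := by
  funext j
  by_cases h : j = i
  · subst h; simp [psv]
  · simp [psv, h]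
lemma exists_elim_all (γ δ : Fin n → ℤ) (s : Finset (Fin n)) : ∀ G : L2 n, ∃ H : L2 n,
    ∀ ω, pts γ ω → ∑ N ∈ Fintype.piFinset (fun i => if i ∈ s then pcz (ω i) (δ i) else {∅}),
      (∏ i ∈ s, WW (ω i) (N i)) * ev (Sum.elim (psv ω) (psv N)) G = ev (Sum.elim (psv ω) 0) H := by
  induction s using Finset.induction_on with
  | empty =>
    intro G
    refine ⟨G, fun ω _ => ?_⟩
    have : Fintype.piFinset (fun i : Fin n => if i ∈ (∅ : Finset (Fin n)) then pcz (ω i) (δ i) else {∅}) =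
        {fun _ => ∅} := by
      ext N; simp [Fintype.mem_piFinset, funext_iff]
    rw [this]
    have h : psv (fun _ : Fin n => (∅ : Finset ℚ)) = 0 := by
      funext i k; simp [psv, ps_zero]
    simp [h]
  | insert i s his ih =>
    intro G
    obtain ⟨H1, h1⟩ := exists_elim i (γ i) (δ i) G
    obtain ⟨H, hH⟩ := ih H1
    refine ⟨H, fun ω hω => ?_⟩
    rw [← hH ω hω, sum_piFinset_update _ i ∅]
    have e : Function.update (fun j => if j ∈ insert i s then pcz (ω j) (δ j) else {∅}) i {∅}
       = fun j => if j ∈ s then pcz (ω j) (δ j) else {∅} := by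
      funext j
      by_cases h : j = i
      · subst h; simp [his]
      · simp [update_of_ne h, h]
    rw [e]
    apply sum_congr rfl
    intro N hN
    have hNi : N i = ∅ := by
      have := Fintype.mem_piFinset.mp hN i
      simpa [his] using this
    simp only [mem_insert, true_or, if_true]
    rw [← h1 (psv ω) (psv N) (ω i) (hω i) rfl (by simp only [psv, hNi]; exact ps_zero), mul_sum]
    apply sum_congr rfl
    intro Y _
    rw [prod_insert his, psv_update]
    have : ∏ j ∈ s, WW (ω j) (Function.update N i Y j) = ∏ j ∈ s, WW (ω j) (N j) := by
      apply prod_congr rfl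
      intro j hj
      rw [update_of_ne (ne_of_mem_of_not_mem hj his)]
    rw [this, update_self]; ring
/-- forget the `N`-part -/
noncomputable def res0 : L2 n →ₐ[ℚ] L1 n :=
  aeval (fun p => Sum.elim (fun i => X (i, p.2)) (fun _ => 0) p.1)
lemma ev_res0 (v : Fin n → ℕ → ℚ) (G : L2 n) : ev v (res0 G) = ev (Sum.elim v 0) G := by
  have : (ev v).comp (res0 (n := n)) = ev (Sum.elim v 0) := by
    apply MvPolynomial.algHom_ext
    rintro ⟨i | i, k⟩ <;> simp [res0]
  exact DFunLike.congr_fun this G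
lemma ps_sdiff {A Y : Finset ℚ} (h : Y ⊆ A) (k : ℕ) : ps (A \ Y).val k = ps A.val k - ps Y.val k := by
  rw [ps_finset, ps_finset, ps_finset, ← sum_sdiff h]; ring
lemma exists_arr (Q : FinQuiver n) (γ δ : Fin n → ℤ) : ∃ F : L2 n, ∀ ω N, pts γ ω → N ∈ subs ω δ →
    ev (Sum.elim (psv ω) (psv N)) F = arr Q ω N := by
  have h1 : ∀ a : Q.Arr, ∃ F : L2 n, ∀ ω N, pts γ ω → N ∈ subs ω δ →
    ev (Sum.elim (psv ω) (psv N)) F = ∏ y ∈ N (Q.hd a), ∏ x ∈ ω (Q.tl a) \ N (Q.tl a), (y - x) := by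
    intro a
    obtain ⟨F, hF⟩ := exists_resultant (ι := Fin n ⊕ Fin n) (Pi.single (inr (Q.hd a)) 1)
      (Pi.single (inl (Q.tl a)) 1 - Pi.single (inr (Q.tl a)) 1) (δ (Q.hd a)).toNat
      (γ (Q.tl a) - δ (Q.tl a)).toNat
    refine ⟨F, fun ω N hω hN => ?_⟩
    rw [mem_subs] at hN
    rw [hF _ (N (Q.hd a)).val (ω (Q.tl a) \ N (Q.tl a)).val]
    · rfl
    · have := (hN (Q.hd a)).2
      simp only [card_val]; omega
    · have h1 := (hN (Q.tl a)).2
      have h2 := hω (Q.tl a)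
      have h3 := card_sdiff_add_card_eq_card (hN (Q.tl a)).1
      simp only [card_val]; omega
    · intro s; simp [Pi.single_apply, psv]
    · intro s
      rw [ps_sdiff (hN _).1]
      simp [Pi.single_apply, psv, sub_mul]
  choose F hF using h1
  exact ⟨∏ a, F a, fun ω N hω hN => by rw [map_prod, arr]; exact prod_congr rfl (fun a _ => hF a ω N hω hN)⟩
theorem exists_IsI (Q : FinQuiver n) (γ δ : Fin n → ℤ) (G : L2 n) : ∃ b, IsI Q γ δ G b := by
  obtain ⟨F, hF⟩ := exists_arr Q γ δ
  obtain ⟨H, hH⟩ := exists_elim_all γ δ Finset.univ (F * G)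
  refine ⟨res0 H, fun ω hω => ?_⟩
  rw [ev_res0, ← hH ω hω, Isum]
  simp only [mem_univ, if_true]
  apply sum_congr rfl
  intro N hN
  rw [map_mul, hF ω N hω hN, kern]; ring
section Loc
variable {ι : Type} [Fintype ι]
lemma prod_inv_swap (Y Z : Finset ℚ) :
    ∏ y ∈ Y, ∏ x ∈ Z, (y - x)⁻¹ = (-1) ^ (Y.card * Z.card) * ∏ x ∈ Z, ∏ y ∈ Y, (x - y)⁻¹ := by
  rw [prod_comm, Finset.card_eq_sum_ones, Finset.card_eq_sum_ones, Finset.sum_mul_sum]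
  have : ∀ x ∈ Z, ∏ y ∈ Y, (y - x)⁻¹ = (-1) ^ Y.card * ∏ y ∈ Y, (x - y)⁻¹ := by
    intro x _
    rw [← prod_const, ← prod_mul_distrib]
    apply prod_congr rfl; intro y _
    rw [← neg_sub x y, inv_neg]; ring
  rw [prod_congr rfl this, prod_mul_distrib, prod_const]
  congr 1
  rw [← pow_mul]; simp
lemma prod_inv_cancel {Y Z : Finset ℚ} (h : Disjoint Y Z) :
    (∏ y ∈ Y, ∏ x ∈ Z, (y - x)) * ∏ y ∈ Y, ∏ x ∈ Z, (y - x)⁻¹ = 1 := by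
  rw [← prod_mul_distrib]
  apply prod_eq_one; intro y hy
  rw [← prod_mul_distrib]
  apply prod_eq_one; intro x hx
  have : y - x ≠ 0 := sub_ne_zero.mpr (fun e => disjoint_left.mp h hy (e ▸ hx))
  field_simp
lemma sq_sign (k : ℕ) : ((-1 : ℚ) ^ k) * (-1) ^ k = 1 := by rw [← mul_pow]; simp
lemma loc_left (A Ω U : Finset ℚ) (hAΩ : Disjoint A Ω) (hU : U ⊆ A ∪ Ω) (τ : ι → ℚ)
    (θ : ι → ℕ → ℚ) (F : Lam ι) (k : ℤ) (l' : ℕ) (hk : k + l' = (U ∩ A).card) :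
    ∑ Y ∈ pcz A k, (∏ y ∈ Y, ∏ x ∈ (A ∪ Ω) \ U, (y - x)) * WW A Y *
      ev (shp θ τ (fun s => ps U.val s - ps Y.val s)) F
    = (∏ y ∈ U ∩ A, ∏ x ∈ Ω \ U, (y - x)) * (-1) ^ (l' * ((U ∩ A).card - l')) * (-1) ^ (l'.choose 2) *
      SS τ (U ∩ A) (Ω \ U) 0 (shp θ τ (ps (U ∩ Ω).val)) l' 0 F := by
  have hdis : Disjoint (U ∩ A) (Ω \ U) := by
    rw [disjoint_left]; intro x hx; simp at hx ⊢; tauto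
  have h1 : ∑ Y ∈ pcz A k, (∏ y ∈ Y, ∏ x ∈ (A ∪ Ω) \ U, (y - x)) * WW A Y *
      ev (shp θ τ (fun s => ps U.val s - ps Y.val s)) F = ∑ Y ∈ pcz (U ∩ A) k, (∏ y ∈ Y, ∏ x ∈ (A ∪ Ω) \ U, (y - x)) * WW A Y *
      ev (shp θ τ (fun s => ps U.val s - ps Y.val s)) F := by
    symm
    apply sum_subset
    · intro Y hY; rw [mem_pcz] at hY ⊢; exact ⟨hY.1.trans inter_subset_right, hY.2⟩
    · intro Y hY hY'
      rw [mem_pcz] at hY hY'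
      have : ¬ Y ⊆ U := fun h => hY' ⟨Finset.subset_inter h hY.1, hY.2⟩
      obtain ⟨y, hy, hyU⟩ := not_subset.mp this
      rw [prod_eq_zero hy]
      · simp
      · apply prod_eq_zero (i := y)
        · simp [hyU, hY.1 hy]
        · simp
  rw [h1, SS]
  simp only [powersetCard_zero, sum_singleton, Finset.union_empty]
  rw [mul_sum]
  refine sum_bij' (fun Y _ => (U ∩ A) \ Y) (fun Y _ => (U ∩ A) \ Y) ?_ ?_ ?_ ?_ ?_
  · intro Y hY
    rw [mem_pcz] at hY
    rw [mem_powersetCard]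
    refine ⟨sdiff_subset, ?_⟩
    have := card_sdiff_add_card_eq_card hY.1
    omega
  · intro Y hY
    rw [mem_powersetCard] at hY
    rw [mem_pcz]
    refine ⟨sdiff_subset, ?_⟩
    have := card_sdiff_add_card_eq_card hY.1
    omega
  · intro Y hY; rw [mem_pcz] at hY; exact Finset.sdiff_sdiff_eq_self hY.1
  · intro Y hY; rw [mem_powersetCard] at hY; exact Finset.sdiff_sdiff_eq_self hY.1
  · intro Y hY
    rw [mem_pcz] at hY
    obtain ⟨hYb, hYc⟩ := hY
    have hcard := card_sdiff_add_card_eq_card hYb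
    have hc1 : ((U ∩ A) \ Y).card = l' := by omega
    have hc2 : (U ∩ A).card - l' = Y.card := by omega
    rw [tm, hc1, hc2]
    have hpt : shp θ τ (fun s => ps U.val s - ps Y.val s) = shp (shp θ τ (ps (U ∩ Ω).val)) τ (ps ((U ∩ A) \ Y).val) := by
      funext j s
      simp only [shp]
      rw [ps_sdiff hYb]
      have : ps U.val s = ps (U ∩ A).val s + ps (U ∩ Ω).val s := by
        rw [ps_finset, ps_finset, ps_finset, ← sum_union]
        · apply sum_congr _ (fun _ _ => rfl)
          ext x; simp; have := @hU x; simp at this; tauto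
        · exact hAΩ.mono inter_subset_right inter_subset_right
      rw [this]; ring
    rw [hpt]
    have hs1 : (A ∪ Ω) \ U = (A \ U) ∪ (Ω \ U) := Finset.union_sdiff_distrib _ _ _
    have hd1 : Disjoint (A \ U) (Ω \ U) := hAΩ.mono sdiff_subset sdiff_subset
    have hs2 : A \ Y = (A \ U) ∪ ((U ∩ A) \ Y) := by
      ext x; simp; have := @hYb x; simp at this; tauto
    have hd2 : Disjoint (A \ U) ((U ∩ A) \ Y) := by
      rw [disjoint_left]; intro x hx; simp at hx ⊢; tauto
    have hs3 : (U ∩ A ∪ Ω \ U) \ ((U ∩ A) \ Y) = Y ∪ (Ω \ U) := by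
      ext x; simp only [mem_sdiff, mem_union, mem_inter]
      have := @hYb x; rw [mem_inter] at this
      by_cases h1 : x ∈ Y <;> by_cases h2 : x ∈ U <;> simp_all
    have hd3 : Disjoint Y (Ω \ U) := hdis.mono_left hYb
    unfold WW
    rw [hs1, hs2, hs3]
    simp only [prod_union hd1, prod_union hd2, prod_union hd3, prod_mul_distrib]
    have c1 := prod_inv_cancel (Y := Y) (Z := A \ U) (by
      rw [disjoint_left]; intro x hx; have := hYb hx; simp at this ⊢; tauto)
    have c2 := prod_inv_cancel (Y := (U ∩ A) \ Y) (Z := Ω \ U) (hdis.mono_left sdiff_subset)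
    have c3 := prod_inv_swap ((U ∩ A) \ Y) Y
    rw [hc1] at c3
    have c4 := prod_sdiff (f := fun y => ∏ x ∈ Ω \ U, (y - x)) hYb
    rw [c3, ← c4]
    have s1 := sq_sign (l' * Y.card)
    have s2 := sq_sign (l'.choose 2)
    simp only [Multiset.map_zero, Multiset.prod_zero, prod_const_one]
    generalize (-1 : ℚ) ^ (l' * Y.card) = e1 at *
    generalize (-1 : ℚ) ^ (l'.choose 2) = e2 at *
    generalize ev (shp (shp θ τ (ps (U ∩ Ω).val)) τ (ps ((U ∩ A) \ Y).val)) F = f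
    generalize ∏ x ∈ Y, ∏ x_1 ∈ A \ U, (x - x_1) = a1 at *
    generalize ∏ x ∈ Y, ∏ x_1 ∈ A \ U, (x - x_1)⁻¹ = a2 at *
    generalize ∏ x ∈ (U ∩ A) \ Y, ∏ x_1 ∈ Ω \ U, (x - x_1) = b1 at *
    generalize ∏ x ∈ (U ∩ A) \ Y, ∏ x_1 ∈ Ω \ U, (x - x_1)⁻¹ = b2 at *
    generalize ∏ x ∈ Y, ∏ x_1 ∈ Ω \ U, (x - x_1) = d1 at *
    generalize ∏ x ∈ Y, ∏ x_1 ∈ (U ∩ A) \ Y, (x - x_1)⁻¹ = d2 at *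
    calc a1 * d1 * (a2 * d2) * f = (a1 * a2) * d1 * d2 * f := by ring
      _ = d1 * d2 * f * 1 * 1 * 1 := by rw [c1]; ring
      _ = d1 * d2 * f * (e1 * e1) * (e2 * e2) * (b1 * b2) := by rw [s1, s2, c2]
      _ = _ := by ring
lemma loc_right (A Ω U : Finset ℚ) (hAΩ : Disjoint A Ω) (hU : U ⊆ A ∪ Ω) (τ : ι → ℚ)
    (θ : ι → ℕ → ℚ) (F : Lam ι) (j : ℤ) (j' : ℕ) (hj : j = j' + (U ∩ Ω).card) :
    ∑ Y ∈ pcz Ω j, (∏ u ∈ U, ∏ x ∈ Ω \ Y, (u - x)) * WW Ω Y * ev (shp θ τ (ps Y.val)) F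
    = (∏ y ∈ U ∩ A, ∏ x ∈ Ω \ U, (y - x)) * (-1) ^ ((U ∩ A).card * j') * (-1) ^ (j'.choose 2) *
      SS τ (U ∩ A) (Ω \ U) 0 (shp θ τ (ps (U ∩ Ω).val)) 0 j' F := by
  have hdis : Disjoint (U ∩ A) (Ω \ U) := by
    rw [disjoint_left]; intro x hx; simp at hx ⊢; tauto
  rw [SS]
  simp only [powersetCard_zero, sum_singleton, Finset.empty_union]
  rw [mul_sum]
  symm
  have hdD : ∀ Z ⊆ Ω \ U, Disjoint Z (U ∩ Ω) := by
    intro Z hZ; rw [disjoint_left]; intro x hx; have := hZ hx; simp at this ⊢; tauto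
  have hterm : ∀ Z ∈ Finset.powersetCard j' (Ω \ U),
      (∏ y ∈ U ∩ A, ∏ x ∈ Ω \ U, (y - x)) * (-1) ^ ((U ∩ A).card * j') * (-1) ^ (j'.choose 2) *
        tm τ (U ∩ A ∪ Ω \ U) 0 (shp θ τ (ps (U ∩ Ω).val)) Z F =
      (∏ u ∈ U, ∏ x ∈ Ω \ (Z ∪ (U ∩ Ω)), (u - x)) * WW Ω (Z ∪ (U ∩ Ω)) *
        ev (shp θ τ (ps (Z ∪ (U ∩ Ω)).val)) F := by
    intro Z hZ
    rw [mem_powersetCard] at hZ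
    obtain ⟨hZ, hZc⟩ := hZ
    have hdZ := hdD Z hZ
    have hpt : shp θ τ (ps (Z ∪ (U ∩ Ω)).val) = shp (shp θ τ (ps (U ∩ Ω).val)) τ (ps Z.val) := by
      funext j s
      simp only [shp]
      have : ps (Z ∪ (U ∩ Ω)).val s = ps (U ∩ Ω).val s + ps Z.val s := by
        rw [ps_finset, ps_finset, ps_finset, sum_union hdZ, add_comm]
      rw [this]; ring
    have hs1 : Ω \ (Z ∪ (U ∩ Ω)) = (Ω \ U) \ Z := by
      ext x; simp; tauto
    have hs2 : (U ∩ A ∪ Ω \ U) \ Z = (U ∩ A) ∪ ((Ω \ U) \ Z) := by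
      ext x; have h1 := @hZ x; simp at h1 ⊢; tauto
    have hd2 : Disjoint (U ∩ A) ((Ω \ U) \ Z) := hdis.mono_right sdiff_subset
    have hs3 : U = (U ∩ A) ∪ (U ∩ Ω) := by
      ext x; have := @hU x; simp at this ⊢; tauto
    have hd3 : Disjoint (U ∩ A) (U ∩ Ω) := hAΩ.mono inter_subset_right inter_subset_right
    have hp3 : ∏ u ∈ U, ∏ x ∈ (Ω \ U) \ Z, (u - x) = (∏ u ∈ U ∩ A, ∏ x ∈ (Ω \ U) \ Z, (u - x)) *
        ∏ u ∈ U ∩ Ω, ∏ x ∈ (Ω \ U) \ Z, (u - x) := by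
      rw [← prod_union hd3, ← hs3]
    have c1 := prod_inv_cancel (Y := U ∩ Ω) (Z := (Ω \ U) \ Z) (by
      rw [disjoint_left]; intro x hx; simp at hx ⊢; tauto)
    have c2 := prod_inv_cancel (Y := U ∩ A) (Z := Z) (hdis.mono_right hZ)
    have c3 := prod_inv_swap Z (U ∩ A)
    rw [hZc, mul_comm j'] at c3
    have c4 : ∏ y ∈ U ∩ A, ∏ x ∈ Ω \ U, (y - x) = (∏ y ∈ U ∩ A, ∏ x ∈ (Ω \ U) \ Z, (y - x)) *
        ∏ y ∈ U ∩ A, ∏ x ∈ Z, (y - x) := by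
      rw [← prod_mul_distrib]
      exact prod_congr rfl fun y _ => (prod_sdiff hZ).symm
    rw [tm, hZc, hpt]
    unfold WW
    rw [hs1, hs2, hp3, c4, prod_union hdZ]
    simp only [prod_union hd2, prod_mul_distrib]
    rw [c3]
    have s1 := sq_sign ((U ∩ A).card * j')
    have s2 := sq_sign (j'.choose 2)
    simp only [Multiset.map_zero, Multiset.prod_zero, prod_const_one]
    generalize (-1 : ℚ) ^ ((U ∩ A).card * j') = e1 at *
    generalize (-1 : ℚ) ^ (j'.choose 2) = e2 at *
    generalize ev (shp (shp θ τ (ps (U ∩ Ω).val)) τ (ps Z.val)) F = f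
    generalize ∏ x ∈ U ∩ Ω, ∏ x_1 ∈ (Ω \ U) \ Z, (x - x_1) = a1 at *
    generalize ∏ x ∈ U ∩ Ω, ∏ x_1 ∈ (Ω \ U) \ Z, (x - x_1)⁻¹ = a2 at *
    generalize ∏ x ∈ U ∩ A, ∏ x_1 ∈ Z, (x - x_1) = b1 at *
    generalize ∏ x ∈ U ∩ A, ∏ x_1 ∈ Z, (x - x_1)⁻¹ = b2 at *
    generalize ∏ x ∈ U ∩ A, ∏ x_1 ∈ (Ω \ U) \ Z, (x - x_1) = d1 at *
    generalize ∏ x ∈ Z, ∏ x_1 ∈ (Ω \ U) \ Z, (x - x_1)⁻¹ = d2 at *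
    calc _ = d1 * d2 * f * (e1 * e1) * (e2 * e2) * (b1 * b2) := by ring
      _ = d1 * d2 * f * (a1 * a2) := by rw [s1, s2, c2, c1]; ring
      _ = _ := by ring
  refine Finset.sum_bij_ne_zero (fun Z _ _ => Z ∪ (U ∩ Ω)) ?_ ?_ ?_ ?_
  · intro Z hZ _
    rw [mem_powersetCard] at hZ
    rw [mem_pcz]
    refine ⟨Finset.union_subset (hZ.1.trans sdiff_subset) inter_subset_right, ?_⟩
    rw [card_union_of_disjoint (hdD Z hZ.1), hZ.2, hj]; push_cast; ring
  · intro Z hZ _ Z' hZ' _ h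
    rw [mem_powersetCard] at hZ hZ'
    have e : ∀ Z ⊆ Ω \ U, (Z ∪ (U ∩ Ω)) \ (U ∩ Ω) = Z := fun Z hZ => by
      rw [Finset.union_sdiff_right, Finset.sdiff_eq_self_of_disjoint (hdD Z hZ)]
    rw [← e Z hZ.1, h, e Z' hZ'.1]
  · intro Y hY hne
    rw [mem_pcz] at hY
    have hDY : U ∩ Ω ⊆ Y := by
      intro x hx
      by_contra hxY
      apply hne
      rw [mem_inter] at hx
      rw [prod_eq_zero hx.1]
      · simp
      · apply prod_eq_zero (i := x)
        · simp [hx.2, hxY]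
        · simp
    have hZ : Y \ (U ∩ Ω) ∈ Finset.powersetCard j' (Ω \ U) := by
      rw [mem_powersetCard]
      refine ⟨?_, ?_⟩
      · intro x hx; have := @hY.1 x; simp at hx this ⊢; tauto
      · have := card_sdiff_add_card_eq_card hDY; omega
    have hE : Y \ (U ∩ Ω) ∪ (U ∩ Ω) = Y := Finset.sdiff_union_of_subset hDY
    refine ⟨Y \ (U ∩ Ω), hZ, ?_, hE⟩
    intro h0
    apply hne
    have := hterm _ hZ
    rw [hE] at this
    rw [← this]; exact h0
  · intro Z hZ _
    exact hterm Z hZ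
lemma loc_left_zero (A Ω U Y : Finset ℚ) (hY : Y ⊆ A) (h : (U ∩ A).card < Y.card) :
    (∏ y ∈ Y, ∏ x ∈ (A ∪ Ω) \ U, (y - x)) = 0 := by
  have : ¬ Y ⊆ U := fun h' => absurd (card_le_card (Finset.subset_inter h' hY)) (by omega)
  obtain ⟨y, hy, hyU⟩ := not_subset.mp this
  refine prod_eq_zero hy (prod_eq_zero (i := y) ?_ (sub_self y))
  simp [hyU, hY hy]
lemma loc_right_zero (Ω U Y : Finset ℚ) (h : Y.card < (U ∩ Ω).card) :
    (∏ u ∈ U, ∏ x ∈ Ω \ Y, (u - x)) = 0 := by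
  have : ¬ U ∩ Ω ⊆ Y := fun h' => absurd (card_le_card h') (by omega)
  obtain ⟨y, hy, hyU⟩ := not_subset.mp this
  rw [mem_inter] at hy
  refine prod_eq_zero hy.1 (prod_eq_zero (i := y) ?_ (sub_self y))
  simp [hyU, hy.2]
noncomputable def locF (τ ℓ : ι → ℚ) (l u w : ℤ) (c : ℕ) (F : Lam ι) : Lam ι :=
  ((-1 : ℚ) ^ (c * (l.toNat + u.toNat + 1) + (c + 1).choose 2)) • Epow τ ℓ (2 * l - u - w) c F
lemma locF_zero (τ ℓ : ι → ℚ) (l u w : ℤ) (F : Lam ι) : locF τ ℓ l u w 0 F = F := by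
  simp [locF, Epow]
lemma neg_one_pow_eq {a b : ℕ} (h : a % 2 = b % 2) : (-1 : ℚ) ^ a = (-1) ^ b := by
  rw [neg_one_pow_eq_pow_mod_two, h, ← neg_one_pow_eq_pow_mod_two]
lemma sign_aux (b c m : ℕ) :
    (-1 : ℚ) ^ ((m + c) * (b + (m + c)) + (m + c).choose 2) * (-1) ^ m =
    (-1) ^ (c * (b + (m + c) + 1) + (c + 1).choose 2) * ((-1) ^ (b * m) * (-1) ^ (m.choose 2)) := by
  rw [← pow_add, ← pow_add, ← pow_add]
  apply neg_one_pow_eq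
  induction c with
  | zero => simp; ring_nf; rcases Nat.even_or_odd' m with ⟨k, rfl | rfl⟩ <;> ring_nf <;> omega
  | succ c ih =>
    have h1 : (m + (c + 1)).choose 2 = (m + c) + (m + c).choose 2 := by
      rw [← add_assoc, Nat.choose_succ_succ' (m + c) 1]; simp
    have h2 : (c + 1 + 1).choose 2 = (c + 1) + (c + 1).choose 2 := by
      rw [Nat.choose_succ_succ' (c + 1) 1]; simp
    rw [h1, h2]
    generalize (m + c).choose 2 = x at *
    generalize (c + 1).choose 2 = y at *
    generalize m.choose 2 = z at *
    have e1 : (m + (c + 1)) * (b + (m + (c + 1))) + (m + c + x) + m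
      = ((m + c) * (b + (m + c)) + x + m) + (b + 3 * (m + c) + 1) := by ring
    have e2 : (c + 1) * (b + (m + (c + 1)) + 1) + (c + 1 + y) + (b * m + z)
      = (c * (b + (m + c) + 1) + y + (b * m + z)) + (b + m + 3 * c + 3) := by ring
    rw [e1, e2]; omega
lemma LOC (A Ω U : Finset ℚ) (hAΩ : Disjoint A Ω) (hU : U ⊆ A ∪ Ω) (τ ℓ : ι → ℚ)
    (hτ : ∑ j, ℓ j * τ j = 2) (θ : ι → ℕ → ℚ)
    (h : ∀ k, ∑ j, ℓ j * θ j k = - ps U.val k - ps Ω.val k) (l : ℤ) (F : Lam ι) :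
    ∑ Y ∈ pcz A (U.card - l), (∏ y ∈ Y, ∏ x ∈ (A ∪ Ω) \ U, (y - x)) * WW A Y *
      ev (shp θ τ (fun s => ps U.val s - ps Y.val s)) F
    = ∑ c ∈ Finset.range (l.toNat + 1), ∑ Y ∈ pcz Ω (l - c),
      (∏ u ∈ U, ∏ x ∈ Ω \ Y, (u - x)) * WW Ω Y *
        ev (shp θ τ (ps Y.val)) (locF τ ℓ l U.card Ω.card c F) := by
  have hcU : (U ∩ A).card + (U ∩ Ω).card = U.card := by
    rw [← card_union_of_disjoint (hAΩ.mono inter_subset_right inter_subset_right),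
      ← Finset.inter_union_distrib_left, Finset.inter_eq_left.mpr hU]
  have hcΩ : (Ω \ U).card + (U ∩ Ω).card = Ω.card := by
    rw [Finset.inter_comm]; exact Finset.card_sdiff_add_card_inter _ _
  have hz : ∀ c : ℕ, l - c < (U ∩ Ω).card → ∑ Y ∈ pcz Ω (l - c),
      (∏ u ∈ U, ∏ x ∈ Ω \ Y, (u - x)) * WW Ω Y *
        ev (shp θ τ (ps Y.val)) (locF τ ℓ l U.card Ω.card c F) = 0 := by
    intro c hc
    apply sum_eq_zero; intro Y hY
    rw [mem_pcz] at hY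
    rw [loc_right_zero _ _ _ (by omega)]; simp
  by_cases hl : l < (U ∩ Ω).card
  · rw [sum_eq_zero, sum_eq_zero]
    · intro c _; exact hz c (by omega)
    · intro Y hY
      rw [mem_pcz] at hY
      rw [loc_left_zero _ _ _ _ hY.1 (by omega)]; simp
  obtain ⟨l', hl'⟩ : ∃ l' : ℕ, l = l' + (U ∩ Ω).card := ⟨(l - (U ∩ Ω).card).toNat, by omega⟩
  rw [loc_left A Ω U hAΩ hU τ θ F _ l' (by omega)]
  have hdis : Disjoint (U ∩ A) (Ω \ U) := by
    rw [disjoint_left]; intro x hx; simp at hx ⊢; tauto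
  have hR : (U ∩ A ∪ Ω \ U).card = (U ∩ A).card + (Ω \ U).card := card_union_of_disjoint hdis
  have hyb := SS_hybrid τ ℓ hτ (U ∩ A) (Ω \ U) hdis 0 (shp θ τ (ps (U ∩ Ω).val)) (by
    intro k
    have e1 : ps U.val k = ps (U ∩ A).val k + ps (U ∩ Ω).val k := by
      rw [ps_finset, ps_finset, ps_finset, ← sum_union
        (hAΩ.mono inter_subset_right inter_subset_right),
        ← Finset.inter_union_distrib_left, Finset.inter_eq_left.mpr hU]
    have e2 : ps (Ω \ U).val k = ps Ω.val k - ps (U ∩ Ω).val k := by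
      rw [← ps_sdiff inter_subset_right]
      congr 2; ext x; simp
    have e3 : ps (U ∩ A ∪ Ω \ U).val k = ps (U ∩ A).val k + ps (Ω \ U).val k := by
      rw [ps_finset, ps_finset, ps_finset, sum_union hdis]
    simp only [shp, mul_add, sum_add_distrib]
    rw [h k, e3, e2, e1, ps_zero]
    have : ∑ x, ℓ x * (τ x * ps (U ∩ Ω).val k) = 2 * ps (U ∩ Ω).val k := by
      rw [← hτ, sum_mul]; simp [mul_assoc]
    rw [this]; simp; ring) _ rfl l' 0 F
  have hd : (((0 : Multiset ℚ).card : ℤ) - ((U ∩ A ∪ Ω \ U).card : ℤ) + 2 * ((l' + 0 : ℕ) : ℤ)) = 2 * l - U.card - Ω.card := by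
    rw [hR]; push_cast; simp; omega
  rw [hd] at hyb
  have hs : (∏ y ∈ U ∩ A, ∏ x ∈ Ω \ U, (y - x)) * (-1) ^ (l' * ((U ∩ A).card - l')) * (-1) ^ (l'.choose 2) *
      SS τ (U ∩ A) (Ω \ U) 0 (shp θ τ (ps (U ∩ Ω).val)) l' 0 F =
      (∏ y ∈ U ∩ A, ∏ x ∈ Ω \ U, (y - x)) * (-1) ^ (l' * ((U ∩ A).card + l') + l'.choose 2) *
      SS τ (U ∩ A) (Ω \ U) 0 (shp θ τ (ps (U ∩ Ω).val)) l' 0 F := by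
    by_cases hb : l' ≤ (U ∩ A).card
    · rw [pow_add, ← mul_assoc]
      congr 3
      apply neg_one_pow_eq
      obtain ⟨k, hk⟩ := Nat.exists_eq_add_of_le hb
      rw [hk, Nat.add_sub_cancel_left, show l' * (l' + k + l') = l' * k + 2 * (l' * l') by ring]; omega
    · rw [SS, Finset.powersetCard_eq_empty.mpr (by omega)]; simp
  rw [hs, hyb]
  have hrange : l'+1 ≤ l.toNat + 1 := by omega
  rw [← sum_subset (Finset.range_subset_range.mpr hrange)]
  swap
  · intro c _ hc
    rw [mem_range] at hc
    exact hz c (by omega)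
  rw [mul_sum]
  apply sum_congr rfl
  intro c hc
  rw [mem_range] at hc
  obtain ⟨m, rfl⟩ : ∃ m, l' = m + c := ⟨l' - c, by omega⟩
  rw [loc_right A Ω U hAΩ hU τ θ _ (l - c) m (by push_cast at hl'; omega)]
  rw [locF, SS_smul, Nat.add_sub_cancel, show m + c + 0 - c = m by omega]
  have hsg := sign_aux (U ∩ A).card c m
  have : (-1 : ℚ) ^ (c * (l.toNat + (U.card : ℤ).toNat + 1) + (c + 1).choose 2) =
      (-1) ^ (c * ((U ∩ A).card + (m + c) + 1) + (c + 1).choose 2) := by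
    apply neg_one_pow_eq
    have : l.toNat + (U.card : ℤ).toNat + 1 = ((U ∩ A).card + (m + c) + 1) + 2 * (U ∩ Ω).card := by omega
    rw [this, mul_add, show c * (2 * (U ∩ Ω).card) = 2 * (c * (U ∩ Ω).card) by ring]; omega
  rw [this]
  simp only [add_zero, Nat.choose_zero_right, Nat.cast_one, mul_one]
  linear_combination (∏ y ∈ U ∩ A, ∏ x ∈ Ω \ U, (y - x)) * SS τ (U ∩ A) (Ω \ U) 0 (shp θ τ (ps (U ∩ Ω).val)) 0 m (Epow τ ℓ (2 * l - U.card - Ω.card) c F) * hsg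
end Loc
noncomputable def inA (Q : FinQuiver n) (i : Fin n) : Finset Q.Arr := Finset.univ.filter (fun a => Q.hd a = i)
lemma mem_inA {Q : FinQuiver n} {i : Fin n} {a : Q.Arr} : a ∈ inA Q i ↔ Q.hd a = i := by simp [inA]
noncomputable def zsum {M : Type} [AddCommGroup M] (Q : FinQuiver n) (i : Fin n) (α : Fin n → M) : M :=
  ∑ a ∈ inA Q i, α (Q.tl a)
noncomputable def refl {M : Type} [AddCommGroup M] (Q : FinQuiver n) (i : Fin n) (α : Fin n → M) : Fin n → M :=
  Function.update α i (zsum Q i α - α i)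
def Sink (Q : FinQuiver n) (i : Fin n) : Prop := ∀ a, Q.tl a ≠ i
/-- reflected quiver -/
noncomputable def rq (Q : FinQuiver n) (i : Fin n) : FinQuiver n where
  Arr := Q.Arr
  hd a := if Q.hd a = i then Q.tl a else Q.hd a
  tl a := if Q.hd a = i then i else Q.tl a
lemma zsum_congr {M : Type} [AddCommGroup M] {Q : FinQuiver n} {i : Fin n} (hs : Sink Q i) {α β : Fin n → M}
    (h : ∀ j, j ≠ i → α j = β j) : zsum Q i α = zsum Q i β :=
  sum_congr rfl fun a _ => h _ (hs a)
lemma refl_same {M : Type} [AddCommGroup M] (Q : FinQuiver n) (i : Fin n) (α : Fin n → M) :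
    refl Q i α i = zsum Q i α - α i := by simp [refl]
lemma refl_ne {M : Type} [AddCommGroup M] (Q : FinQuiver n) {i j : Fin n} (h : j ≠ i) (α : Fin n → M) :
    refl Q i α j = α j := by simp [refl, h]
lemma refl_refl {M : Type} [AddCommGroup M] {Q : FinQuiver n} {i : Fin n} (hs : Sink Q i) (α : Fin n → M) :
    refl Q i (refl Q i α) = α := by
  funext j
  by_cases h : j = i
  · subst h
    rw [refl_same, refl_same, zsum_congr hs (β := α) (fun k hk => refl_ne Q hk α)]; abel
  · rw [refl_ne Q h, refl_ne Q h]
lemma refl_add {M : Type} [AddCommGroup M] (Q : FinQuiver n) (i : Fin n) (α β : Fin n → M) :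
    refl Q i (α + β) = refl Q i α + refl Q i β := by
  funext j
  by_cases h : j = i
  · subst h
    simp only [Pi.add_apply, refl_same, zsum, sum_add_distrib]; abel
  · simp [refl_ne Q h]
noncomputable def sLam (Q : FinQuiver n) (i : Fin n) : L1 n →ₐ[ℚ] L1 n :=
  aeval (fun p => refl Q i (fun j => (X (j, p.2) : L1 n)) p.1)
noncomputable def s2 (Q : FinQuiver n) (i : Fin n) : L2 n →ₐ[ℚ] L2 n :=
  aeval (fun p => Sum.elim (fun j => refl Q i (fun j => (X (inl j, p.2) : L2 n)) j)
    (fun j => refl Q i (fun j => (X (inr j, p.2) : L2 n)) j) p.1)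
lemma refl_apply {M N : Type} [AddCommGroup M] [AddCommGroup N] (f : M →+ N) (Q : FinQuiver n) (i : Fin n)
    (α : Fin n → M) (j : Fin n) : f (refl Q i α j) = refl Q i (fun j => f (α j)) j := by
  by_cases h : j = i
  · subst h; simp [refl_same, zsum]
  · simp [refl_ne Q h]
lemma ev_sLam (Q : FinQuiver n) (i : Fin n) (v : Fin n → ℕ → ℚ) (a : L1 n) :
    ev v (sLam Q i a) = ev (refl Q i v) a := by
  have : (ev v).comp (sLam Q i) = ev (refl Q i v) := by
    apply MvPolynomial.algHom_ext
    rintro ⟨j, k⟩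
    have e1 := refl_apply (ev v : L1 n →+ ℚ) Q i (fun j => X (j, k)) j
    have e2 := refl_apply (Pi.evalAddMonoidHom (fun _ : ℕ => ℚ) k) Q i v j
    simp [sLam] at e1 e2 ⊢
    rw [e1, e2]
  exact DFunLike.congr_fun this a
lemma ev_s2 (Q : FinQuiver n) (i : Fin n) (v w : Fin n → ℕ → ℚ) (a : L2 n) :
    ev (Sum.elim v w) (s2 Q i a) = ev (Sum.elim (refl Q i v) (refl Q i w)) a := by
  have : (ev (Sum.elim v w)).comp (s2 Q i) = ev (Sum.elim (refl Q i v) (refl Q i w)) := by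
    apply MvPolynomial.algHom_ext
    rintro ⟨j | j, k⟩
    · have e1 := refl_apply (ev (Sum.elim v w) : L2 n →+ ℚ) Q i (fun j => X (inl j, k)) j
      have e2 := refl_apply (Pi.evalAddMonoidHom (fun _ : ℕ => ℚ) k) Q i v j
      simp [s2] at e1 e2 ⊢
      rw [e1, e2]
    · have e1 := refl_apply (ev (Sum.elim v w) : L2 n →+ ℚ) Q i (fun j => X (inr j, k)) j
      have e2 := refl_apply (Pi.evalAddMonoidHom (fun _ : ℕ => ℚ) k) Q i w j
      simp [s2] at e1 e2 ⊢
      rw [e1, e2]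
  exact DFunLike.congr_fun this a
lemma ev_ext {ι : Type} {a b : Lam ι} (h : ∀ θ, ev θ a = ev θ b) : a = b := by
  apply MvPolynomial.funext
  intro x
  have := h (fun i k => x (i, k))
  simpa [ev, MvPolynomial.aeval_eq_eval] using this
lemma sLam_sLam {Q : FinQuiver n} {i : Fin n} (hs : Sink Q i) (a : L1 n) : sLam Q i (sLam Q i a) = a :=
  ev_ext fun θ => by rw [ev_sLam, ev_sLam, refl_refl hs]
def eZ (i : Fin n) : Fin n → ℤ := Pi.single i 1
/-- disjoint union of the finsets at tails of arrows into `i` -/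
noncomputable def zset (Q : FinQuiver n) (i : Fin n) (ω : Fin n → Finset ℚ) : Finset ℚ :=
  (inA Q i).biUnion (fun a => ω (Q.tl a))
noncomputable def tauI (i : Fin n) : Fin n ⊕ Fin n → ℚ := Pi.single (inr i) 1
noncomputable def ellI (Q : FinQuiver n) (i : Fin n) : Fin n ⊕ Fin n → ℚ :=
  2 • Pi.single (inr i) 1 - Pi.single (inl i) 1 - ∑ a ∈ inA Q i, Pi.single (inr (Q.tl a)) 1
lemma single_dot {ι : Type} [Fintype ι] [DecidableEq ι] (i : ι) (θ : ι → ℚ) : ∑ j, (Pi.single i 1 : ι → ℚ) j * θ j = θ i := by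
  simp [Pi.single_apply]
lemma ellI_dot (Q : FinQuiver n) (i : Fin n) (θ : Fin n ⊕ Fin n → ℚ) :
    ∑ j, ellI Q i j * θ j = 2 * θ (inr i) - θ (inl i) - ∑ a ∈ inA Q i, θ (inr (Q.tl a)) := by
  have : ∀ j, ellI Q i j * θ j = 2 * ((Pi.single (inr i) 1 : Fin n ⊕ Fin n → ℚ) j * θ j)
      - (Pi.single (inl i) 1 : Fin n ⊕ Fin n → ℚ) j * θ j
      - ∑ a ∈ inA Q i, (Pi.single (inr (Q.tl a)) 1 : Fin n ⊕ Fin n → ℚ) j * θ j := by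
    intro j
    simp only [ellI, Pi.sub_apply, Pi.smul_apply, Finset.sum_apply, ← sum_mul]
    simp; ring
  simp only [this, sum_sub_distrib]
  rw [sum_comm, ← mul_sum]
  simp only [single_dot]
lemma prod_biUnion' {β : Type} [DecidableEq β] (s : Finset β) (t : β → Finset ℚ) (f : ℚ → ℚ)
    (h : ∀ a ∈ s, ∀ b ∈ s, a ≠ b → Disjoint (t a) (t b)) :
    ∏ x ∈ s.biUnion t, f x = ∏ a ∈ s, ∏ x ∈ t a, f x := Finset.prod_biUnion (fun a ha b hb hab => h a ha b hb hab)
def DisjAt (Q : FinQuiver n) (i : Fin n) (ω : Fin n → Finset ℚ) : Prop :=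
  ∀ a ∈ inA Q i, ∀ b ∈ inA Q i, a ≠ b → Disjoint (ω (Q.tl a)) (ω (Q.tl b))
lemma ps_zset {Q : FinQuiver n} {i : Fin n} {ω : Fin n → Finset ℚ} (h : DisjAt Q i ω) (k : ℕ) :
    ps (zset Q i ω).val k = ∑ a ∈ inA Q i, ps (ω (Q.tl a)).val k := by
  rw [ps_finset, zset, sum_biUnion (fun a ha b hb hab => h a ha b hb hab)]
  simp [ps_finset]
lemma card_zset {Q : FinQuiver n} {i : Fin n} {ω : Fin n → Finset ℚ} (h : DisjAt Q i ω) :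
    (zset Q i ω).card = ∑ a ∈ inA Q i, (ω (Q.tl a)).card := 
  Finset.card_biUnion (fun a ha b hb hab => h a ha b hb hab)
noncomputable def K0 (Q : FinQuiver n) (i : Fin n) (ω N : Fin n → Finset ℚ) : ℚ :=
  (∏ a ∈ Finset.univ \ inA Q i, ∏ y ∈ N (Q.hd a), ∏ x ∈ ω (Q.tl a) \ N (Q.tl a), (y - x)) *
    ∏ j ∈ Finset.univ \ {i}, WW (ω j) (N j)
lemma zset_sdiff {Q : FinQuiver n} {i : Fin n} {ω N : Fin n → Finset ℚ} (h : DisjAt Q i ω)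
    (hN : ∀ a ∈ inA Q i, N (Q.tl a) ⊆ ω (Q.tl a)) : zset Q i ω \ zset Q i N = zset Q i (fun j => ω j \ N j) := by
  ext x
  simp only [zset, mem_sdiff, mem_biUnion]
  constructor
  · rintro ⟨⟨a, ha, hx⟩, h2⟩
    exact ⟨a, ha, hx, fun hx' => h2 ⟨a, ha, hx'⟩⟩
  · rintro ⟨a, ha, hx, hx'⟩
    refine ⟨⟨a, ha, hx⟩, ?_⟩
    rintro ⟨b, hb, hxb⟩
    by_cases hab : a = b
    · subst hab; exact hx' hxb
    · exact disjoint_left.mp (h a ha b hb hab) hx (hN b hb hxb)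
lemma kern_left {Q : FinQuiver n} {i : Fin n} (hs : Sink Q i) {ω N : Fin n → Finset ℚ} (h : DisjAt Q i ω)
    (hN : ∀ j, j ≠ i → N j ⊆ ω j) (Y : Finset ℚ) :
    kern Q ω (Function.update N i Y) = K0 Q i ω N *
      ((∏ y ∈ Y, ∏ x ∈ zset Q i ω \ zset Q i N, (y - x)) * WW (ω i) Y) := by
  rw [zset_sdiff h (fun a _ => hN _ (hs a))]
  have hd : DisjAt Q i (fun j => ω j \ N j) := fun a ha b hb hab =>
    (h a ha b hb hab).mono sdiff_subset sdiff_subset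
  unfold zset
  simp only [prod_biUnion' _ _ _ hd]
  rw [prod_comm, kern, arr, K0, ← prod_sdiff (subset_univ (inA Q i)),
    ← prod_sdiff (subset_univ {i})]
  simp only [Finset.prod_singleton, update_self]
  have e1 : ∏ a ∈ inA Q i, ∏ y ∈ Function.update N i Y (Q.hd a),
      ∏ x ∈ ω (Q.tl a) \ Function.update N i Y (Q.tl a), (y - x) =
      ∏ a ∈ inA Q i, ∏ y ∈ Y, ∏ x ∈ ω (Q.tl a) \ N (Q.tl a), (y - x) := by
    apply prod_congr rfl; intro a ha
    rw [mem_inA.mp ha, update_self, update_of_ne (hs a)]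
  have e2 : ∏ a ∈ Finset.univ \ inA Q i, ∏ y ∈ Function.update N i Y (Q.hd a),
      ∏ x ∈ ω (Q.tl a) \ Function.update N i Y (Q.tl a), (y - x) =
      ∏ a ∈ Finset.univ \ inA Q i, ∏ y ∈ N (Q.hd a), ∏ x ∈ ω (Q.tl a) \ N (Q.tl a), (y - x) := by
    apply prod_congr rfl; intro a ha
    have : Q.hd a ≠ i := by simpa [mem_inA] using ha
    rw [update_of_ne this, update_of_ne (hs a)]
  have e3 : ∏ j ∈ Finset.univ \ {i}, WW (ω j) (Function.update N i Y j) = ∏ j ∈ Finset.univ \ {i}, WW (ω j) (N j) := by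
    apply prod_congr rfl; intro a ha
    have : a ≠ i := by simpa using ha
    rw [update_of_ne this]
  rw [e1, e2, e3]; ring
lemma kern_right {Q : FinQuiver n} {i : Fin n} (hs : Sink Q i) {ω N : Fin n → Finset ℚ} (h : DisjAt Q i ω)
    (hN : ∀ j, j ≠ i → N j ⊆ ω j) (Ω Y : Finset ℚ) :
    kern (rq Q i) (Function.update ω i Ω) (Function.update N i Y) = K0 Q i ω N *
      ((∏ u ∈ zset Q i N, ∏ x ∈ Ω \ Y, (u - x)) * WW Ω Y) := by
  have hd : DisjAt Q i N := fun a ha b hb hab =>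
    (h a ha b hb hab).mono (hN _ (hs a)) (hN _ (hs b))
  unfold zset
  rw [prod_biUnion' _ _ _ hd, kern, arr, K0, ← prod_sdiff (subset_univ {i})]
  have hp := fun f : Q.Arr → ℚ => (prod_sdiff (f := f) (subset_univ (inA Q i))).symm
  simp only [Finset.prod_singleton, update_self]
  have e1 : ∏ a ∈ inA Q i, ∏ y ∈ Function.update N i Y ((rq Q i).hd a),
      ∏ x ∈ Function.update ω i Ω ((rq Q i).tl a) \ Function.update N i Y ((rq Q i).tl a), (y - x) =
      ∏ a ∈ inA Q i, ∏ y ∈ N (Q.tl a), ∏ x ∈ Ω \ Y, (y - x) := by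
    apply prod_congr rfl; intro a ha
    have e := mem_inA.mp ha
    simp only [rq, if_pos e]
    rw [update_self, update_self, update_of_ne (hs a)]
  have e2 : ∏ a ∈ Finset.univ \ inA Q i, ∏ y ∈ Function.update N i Y ((rq Q i).hd a),
      ∏ x ∈ Function.update ω i Ω ((rq Q i).tl a) \ Function.update N i Y ((rq Q i).tl a), (y - x) =
      ∏ a ∈ Finset.univ \ inA Q i, ∏ y ∈ N (Q.hd a), ∏ x ∈ ω (Q.tl a) \ N (Q.tl a), (y - x) := by
    apply prod_congr rfl; intro a ha
    have e : Q.hd a ≠ i := by simpa [mem_inA] using ha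
    simp only [rq, if_neg e]
    rw [update_of_ne e, update_of_ne (hs a), update_of_ne (hs a)]
  have e3 : ∏ j ∈ Finset.univ \ {i}, WW (Function.update ω i Ω j) (Function.update N i Y j) = ∏ j ∈ Finset.univ \ {i}, WW (ω j) (N j) := by
    apply prod_congr rfl; intro a ha
    have : a ≠ i := by simpa using ha
    rw [update_of_ne this, update_of_ne this]
  rw [e3]
  refine Eq.trans (congrArg₂ (· * ·) ((hp _).trans (congrArg₂ (· * ·) e2 e1)) rfl) ?_
  ring
lemma refl_psv {Q : FinQuiver n} {i : Fin n} {ω : Fin n → Finset ℚ} (h : DisjAt Q i ω)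
    (hsub : ω i ⊆ zset Q i ω) :
    psv (Function.update ω i (zset Q i ω \ ω i)) = refl Q i (psv ω) := by
  rw [psv_update, refl]
  congr 1
  funext k
  rw [ps_sdiff hsub, ps_zset h]
  simp [zsum, psv]
theorem Isum_refl {Q : FinQuiver n} {i : Fin n} (hs : Sink Q i) {ω : Fin n → Finset ℚ} (h : DisjAt Q i ω)
    (hsub : ω i ⊆ zset Q i ω) (δ : Fin n → ℤ) (G : L2 n) :
    Isum Q ω δ G = ∑ c ∈ Finset.range ((refl Q i δ i).toNat + 1),
      Isum (rq Q i) (Function.update ω i (zset Q i ω \ ω i))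
        (refl Q i δ - (c : ℤ) • eZ i)
        (locF (tauI i) (ellI Q i) (refl Q i δ i) (zsum Q i δ) ((zset Q i ω).card - (ω i).card) c (s2 Q i G)) := by
  unfold Isum subs
  rw [sum_piFinset_update _ i ∅]
  have hR : ∀ c : ℕ, ∀ f : (Fin n → Finset ℚ) → ℚ, ∑ N ∈ Fintype.piFinset (fun j => pcz (Function.update ω i (zset Q i ω \ ω i) j)
      ((refl Q i δ - (c : ℤ) • eZ i) j)), f N =
      ∑ N ∈ Fintype.piFinset (Function.update (fun i => pcz (ω i) (δ i)) i {∅}),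
        ∑ Y ∈ pcz (zset Q i ω \ ω i) (refl Q i δ i - c), f (Function.update N i Y) := by
    intro c f
    rw [sum_piFinset_update _ i ∅]
    congr 1
    · congr 1
      funext j
      by_cases hj : j = i
      · subst hj; simp
      · simp [hj, refl_ne Q hj, eZ]
    · simp [eZ]
  simp only [hR]
  rw [sum_comm (s := Finset.range _)]
  apply sum_congr rfl
  intro N hN
  rw [Fintype.mem_piFinset] at hN
  have hNj : ∀ j, j ≠ i → N j ⊆ ω j ∧ ((N j).card : ℤ) = δ j := by
    intro j hj
    have := hN j
    rw [update_of_ne hj, mem_pcz] at this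
    exact this
  have hNi : N i = ∅ := by have := hN i; simpa using this
  have hdN : DisjAt Q i N := fun a ha b hb hab =>
    (h a ha b hb hab).mono (hNj _ (hs a)).1 (hNj _ (hs b)).1
  have hAΩ : Disjoint (ω i) (zset Q i ω \ ω i) := Finset.disjoint_sdiff
  have hun : ω i ∪ (zset Q i ω \ ω i) = zset Q i ω := Finset.union_sdiff_of_subset hsub
  have hUsub : zset Q i N ⊆ zset Q i ω := by
    apply Finset.biUnion_subset_biUnion_of_subset_left _ (Finset.Subset.refl _) |>.trans
    intro x hx
    rw [mem_biUnion] at hx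
    obtain ⟨a, ha, hx⟩ := hx
    exact mem_biUnion.mpr ⟨a, ha, (hNj _ (hs a)).1 hx⟩
  have hUc : ((zset Q i N).card : ℤ) = zsum Q i δ := by
    rw [card_zset hdN, zsum]; push_cast
    exact sum_congr rfl fun a _ => (hNj _ (hs a)).2
  have hΩc : ((zset Q i ω \ ω i).card : ℤ) = (zset Q i ω).card - (ω i).card := by
    have := card_sdiff_add_card_eq_card hsub; omega
  have hL := LOC (ω i) (zset Q i ω \ ω i) (zset Q i N) hAΩ (by rw [hun]; exact hUsub) (tauI i) (ellI Q i)
    (by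
      rw [ellI_dot]
      have : ∀ a, Q.tl a ≠ i := hs
      simp [tauI, Pi.single_apply, this])
    (Sum.elim (refl Q i (psv ω)) (psv N)) (by
      intro k
      rw [ellI_dot]
      simp only [Sum.elim_inr, Sum.elim_inl]
      rw [← refl_psv h hsub, psv_update, update_self, ps_zset hdN]
      simp [psv, hNi, ps_zero]; ring) (refl Q i δ i) (s2 Q i G)
  rw [hun, hUc, hΩc] at hL
  have hδ : zsum Q i δ - refl Q i δ i = δ i := by rw [refl_same]; ring
  rw [hδ] at hL
  have hshp : ∀ f : ℕ → ℚ, shp (Sum.elim (refl Q i (psv ω)) (psv N)) (tauI i) f =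
      Sum.elim (refl Q i (psv ω)) (Function.update (psv N) i f) := by
    intro f
    funext j k
    rcases j with j | j
    · simp [shp, tauI]
    · by_cases hj : j = i
      · subst hj; simp [shp, tauI, psv, hNi, ps_zero]
      · simp [shp, tauI, hj]
  simp only [hshp] at hL
  have hE : ∀ Y : Finset ℚ, ev (Sum.elim (refl Q i (psv ω)) (Function.update (psv N) i
      (fun s => ps (zset Q i N).val s - ps Y.val s))) (s2 Q i G) =
      ev (Sum.elim (psv ω) (psv (Function.update N i Y))) G := by
    intro Y
    rw [ev_s2, refl_refl hs]
    congr 2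
    rw [psv_update, refl, update_self, Function.update_idem]
    rw [zsum_congr hs (β := psv N) (fun j hj => update_of_ne hj _ _)]
    congr 2
    funext k
    show zsum Q i (psv N) k - (ps (zset Q i N).val k - ps Y.val k) = ps Y.val k
    rw [ps_zset hdN]
    simp [zsum, psv]
  simp only [hE] at hL
  have hN' : ∀ j, j ≠ i → N j ⊆ ω j := fun j hj => (hNj j hj).1
  simp only [kern_left hs h hN', kern_right hs h hN', refl_psv h hsub, psv_update N]
  have hL' := congrArg (fun x => K0 Q i ω N * x) hL
  simp only [mul_sum] at hL'
  simp only [psv_update N] at hL'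
  refine Eq.trans (sum_congr rfl fun Y _ => ?_) (hL'.trans (sum_congr rfl fun c _ => sum_congr rfl fun Y _ => ?_))
  · ring
  · ring
section Ker
variable {A : Type} [CommRing A] [Algebra ℚ A]
lemma Ez_geom (p p' : ℕ → A) (x : A) (h : ∀ k, p' k = p k + x ^ (k + 1)) (M : ℕ) :
    Ez p M = ∑ l ∈ Finset.range (M + 1), Ez p' l * x ^ (M - l) := by
  have hs : ∀ d : ℤ, Ez p' d = Ez p d - x * Ez p (d - 1) := fun d => by
    rw [← Ez_add_single]; exact Ez_congr h d
  induction M with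
  | zero => simp [Ez_zero]
  | succ M ih =>
    rw [sum_range_succ, Nat.sub_self, pow_zero, mul_one, hs ((M + 1 : ℕ) : ℤ),
      show (((M + 1 : ℕ) : ℤ) - 1) = (M : ℤ) by push_cast; ring, ih]
    have : ∑ l ∈ Finset.range (M + 1), Ez p' l * x ^ (M + 1 - l) = x * ∑ l ∈ Finset.range (M + 1), Ez p' l * x ^ (M - l) := by
      rw [mul_sum]; apply sum_congr rfl; intro l hl
      rw [mem_range] at hl
      rw [show M + 1 - l = (M - l) + 1 by omega]; ring
    rw [this]; ring
noncomputable def pz (Z : Finset A) (n k : ℕ) : MvPolynomial (Fin n) A := C (ps Z.val k) - ∑ j, X j ^ (k + 1)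
noncomputable def JJ (Z : Finset A) (n : ℕ) : Ideal (MvPolynomial (Fin n) A) :=
  Ideal.span {f | ∃ d : ℤ, (Z.card : ℤ) < d + n ∧ f = Ez (pz Z n) d}
lemma JJ_le (Z : Finset A) (n : ℕ) {c : MvPolynomial (Fin n) A} (hc : c ∈ JJ Z n) :
    rename Fin.succ c ∈ JJ Z (n + 1) := by
  have : JJ Z n ≤ (JJ Z (n + 1)).comap (rename (R := A) (Fin.succ (n := n))) := by
    unfold JJ
    rw [Ideal.span_le]
    rintro _ ⟨d, hd, rfl⟩
    rw [SetLike.mem_coe, Ideal.mem_comap]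
    have e : rename Fin.succ (Ez (pz Z n) d) = Ez (fun k => pz Z (n + 1) k + X 0 ^ (k + 1)) d := by
      have := map_Ez ((rename (R := A) (Fin.succ (n := n))).restrictScalars ℚ) (pz Z n) d
      simp only [AlgHom.restrictScalars_apply] at this
      rw [this]
      apply Ez_congr; intro k
      simp [pz, Fin.sum_univ_succ]; ring
    rw [e, Ez_add_single]
    apply Ideal.sub_mem
    · exact Ideal.subset_span ⟨d, by push_cast; omega, rfl⟩
    · apply Ideal.mul_mem_left
      exact Ideal.subset_span ⟨d - 1, by push_cast; omega, rfl⟩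
  exact this hc
lemma kernel_abs [IsDomain A] (Z : Finset A) (n : ℕ) : ∀ h : MvPolynomial (Fin n) A,
    (∀ x : Fin n → A, Function.Injective x → (∀ j, x j ∈ Z) → eval x h = 0) → h ∈ JJ Z n := by
  induction n with
  | zero =>
    intro h hv
    have := hv (fun j => j.elim0) (fun j => j.elim0) (fun j => j.elim0)
    obtain ⟨c, rfl⟩ := C_surjective (Fin 0) h
    simp at this
    simp [this]
  | succ n ih =>
    intro h hv
    by_cases hn : Z.card < n + 1
    · have : JJ Z (n + 1) = ⊤ := by
        rw [Ideal.eq_top_iff_one]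
        exact Ideal.subset_span ⟨0, by push_cast; omega, (Ez_zero _).symm⟩
      rw [this]; trivial
    obtain ⟨M, hM⟩ : ∃ M, Z.card = n + (M + 1) := ⟨Z.card - n - 1, by omega⟩
    let g : Polynomial (MvPolynomial (Fin n) A) := ∑ l ∈ Finset.range (M + 1 + 1),
      Polynomial.C (Ez (pz Z n) (l : ℤ)) * Polynomial.X ^ (M + 1 - l)
    have hgm : g.Monic ∧ g.natDegree = M + 1 := by
      have : g = Polynomial.X ^ (M + 1) + ∑ l ∈ Finset.range (M + 1),
          Polynomial.C (Ez (pz Z n) ((l + 1 : ℕ) : ℤ)) * Polynomial.X ^ (M + 1 - (l + 1)) := by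
        simp only [g]
        rw [sum_range_succ']; simp [Ez_zero, add_comm]
      have hd : (∑ l ∈ Finset.range (M + 1),
          Polynomial.C (Ez (pz Z n) ((l + 1 : ℕ) : ℤ)) * Polynomial.X ^ (M + 1 - (l + 1))).degree < ((M + 1 : ℕ) : WithBot ℕ) := by
        refine lt_of_le_of_lt (Polynomial.degree_sum_le _ _) ?_
        rw [Finset.sup_lt_iff (WithBot.bot_lt_coe _)]
        intro l hl
        refine lt_of_le_of_lt (Polynomial.degree_C_mul_X_pow_le _ _) ?_
        exact_mod_cast (by omega : M + 1 - (l + 1) < M + 1)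
      rw [this]
      refine ⟨Polynomial.monic_X_pow_add hd, ?_⟩
      apply Polynomial.natDegree_eq_of_degree_eq_some
      rw [Polynomial.degree_add_eq_left_of_degree_lt]
      · simp
      · rw [Polynomial.degree_X_pow]; exact hd
    have hgs : (finSuccEquiv A n).symm g = Ez (pz Z (n + 1)) ((M + 1 : ℕ) : ℤ) := by
      rw [AlgEquiv.symm_apply_eq]
      have e := map_Ez ((finSuccEquiv A n).toAlgHom.restrictScalars ℚ)
        (pz Z (n + 1)) ((M + 1 : ℕ) : ℤ)
      have e : finSuccEquiv A n (Ez (pz Z (n + 1)) ((M + 1 : ℕ) : ℤ)) = Ez (fun k => finSuccEquiv A n (pz Z (n + 1) k)) ((M + 1 : ℕ) : ℤ) := e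
      rw [e, Ez_geom _ (fun k => Polynomial.C (pz Z n k)) Polynomial.X]
      · apply sum_congr rfl; intro l _
        congr 1
        have := map_Ez (Algebra.ofId (MvPolynomial (Fin n) A) (Polynomial (MvPolynomial (Fin n) A)) |>.restrictScalars ℚ)
          (pz Z n) (l : ℤ)
        exact this
      · intro k
        have hC : ∀ a : A, finSuccEquiv A n (C a) = Polynomial.C (C a) := fun a => by simp [finSuccEquiv_apply]
        simp only [pz, map_sub, map_sum, map_pow, Fin.sum_univ_succ, finSuccEquiv_X_zero, finSuccEquiv_X_succ, map_add, hC]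
        ring
    have hdiv := Polynomial.modByMonic_add_div (finSuccEquiv A n h) g
    set r := finSuccEquiv A n h %ₘ g with hr
    have hrz : ∀ k, r.coeff k ∈ JJ Z n := by
      intro k
      apply ih
      intro x hx hxZ
      have hr0 : r.map (eval x) = 0 := by
        let X' := Finset.univ.image x
        have hX' : X' ⊆ Z := by intro y hy; simp [X'] at hy; obtain ⟨j, rfl⟩ := hy; exact hxZ j
        have hXc : X'.card = n := by rw [card_image_of_injective _ hx]; simp
        have hZX : (Z \ X').card = M + 1 := by rw [card_sdiff_of_subset hX', hXc, hM]; omega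
        apply Polynomial.eq_zero_of_degree_lt_of_eval_finset_eq_zero (Z \ X')
        · rw [hZX, ← hgm.2]
          refine lt_of_le_of_lt (Polynomial.degree_map_le) ?_
          rw [← Polynomial.degree_eq_natDegree hgm.1.ne_zero]
          exact Polynomial.degree_modByMonic_lt _ hgm.1
        · intro z hz
          rw [mem_sdiff] at hz
          have h1 : Polynomial.eval z ((finSuccEquiv A n h).map (eval x)) = 0 := by
            rw [← eval_eq_eval_mv_eval']
            apply hv
            · rw [Fin.cons_injective_iff]
              refine ⟨?_, hx⟩
              rintro ⟨j, rfl⟩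
              exact hz.2 (by simp [X'])
            · intro j; refine Fin.cases ?_ (fun j => ?_) j
              · simpa using hz.1
              · simpa using hxZ j
          have h2 : Polynomial.eval z (g.map (eval x)) = 0 := by
            have := prod_eq_Ez (Z \ X').val z
            rw [card_val, hZX] at this
            have h0 : ((Z \ X').val.map (fun y => z - y)).prod = 0 :=
              prod_eq_zero (mem_sdiff.mpr hz) (sub_self z)
            rw [h0] at this
            rw [this]
            simp only [g, Polynomial.map_sum, Polynomial.eval_finsetSum, Polynomial.map_mul, Polynomial.map_C,
              Polynomial.map_pow, Polynomial.map_X, Polynomial.eval_mul, Polynomial.eval_C, Polynomial.eval_pow, Polynomial.eval_X]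
            apply sum_congr rfl; intro l _
            congr 1
            have e := map_Ez ((aeval x : MvPolynomial (Fin n) A →ₐ[A] A).restrictScalars ℚ) (pz Z n) (l : ℤ)
            simp only [AlgHom.restrictScalars_apply, coe_aeval_eq_eval] at e
            have e' : eval x (Ez (pz Z n) (l : ℤ)) = _ := e
            rw [e']
            apply Ez_congr; intro k
            simp only [pz, map_sub, map_sum, map_pow, aeval_C, aeval_X, Algebra.algebraMap_self, RingHom.id_apply]
            rw [ps_finset, ps_finset, ← sum_sdiff hX', sum_image (fun a _ b _ h => hx h)]
            ring
          have h3 := congrArg (fun q => Polynomial.eval z (Polynomial.map (eval x) q)) hdiv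
          simp only [Polynomial.map_add, Polynomial.map_mul, Polynomial.eval_add, Polynomial.eval_mul] at h3
          rw [h1, h2, zero_mul, add_zero] at h3
          exact h3
      rw [← Polynomial.coeff_map, hr0]; simp
    have hh : h = (finSuccEquiv A n).symm r + (finSuccEquiv A n).symm g * (finSuccEquiv A n).symm (finSuccEquiv A n h /ₘ g) := by
      rw [← map_mul, ← map_add, hdiv, AlgEquiv.symm_apply_apply]
    rw [hh]
    apply Ideal.add_mem
    · rw [Polynomial.as_sum_support_C_mul_X_pow r, map_sum]
      apply Ideal.sum_mem; intro k _
      rw [map_mul]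
      apply Ideal.mul_mem_right
      have : (finSuccEquiv A n).symm (Polynomial.C (r.coeff k)) = rename Fin.succ (r.coeff k) := by
        rw [AlgEquiv.symm_apply_eq]
        have hC : ∀ a : A, finSuccEquiv A n (C a) = Polynomial.C (C a) := fun a => by simp [finSuccEquiv_apply]
        generalize r.coeff k = c
        induction c using MvPolynomial.induction_on with
        | C a => simp [hC]
        | add p q hp hq => simp [hp, hq]
        | mul_X p i hp => simp only [map_mul, hp, rename_X, finSuccEquiv_X_succ]
      rw [this]
      exact JJ_le Z n (hrz k)
    · apply Ideal.mul_mem_right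
      rw [hgs]
      exact Ideal.subset_span ⟨_, by push_cast; omega, rfl⟩
end Ker
lemma dens {σ : Type} [Fintype σ] (P : MvPolynomial σ ℚ)
    (h : ∀ x : σ → ℚ, Function.Injective x → eval x P = 0) : P = 0 := by
  let D : MvPolynomial σ ℚ := ∏ p ∈ (Finset.univ : Finset σ).offDiag, (X p.1 - X p.2)
  have hD : D ≠ 0 := by
    rw [prod_ne_zero_iff]
    rintro ⟨a, b⟩ hab
    simp at hab
    exact sub_ne_zero.mpr (fun e => hab (X_injective e))
  have : P * D = 0 := by
    apply MvPolynomial.funext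
    intro x
    rw [map_mul, map_zero]
    by_cases hx : Function.Injective x
    · rw [h x hx, zero_mul]
    · simp only [Function.Injective, not_forall] at hx
      obtain ⟨a, b, hab, hne⟩ := hx
      have : eval x D = 0 := by
        rw [map_prod]
        apply prod_eq_zero (i := (a, b))
        · simpa using hne
        · simp [hab]
      rw [this, mul_zero]
  exact (mul_eq_zero.mp this).resolve_right hD
abbrev Bg (g : Fin n → ℕ) := MvPolynomial ((i : Fin n) × Fin (g i)) ℚ
noncomputable def pf (g : Fin n → ℕ) : L1 n →ₐ[ℚ] Bg g :=
  aeval (fun p => ∑ j : Fin (g p.1), X ⟨p.1, j⟩ ^ (p.2 + 1))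
def psf (g : Fin n → ℕ) (x : ((i : Fin n) × Fin (g i)) → ℚ) : Fin n → ℕ → ℚ :=
  fun i k => ∑ j, x ⟨i, j⟩ ^ (k + 1)
lemma eval_pf (g : Fin n → ℕ) (x : ((i : Fin n) × Fin (g i)) → ℚ) (a : L1 n) :
    eval x (pf g a) = ev (psf g x) a := by
  have : (aeval x).comp (pf g) = ev (psf g x) := by
    apply MvPolynomial.algHom_ext
    rintro ⟨i, k⟩
    simp [pf, psf]
  exact DFunLike.congr_fun this a
def RR (γ : Fin n → ℤ) : Submodule ℚ (L1 n) where
  carrier := {a | ∀ ω, pts γ ω → ev (psv ω) a = 0}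
  add_mem' := fun ha hb ω hω => by rw [map_add, ha ω hω, hb ω hω, add_zero]
  zero_mem' := fun ω _ => map_zero _
  smul_mem' := fun c a ha ω hω => by rw [map_smul, ha ω hω, smul_zero]
lemma RR_top {γ : Fin n → ℤ} {i : Fin n} (h : γ i < 0) : RR γ = ⊤ := by
  rw [eq_top_iff]; rintro a - ω hω
  have := hω i; omega
lemma RR_mul {γ : Fin n → ℤ} {a : L1 n} (h : a ∈ RR γ) (g : L1 n) : g * a ∈ RR γ := fun ω hω => by
  rw [map_mul, h ω hω, mul_zero]
lemma mem_RR_iff (g : Fin n → ℕ) (a : L1 n) : a ∈ RR (fun i => (g i : ℤ)) ↔ pf g a = 0 := by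
  constructor
  · intro h
    apply dens
    intro x hx
    rw [eval_pf]
    have hinj : ∀ i, Function.Injective (fun j : Fin (g i) => x ⟨i, j⟩) := fun i a b hab => by
      have := hx hab; simpa using this
    have := h (fun i => Finset.univ.image (fun j : Fin (g i) => x ⟨i, j⟩)) (fun i => by
      rw [card_image_of_injective _ (hinj i)]; simp)
    rw [← this]
    apply ev_congr; intro i k
    rw [psv, ps_finset, sum_image (fun a _ b _ h => hinj i h)]; rfl
  · intro h ω hω
    have hω' : ∀ i, (ω i).card = g i := fun i => Int.ofNat.inj (hω i)
    let e := fun i => (ω i).equivFinOfCardEq (hω' i)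
    have := eval_pf g (fun p => ((e p.1).symm p.2 : ℚ)) a
    rw [h, map_zero] at this
    rw [this]
    apply ev_congr; intro i k
    rw [psv, ps_finset, psf, ← Finset.sum_coe_sort (ω i)]
    rw [← Equiv.sum_comp (e i).symm]
lemma LIM {γ : Fin n → ℤ} {a : L1 n} (h : a ∈ RR γ) (m : Fin n → Multiset ℚ) (hm : ∀ i, ((m i).card : ℤ) = γ i) :
    ev (fun i => ps (m i)) a = 0 := by
  have hγ : γ = fun i => (((m i).card : ℕ) : ℤ) := funext fun i => (hm i).symm
  rw [hγ, mem_RR_iff] at h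
  have := eval_pf (fun i => (m i).card) (fun p => (m p.1).toList.get (Fin.cast (by simp) p.2)) a
  rw [h, map_zero] at this
  rw [this]
  apply ev_congr; intro i k
  rw [psf]
  have : ps (m i) k = ((m i).toList.map (fun x => x ^ (k + 1))).sum := by
    conv_lhs => rw [← (m i).coe_toList]
    simp only [ps, Multiset.map_coe, Multiset.sum_coe]
  rw [this, ← List.sum_ofFn]
  congr 1
  apply List.ext_getElem
  · simp
  · intro j h1 h2; simp
/-! symmetrization -/
section Sym
lemma sym_one {m : ℕ} (f : MvPolynomial (Fin m) ℚ) (hf : f.IsSymmetric) :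
    f ∈ Algebra.adjoin ℚ (Set.range fun k : ℕ => psum (Fin m) ℚ (k + 1)) := by
  have hes : ∀ k, esymm (Fin m) ℚ k ∈ Algebra.adjoin ℚ (Set.range fun k : ℕ => psum (Fin m) ℚ (k + 1)) := by
    intro k
    induction k using Nat.strong_induction_on with
    | _ k ih =>
      rcases k with _ | k
      · rw [esymm_zero]; exact one_mem _
      have h := mul_esymm_eq_sum (Fin m) ℚ (k + 1)
      have h2 : esymm (Fin m) ℚ (k + 1) = (1 / ((k + 1 : ℕ) : ℚ)) • (((k + 1 : ℕ) : MvPolynomial (Fin m) ℚ) * esymm (Fin m) ℚ (k + 1)) := by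
        rw [← nsmul_eq_mul, ← Nat.cast_smul_eq_nsmul ℚ, smul_smul, one_div_mul_cancel (by positivity), one_smul]
      rw [h2, h]
      apply Subalgebra.smul_mem
      apply Subalgebra.mul_mem
      · exact pow_mem (neg_mem (one_mem _)) _
      apply Subalgebra.sum_mem
      rintro ⟨a, b⟩ hab
      rw [mem_filter, Finset.HasAntidiagonal.mem_antidiagonal] at hab
      have hab1 : a + b = k + 1 := hab.1
      apply Subalgebra.mul_mem
      · apply Subalgebra.mul_mem _ (pow_mem (neg_mem (one_mem _)) _)
        exact ih a hab.2
      · apply Algebra.subset_adjoin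
        exact ⟨b - 1, by simp; congr 1; omega⟩
  obtain ⟨p, hp⟩ := esymmAlgHom_fin_surjective (R := ℚ) (le_refl m) ⟨f, hf⟩
  have hp' : aeval (fun i : Fin m => esymm (Fin m) ℚ (i + 1)) p = f := by
    rw [← esymmAlgHom_apply, hp]
  rw [← hp']
  have : (aeval (fun i : Fin m => esymm (Fin m) ℚ (i + 1)) p) ∈ (aeval (R := ℚ) (fun i : Fin m => esymm (Fin m) ℚ (i + 1))).range := ⟨p, rfl⟩
  rw [← Algebra.adjoin_range_eq_range_aeval] at this
  refine Algebra.adjoin_le ?_ this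
  rintro _ ⟨i, rfl⟩
  exact hes _
def pact {g : Fin n → ℕ} (σ : ∀ i, Equiv.Perm (Fin (g i))) : ((i : Fin n) × Fin (g i)) → ((i : Fin n) × Fin (g i)) :=
  fun p => ⟨p.1, σ p.1 p.2⟩
noncomputable def av {g : Fin n → ℕ} : Bg g →ₗ[ℚ] Bg g :=
  (1 / (Fintype.card (∀ i, Equiv.Perm (Fin (g i))) : ℚ)) •
    ∑ σ : ∀ i, Equiv.Perm (Fin (g i)), (rename (R := ℚ) (pact σ)).toLinearMap
lemma av_apply {g : Fin n → ℕ} (f : Bg g) : av f = (1 / (Fintype.card (∀ i, Equiv.Perm (Fin (g i))) : ℚ)) •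
    ∑ σ : ∀ i, Equiv.Perm (Fin (g i)), rename (pact σ) f := by simp [av]
lemma av_inv {g : Fin n → ℕ} (c f : Bg g) (hf : ∀ σ, rename (pact σ) f = f) : av (c * f) = av c * f := by
  rw [av_apply, av_apply, smul_mul_assoc, sum_mul]
  simp [hf]
lemma av_self {g : Fin n → ℕ} (f : Bg g) (hf : ∀ σ, rename (pact σ) f = f) : av f = f := by
  rw [av_apply]
  simp only [hf, Finset.sum_const, Finset.card_univ]
  rw [← Nat.cast_smul_eq_nsmul ℚ, smul_smul, one_div_mul_cancel, one_smul]
  exact Nat.cast_ne_zero.mpr Fintype.card_ne_zero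
lemma pf_inv {g : Fin n → ℕ} (a : L1 n) (σ : ∀ i, Equiv.Perm (Fin (g i))) : rename (pact σ) (pf g a) = pf g a := by
  have : (rename (pact σ)).comp (pf g) = pf g := by
    apply MvPolynomial.algHom_ext
    rintro ⟨i, k⟩
    simp [pf, pact]
    exact Equiv.sum_comp (σ i) (fun j => (X ⟨i, j⟩ : Bg g) ^ (k + 1))
  exact DFunLike.congr_fun this a
lemma av_mem {g : Fin n → ℕ} (f : Bg g) : ∃ a, pf g a = av f := by
  suffices h : av f ∈ (pf g).range from h
  induction f using MvPolynomial.induction_on' with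
  | add p q hp hq => rw [map_add]; exact add_mem hp hq
  | monomial s c =>
    have hm : (monomial s c : Bg g) = c • ∏ i, ∏ j, X ⟨i, j⟩ ^ (s ⟨i, j⟩) := by
      rw [← Fintype.prod_sigma', monomial_eq, smul_eq_C_mul, Finsupp.prod_fintype _ _ (by simp)]
    rw [hm, map_smul, av_apply]
    apply Subalgebra.smul_mem
    apply Subalgebra.smul_mem
    simp only [map_prod, map_pow, rename_X, pact]
    have := Finset.prod_univ_sum (fun i : Fin n => (Finset.univ : Finset (Equiv.Perm (Fin (g i)))))
      (fun i σ => ∏ j, (X ⟨i, σ j⟩ : Bg g) ^ (s ⟨i, j⟩))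
    rw [Fintype.piFinset_univ] at this
    rw [← this]
    apply Subalgebra.prod_mem
    intro i _
    let F : MvPolynomial (Fin (g i)) ℚ := ∑ σ : Equiv.Perm (Fin (g i)), ∏ j, X (σ j) ^ (s ⟨i, j⟩)
    have hF : F.IsSymmetric := by
      intro τ
      simp only [F, map_sum, map_prod, map_pow, rename_X]
      exact Equiv.sum_comp (Equiv.mulLeft τ) (fun σ : Equiv.Perm (Fin (g i)) => ∏ j, (X (σ j) : MvPolynomial (Fin (g i)) ℚ) ^ (s ⟨i, j⟩))
    have hF2 : rename (Sigma.mk i) F ∈ (pf g).range := by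
      have := sym_one F hF
      have h2 : Algebra.adjoin ℚ (Set.range fun k : ℕ => psum (Fin (g i)) ℚ (k + 1)) ≤ (pf g).range.comap (rename (Sigma.mk i)) := by
        apply Algebra.adjoin_le
        rintro _ ⟨k, rfl⟩
        exact ⟨X (i, k), by simp [pf, psum]⟩
      exact h2 this
    simpa [F] using hF2
end Sym
noncomputable def EE (Q : FinQuiver n) (i : Fin n) (d : ℤ) : L1 n :=
  Ez (fun k => zsum Q i (fun j => (X (j, k) : L1 n)) - X (i, k)) d
def Single (Q : FinQuiver n) (i : Fin n) : Prop := ∀ a ∈ inA Q i, ∀ b ∈ inA Q i, Q.tl a = Q.tl b → a = b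
theorem kernel_lemma {Q : FinQuiver n} {i : Fin n} (hs : Sink Q i) (h1 : Single Q i) (γ : Fin n → ℤ) (a : L1 n)
    (ha : ∀ ω, pts γ ω → DisjAt Q i ω → ω i ⊆ zset Q i ω → ev (psv ω) a = 0)
    (S : Submodule ℚ (L1 n)) (hR : RR γ ≤ S) (hE : ∀ g d, zsum Q i γ < d + γ i → g * EE Q i d ∈ S) : a ∈ S := by
  by_cases hγ : ∃ j, γ j < 0
  · obtain ⟨j, hj⟩ := hγ
    apply hR; rw [RR_top hj]; trivial
  push Not at hγ
  obtain ⟨g, rfl⟩ : ∃ g : Fin n → ℕ, γ = fun i => (g i : ℤ) := ⟨fun i => (γ i).toNat, funext fun i => by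
    have := hγ i; simp; omega⟩
  let q : L1 n →ₐ[ℚ] MvPolynomial (Fin (g i)) (Bg g) :=
    aeval (fun p => if p.1 = i then ∑ j, X j ^ (p.2 + 1) else C (pf g (X p)))
  let Z : Finset (Bg g) := ((inA Q i).sigma (fun a => (Finset.univ : Finset (Fin (g (Q.tl a)))))).image
    (fun p => X ⟨Q.tl p.1, p.2⟩)
  have hZinj : ∀ p ∈ (inA Q i).sigma (fun a => (Finset.univ : Finset (Fin (g (Q.tl a))))),
      ∀ p' ∈ (inA Q i).sigma (fun a => (Finset.univ : Finset (Fin (g (Q.tl a))))),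
      (X ⟨Q.tl p.1, p.2⟩ : Bg g) = X ⟨Q.tl p'.1, p'.2⟩ → p = p' := by
    rintro ⟨b, j⟩ hb ⟨b', j'⟩ hb' h
    rw [mem_sigma] at hb hb'
    have := X_injective h
    have hbb : b = b' := h1 b hb.1 b' hb'.1 (by exact congrArg Sigma.fst this)
    subst hbb
    simpa using this
  have hZc : (Z.card : ℤ) = zsum Q i (fun i => (g i : ℤ)) := by
    rw [card_image_of_injOn (fun p hp p' hp' h => hZinj p hp p' hp' h)]
    simp [zsum]
  have hZp : ∀ k, ps Z.val k = ∑ a ∈ inA Q i, pf g (X (Q.tl a, k)) := by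
    intro k
    rw [ps_finset, sum_image hZinj, Finset.sum_sigma]
    simp [pf]
  have hq : q a ∈ JJ Z (g i) := by
    apply kernel_abs
    intro x hx hxZ
    apply dens
    intro y hy
    have hxy : Function.Injective (fun j => eval y (x j)) := by
      intro j j' h
      apply hx
      have e1 := hxZ j; have e2 := hxZ j'
      simp only [Z, mem_image] at e1 e2
      obtain ⟨p, _, hp⟩ := e1; obtain ⟨p', _, hp'⟩ := e2
      replace h : eval y (x j) = eval y (x j') := h
      rw [← hp, ← hp'] at h ⊢
      rw [eval_X, eval_X] at h
      rw [hy h]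
    have hyi : ∀ i, Function.Injective (fun j : Fin (g i) => y ⟨i, j⟩) := fun i a b hab => by
      have := hy hab; simpa using this
    let ω : Fin n → Finset ℚ := Function.update (fun i => Finset.univ.image (fun j : Fin (g i) => y ⟨i, j⟩)) i
      (Finset.univ.image (fun j => eval y (x j)))
    have hωj : ∀ j, j ≠ i → ω j = Finset.univ.image (fun l : Fin (g j) => y ⟨j, l⟩) := fun j hj => by simp [ω, hj]
    have hωi : ω i = Finset.univ.image (fun j => eval y (x j)) := by simp [ω]
    have hev : eval y (eval x (q a)) = ev (psv ω) a := by
      have : ((aeval y : Bg g →ₐ[ℚ] ℚ).comp ((aeval x : _ →ₐ[Bg g] Bg g).restrictScalars ℚ)).comp q = ev (psv ω) := by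
        apply MvPolynomial.algHom_ext
        rintro ⟨j, k⟩
        by_cases hj : j = i
        · subst hj
          have e : psv ω j k = ∑ l, (eval y (x l)) ^ (k + 1) := by
            rw [psv, hωi, ps_finset, sum_image (fun a _ b _ h => hxy h)]
          rw [ev_X, e]
          simp [q]
        · have e : psv ω j k = ∑ l, (y ⟨j, l⟩) ^ (k + 1) := by
            rw [psv, hωj j hj, ps_finset, sum_image (fun a _ b _ h => hyi j h)]
          rw [ev_X, e]
          simp [q, hj, pf]
      exact DFunLike.congr_fun this a
    rw [hev]
    apply ha
    · intro j
      by_cases hj : j = i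
      · subst hj; rw [hωi, card_image_of_injective _ hxy]; simp
      · rw [hωj j hj, card_image_of_injective _ (hyi j)]; simp
    · intro b hb b' hb' hbb
      rw [hωj _ (hs b), hωj _ (hs b'), disjoint_left]
      intro t ht ht'
      simp only [mem_image, mem_univ, true_and] at ht ht'
      obtain ⟨j, rfl⟩ := ht; obtain ⟨j', h⟩ := ht'
      exact hbb (h1 b hb b' hb' (congrArg Sigma.fst (hy h)).symm)
    · rw [hωi]
      intro t ht
      simp only [mem_image, mem_univ, true_and] at ht
      obtain ⟨j, rfl⟩ := ht
      have e1 := hxZ j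
      simp only [Z, mem_image, mem_sigma, mem_univ, and_true] at e1
      obtain ⟨p, hp, hpx⟩ := e1
      rw [zset, mem_biUnion]
      refine ⟨p.1, hp, ?_⟩
      rw [hωj _ (hs _), ← hpx]
      simp
  let Θ : MvPolynomial (Fin (g i)) (Bg g) →ₐ[ℚ] Bg g := (aeval (fun j => X ⟨i, j⟩) : _ →ₐ[Bg g] Bg g).restrictScalars ℚ
  have hΘq : Θ (q a) = pf g a := by
    have : Θ.comp q = pf g := by
      apply MvPolynomial.algHom_ext
      rintro ⟨j, k⟩
      by_cases hj : j = i
      · subst hj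
        simp [q, Θ, pf]
      · simp [q, Θ, pf, hj]
    exact DFunLike.congr_fun this a
  have hΘE : ∀ d, Θ (Ez (pz Z (g i)) d) = pf g (EE Q i d) := by
    intro d
    rw [map_Ez, EE, map_Ez]
    apply Ez_congr; intro k
    simp only [pz, map_sub, hZp, zsum, map_sum]
    simp [Θ, pf]
  have key : ∀ f ∈ JJ Z (g i), ∀ c : Bg g, ∃ s ∈ S, pf g s = av (c * Θ f) := by
    intro f hf
    unfold JJ at hf
    induction hf using Submodule.span_induction with
    | mem f hf =>
      obtain ⟨d, hd, rfl⟩ := hf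
      intro c
      obtain ⟨b, hb⟩ := av_mem c
      refine ⟨b * EE Q i d, hE _ _ (by rw [← hZc]; exact hd), ?_⟩
      rw [hΘE, av_inv _ _ (pf_inv _), map_mul, hb]
    | zero => intro c; exact ⟨0, S.zero_mem, by simp⟩
    | add f f' _ _ h h' =>
      intro c
      obtain ⟨s, hs, e⟩ := h c; obtain ⟨s', hs', e'⟩ := h' c
      exact ⟨s + s', S.add_mem hs hs', by simp only [map_add, e, e', mul_add]⟩
    | smul b f _ h =>
      intro c
      obtain ⟨s, hs, e⟩ := h (c * Θ b)
      exact ⟨s, hs, by rw [e, smul_eq_mul, map_mul Θ, mul_assoc]⟩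
  obtain ⟨s, hsS, e⟩ := key _ hq 1
  rw [hΘq, one_mul, av_self _ (pf_inv _)] at e
  have : a - s ∈ RR (fun i => (g i : ℤ)) := by rw [mem_RR_iff, map_sub, e, sub_self]
  have := S.add_mem (hR this) hsS
  simpa using this
lemma Isum_add (Q : FinQuiver n) (ω : Fin n → Finset ℚ) (δ : Fin n → ℤ) (G G' : L2 n) :
    Isum Q ω δ (G + G') = Isum Q ω δ G + Isum Q ω δ G' := by
  simp only [Isum, map_add, mul_add, sum_add_distrib]
lemma Isum_smul (Q : FinQuiver n) (ω : Fin n → Finset ℚ) (δ : Fin n → ℤ) (c : ℚ) (G : L2 n) :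
    Isum Q ω δ (c • G) = c * Isum Q ω δ G := by
  simp only [Isum, map_smul, smul_eq_mul, mul_sum]
  exact sum_congr rfl fun _ _ => by ring
lemma IsI.add {Q : FinQuiver n} {γ δ : Fin n → ℤ} {G G' : L2 n} {b b' : L1 n} (h : IsI Q γ δ G b) (h' : IsI Q γ δ G' b') :
    IsI Q γ δ (G + G') (b + b') := fun ω hω => by rw [map_add, h ω hω, h' ω hω, Isum_add]
lemma IsI.smul {Q : FinQuiver n} {γ δ : Fin n → ℤ} {G : L2 n} {b : L1 n} (c : ℚ) (h : IsI Q γ δ G b) :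
    IsI Q γ δ (c • G) (c • b) := fun ω hω => by rw [map_smul, h ω hω, Isum_smul, smul_eq_mul]
lemma IsI.sub_mem {Q : FinQuiver n} {γ δ : Fin n → ℤ} {G : L2 n} {b b' : L1 n} (h : IsI Q γ δ G b) (h' : IsI Q γ δ G b') :
    b - b' ∈ RR γ := fun ω hω => by rw [map_sub, h ω hω, h' ω hω, sub_self]
def IR (Q : FinQuiver n) (γ δ : Fin n → ℤ) : Submodule ℚ (L1 n) where
  carrier := {b | ∃ G, IsI Q γ δ G b}
  add_mem' := fun ⟨_, h⟩ ⟨_, h'⟩ => ⟨_, h.add h'⟩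
  zero_mem' := ⟨0, fun ω _ => by simp [Isum]⟩
  smul_mem' := fun c _ ⟨_, h⟩ => ⟨_, h.smul c⟩
lemma IR_neg {Q : FinQuiver n} {γ δ : Fin n → ℤ} {j : Fin n} (hj : δ j < 0 ∨ γ j < δ j) : IR Q γ δ ≤ RR γ := by
  rintro b ⟨G, h⟩ ω hω
  rw [h ω hω, Isum, sum_eq_zero]
  intro N hN
  have h1 := mem_subs.mp hN j
  have h2 := card_le_card h1.1
  have := hω j
  omega
lemma sEE {Q : FinQuiver n} {i : Fin n} (hs : Sink Q i) (d : ℤ) : sLam Q i (EE Q i d) = Ez (fun k => X (i, k)) d := by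
  rw [EE, map_Ez]
  apply Ez_congr
  intro k
  have : ∀ j, sLam Q i (X (j, k)) = refl Q i (fun j => (X (j, k) : L1 n)) j := fun j => by simp [sLam]
  simp only [map_sub, zsum, map_sum, this, refl_same]
  rw [sum_congr rfl fun a _ => refl_ne Q (hs a) _]
  ring
lemma Ez_mem {γ : Fin n → ℤ} {i : Fin n} {d : ℤ} (h : γ i < d) (g : L1 n) : g * Ez (fun k => (X (i, k) : L1 n)) d ∈ RR γ := by
  apply RR_mul
  intro ω hω
  rw [map_Ez]
  have : (fun k => ev (psv ω) (X (i, k) : L1 n)) = ps (ω i).val := by funext k; simp [psv, ev]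
  rw [this]
  apply Ez_ps_large
  have := hω i
  simpa using (by omega : ((ω i).card : ℤ) < d)
theorem Bp {Q : FinQuiver n} {i : Fin n} (hs : Sink Q i) (h1 : Single Q i) {γ δ : Fin n → ℤ} {G : L2 n} {b b' : L1 n}
    (hb : IsI Q γ δ G b) (hb' : IsI (rq Q i) (refl Q i γ) (refl Q i δ) (s2 Q i G) b')
    (S : Submodule ℚ (L1 n)) (hS1 : ∀ a ∈ RR γ, sLam Q i a ∈ S) (hS2 : RR (refl Q i γ) ≤ S)
    (hS3 : ∀ c : ℕ, IR (rq Q i) (refl Q i γ) (refl Q i δ - ((c + 1 : ℕ) : ℤ) • eZ i) ≤ S) : sLam Q i b - b' ∈ S := by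
  let w : ℤ := refl Q i γ i
  choose bc hbc using fun c : ℕ => exists_IsI (rq Q i) (refl Q i γ) (refl Q i δ - (c : ℤ) • eZ i)
    (locF (tauI i) (ellI Q i) (refl Q i δ i) (zsum Q i δ) w c (s2 Q i G))
  let M := (refl Q i δ i).toNat
  let a : L1 n := b - sLam Q i (∑ c ∈ Finset.range (M + 1), bc c)
  have ha : a ∈ S.comap (sLam Q i).toLinearMap := by
    apply kernel_lemma hs h1 γ
    · intro ω hω hd hsub
      have hcz : ((zset Q i ω).card : ℤ) = zsum Q i γ := by
        rw [card_zset hd]; push_cast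
        exact sum_congr rfl fun a _ => hω _
      have hw : ((zset Q i ω).card : ℤ) - (ω i).card = w := by
        rw [hcz, hω i]; exact (refl_same Q i γ).symm
      have hp : pts (refl Q i γ) (Function.update ω i (zset Q i ω \ ω i)) := by
        intro j
        by_cases hj : j = i
        · subst hj
          rw [update_self, card_sdiff_of_subset hsub, Nat.cast_sub (card_le_card hsub)]
          exact hw
        · rw [update_of_ne hj, refl_ne Q hj]; exact hω j
      simp only [a, map_sub, map_sum, ev_sLam]
      rw [hb ω hω, Isum_refl hs hd hsub, sub_eq_zero]
      apply sum_congr rfl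
      intro c _
      rw [hw, ← hbc c _ hp, refl_psv hd hsub]
    · exact hS1
    · intro g d hd
      apply hS2
      show sLam Q i _ ∈ _
      rw [map_mul, sEE hs]
      apply Ez_mem
      rw [refl_same]; omega
  have e : sLam Q i b - b' = sLam Q i a + (bc 0 - b') + ∑ c ∈ Finset.range M, bc (c + 1) := by
    simp only [a, map_sub, sLam_sLam hs, sum_range_succ']
    ring
  rw [e]
  refine S.add_mem (S.add_mem ha (hS2 ?_)) (S.sum_mem fun c _ => hS3 c ⟨_, hbc (c + 1)⟩)
  have h0 := hbc 0
  rw [locF_zero] at h0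
  simp only [Nat.cast_zero, zero_smul, sub_zero] at h0
  exact h0.sub_mem hb'
def eul (Q : FinQuiver n) (α β : Fin n → ℤ) : ℤ := ∑ i, α i * β i - ∑ a : Q.Arr, α (Q.tl a) * β (Q.hd a)
lemma eul_addl (Q : FinQuiver n) (a b c : Fin n → ℤ) : eul Q (a + b) c = eul Q a c + eul Q b c := by
  simp only [eul, Pi.add_apply, add_mul, sum_add_distrib]; ring
lemma eul_addr (Q : FinQuiver n) (a b c : Fin n → ℤ) : eul Q c (a + b) = eul Q c a + eul Q c b := by
  simp only [eul, Pi.add_apply, mul_add, sum_add_distrib]; ring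
lemma eul_smull (Q : FinQuiver n) (k : ℤ) (a c : Fin n → ℤ) : eul Q (k • a) c = k * eul Q a c := by
  simp only [eul, Pi.smul_apply, smul_eq_mul, mul_sub, mul_sum, mul_assoc]
lemma eul_smulr (Q : FinQuiver n) (k : ℤ) (a c : Fin n → ℤ) : eul Q c (k • a) = k * eul Q c a := by
  simp only [eul, Pi.smul_apply, smul_eq_mul, mul_sub, mul_sum, mul_left_comm]
lemma eul_er (Q : FinQuiver n) (i : Fin n) (v : Fin n → ℤ) : eul Q v (eZ i) = v i - zsum Q i v := by
  simp [eul, eZ, zsum, inA, Pi.single_apply, sum_filter]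
lemma eul_el (Q : FinQuiver n) (i : Fin n) (v : Fin n → ℤ) :
    eul Q (eZ i) v = v i - ∑ a ∈ Finset.univ.filter (fun a => Q.tl a = i), v (Q.hd a) := by
  simp [eul, eZ, Pi.single_apply, sum_filter]
lemma eq_sum_eZ (v : Fin n → ℤ) : v = ∑ j, v j • eZ j := by
  funext k; simp [eZ, Pi.single_apply]
lemma eul_suml (Q : FinQuiver n) (v c : Fin n → ℤ) : eul Q v c = ∑ j, v j * eul Q (eZ j) c := by
  let f : (Fin n → ℤ) →+ ℤ := ⟨⟨fun v => eul Q v c, by simp [eul]⟩, fun a b => eul_addl Q a b c⟩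
  have : eul Q v c = f (∑ j, v j • eZ j) := by rw [← eq_sum_eZ]; rfl
  rw [this, map_sum]
  exact sum_congr rfl fun j _ => eul_smull Q _ _ _
lemma eul_sumr (Q : FinQuiver n) (v c : Fin n → ℤ) : eul Q c v = ∑ j, v j * eul Q c (eZ j) := by
  let f : (Fin n → ℤ) →+ ℤ := ⟨⟨fun v => eul Q c v, by simp [eul]⟩, fun a b => eul_addr Q a b c⟩
  have : eul Q c v = f (∑ j, v j • eZ j) := by rw [← eq_sum_eZ]; rfl
  rw [this, map_sum]
  exact sum_congr rfl fun j _ => eul_smulr Q _ _ _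
structure RootL (Q : FinQuiver n) (L : List (Fin n → ℤ)) : Prop where
  pos : ∀ v, v ≠ 0 → 0 < eul Q v v
  nodup : L.Nodup
  mem : ∀ b, b ∈ L ↔ (∀ j, 0 ≤ b j) ∧ eul Q b b = 1
  ord : L.Pairwise (fun a b => eul Q b a ≤ eul Q a b)
lemma eZ_ne (i : Fin n) : (eZ i : Fin n → ℤ) ≠ 0 := fun h => by have := congrFun h i; simp [eZ] at this
lemma zsum_nonneg {Q : FinQuiver n} {i : Fin n} (v : Fin n → ℤ) (h : ∀ a, Q.hd a = i → 0 ≤ v (Q.tl a)) : 0 ≤ zsum Q i v :=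
  sum_nonneg fun a ha => h a (mem_inA.mp ha)
lemma noloop {Q : FinQuiver n} (pos : ∀ v, v ≠ 0 → 0 < eul Q v v) (a : Q.Arr) : Q.tl a ≠ Q.hd a := by
  intro h
  have h1 := pos _ (eZ_ne (Q.hd a))
  rw [eul_er] at h1
  have : (1 : ℤ) ≤ zsum Q (Q.hd a) (eZ (Q.hd a)) := by
    have := Finset.single_le_sum (f := fun b => (eZ (Q.hd a) : Fin n → ℤ) (Q.tl b)) (s := inA Q (Q.hd a))
      (fun b _ => by simp only [eZ, Pi.single_apply]; split_ifs <;> simp) (mem_inA.mpr rfl : a ∈ inA Q (Q.hd a))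
    simpa [eZ, h, zsum] using this
  simp [eZ] at h1
  simp [eZ] at this
  omega
lemma eul_ee {Q : FinQuiver n} (pos : ∀ v, v ≠ 0 → 0 < eul Q v v) (i : Fin n) : eul Q (eZ i) (eZ i) = 1 := by
  rw [eul_er, zsum, sum_eq_zero]
  · simp [eZ]
  · intro a ha
    have := noloop pos a
    rw [mem_inA.mp ha] at this
    simp [eZ, this]
lemma head_simple {Q : FinQuiver n} {e : Fin n → ℤ} {T : List (Fin n → ℤ)} (h : RootL Q (e :: T)) :
    ∃ i, e = eZ i ∧ Sink Q i ∧ Single Q i := by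
  have he := (h.mem e).mp (by simp)
  have hord : ∀ b, (∀ j, 0 ≤ b j) → eul Q b b = 1 → eul Q b e ≤ eul Q e b := by
    intro b h0 h1
    have hb := (h.mem b).mpr ⟨h0, h1⟩
    rcases List.mem_cons.mp hb with rfl | hb
    · rfl
    · exact (List.pairwise_cons.mp h.ord).1 b hb
  have hs0 : ∀ j k : Fin n, 0 ≤ (eZ j : Fin n → ℤ) k := fun j k => by
    simp only [eZ, Pi.single_apply]; split_ifs <;> simp
  have hsim : ∀ j, eul Q (eZ j) e ≤ eul Q e (eZ j) := fun j => hord _ (hs0 j) (eul_ee h.pos j)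
  have hz : ∑ j, e j * (eul Q e (eZ j) - eul Q (eZ j) e) = 0 := by
    simp only [mul_sub, sum_sub_distrib]
    rw [← eul_sumr, ← eul_suml, sub_self]
  rw [Finset.sum_eq_zero_iff_of_nonneg (fun j _ => mul_nonneg (he.1 j) (sub_nonneg.mpr (hsim j)))] at hz
  obtain ⟨i, hi⟩ : ∃ i, 0 < e i * eul Q e (eZ i) := by
    by_contra hc
    push Not at hc
    have := Finset.sum_nonpos (fun i (_ : i ∈ Finset.univ) => hc i)
    rw [← eul_sumr, he.2] at this
    omega
  have hei : 0 < e i := lt_of_le_of_ne (he.1 i) (fun h => by rw [← h] at hi; simp at hi)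
  have h1 : 0 < eul Q e (eZ i) := by by_contra hc; push Not at hc; nlinarith
  have h2 : eul Q e (eZ i) = eul Q (eZ i) e := by
    have := hz i (mem_univ _)
    rcases mul_eq_zero.mp this with h | h <;> omega
  have hee : e = eZ i := by
    by_contra hne
    have := h.pos (e + (-1 : ℤ) • eZ i) (fun h => hne (by
      funext k; have := congrFun h k; simp at this; linarith))
    rw [eul_addl, eul_addr, eul_addr, eul_smull, eul_smull, eul_smulr, eul_smulr, he.2, eul_ee h.pos] at this
    omega
  subst hee
  have two : ∀ k, k ≠ i → eul Q (eZ i) (eZ k) + eul Q (eZ k) (eZ i) ≥ -1 := by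
    intro k hk
    have := h.pos (eZ i + eZ k) (fun h => by have := congrFun h i; simp [eZ, Pi.single_apply] at this; split_ifs at this <;> omega)
    rw [eul_addl, eul_addr, eul_addr, eul_ee h.pos, eul_ee h.pos] at this
    omega
  have nn : ∀ k (a b : Fin n), 0 ≤ (if a = b then (k:ℤ) else 0) ∨ k < 0 := by intro k a b; split_ifs <;> omega
  refine ⟨i, rfl, ?_, ?_⟩
  · intro a ha
    have hne : Q.hd a ≠ i := fun h' => noloop h.pos a (ha.trans h'.symm)
    have t := two _ hne
    have o := hsim (Q.hd a)
    have l : eul Q (eZ i) (eZ (Q.hd a)) ≤ -1 := by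
      rw [eul_el]
      have := Finset.single_le_sum (f := fun b => (eZ (Q.hd a) : Fin n → ℤ) (Q.hd b)) (s := Finset.univ.filter (fun a => Q.tl a = i))
        (fun b _ => hs0 _ _) (by simpa using ha : a ∈ _)
      simp [eZ, Pi.single_apply, hne.symm] at this ⊢
      omega
    omega
  · intro a ha b hb hab
    by_contra hne
    have ha' := mem_inA.mp ha
    have hki : Q.tl a ≠ i := fun h' => noloop h.pos a (h'.trans ha'.symm)
    have t := two _ hki
    have l : eul Q (eZ (Q.tl a)) (eZ i) ≤ -2 := by
      rw [eul_er, zsum]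
      have := Finset.add_le_sum (f := fun b => (eZ (Q.tl a) : Fin n → ℤ) (Q.tl b)) (s := inA Q i)
        (fun b _ => hs0 _ _) ha hb hne
      simp [eZ, Pi.single_apply, hki.symm, ← hab] at this ⊢
      omega
    have l2 : eul Q (eZ i) (eZ (Q.tl a)) ≤ 0 := by
      rw [eul_el]
      have := sum_nonneg (s := Finset.univ.filter (fun a => Q.tl a = i)) (fun b _ => hs0 (Q.tl a) (Q.hd b))
      simp [eZ, Pi.single_apply, hki.symm] at this ⊢
    omega
lemma eul_refl {Q : FinQuiver n} {i : Fin n} (hs : Sink Q i) (α β : Fin n → ℤ) :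
    eul (rq Q i) (refl Q i α) (refl Q i β) = eul Q α β := by
  unfold eul
  rw [← add_sum_erase _ _ (mem_univ i), ← add_sum_erase _ _ (mem_univ i)]
  rw [sum_congr rfl (fun j hj => by rw [refl_ne Q (ne_of_mem_erase hj), refl_ne Q (ne_of_mem_erase hj)] :
    ∀ j ∈ Finset.univ.erase i, refl Q i α j * refl Q i β j = α j * β j)]
  have e1 : ∀ f : Q.Arr → ℤ, ∑ a, f a = ∑ a ∈ inA Q i, f a + ∑ a ∈ Finset.univ.filter (fun a => ¬ Q.hd a = i), f a :=
    fun f => (Finset.sum_filter_add_sum_filter_not _ _ _).symm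
  have e2 : ∑ a : (rq Q i).Arr, refl Q i α ((rq Q i).tl a) * refl Q i β ((rq Q i).hd a)
      = ∑ a : Q.Arr, refl Q i α ((rq Q i).tl a) * refl Q i β ((rq Q i).hd a) := rfl
  rw [e2, e1, e1 (fun a => α (Q.tl a) * β (Q.hd a))]
  have e3 : ∑ a ∈ inA Q i, refl Q i α ((rq Q i).tl a) * refl Q i β ((rq Q i).hd a) = refl Q i α i * zsum Q i β := by
    rw [zsum, mul_sum]
    refine sum_congr rfl fun a ha => ?_
    simp only [rq, mem_inA.mp ha, if_true]
    rw [refl_ne Q (hs a)]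
  have e4 : ∑ a ∈ inA Q i, α (Q.tl a) * β (Q.hd a) = zsum Q i α * β i := by
    rw [zsum, sum_mul]
    exact sum_congr rfl fun a ha => by rw [mem_inA.mp ha]
  have e5 : ∑ a ∈ Finset.univ.filter (fun a => ¬ Q.hd a = i), refl Q i α ((rq Q i).tl a) * refl Q i β ((rq Q i).hd a) =
      ∑ a ∈ Finset.univ.filter (fun a => ¬ Q.hd a = i), α (Q.tl a) * β (Q.hd a) := by
    refine sum_congr rfl fun a ha => ?_
    have ha := (mem_filter.mp ha).2
    simp only [rq, ha, if_false]
    rw [refl_ne Q (hs a), refl_ne Q ha]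
  rw [e3, e4, e5, refl_same, refl_same]
  ring
lemma rq_sq (Q : FinQuiver n) (i : Fin n) (v : Fin n → ℤ) : eul (rq Q i) v v = eul Q v v := by
  unfold eul
  congr 1
  refine sum_congr rfl fun (a : Q.Arr) _ => ?_
  simp only [rq]
  split_ifs with h
  · rw [h, mul_comm]
  · rfl
lemma refl_smul (Q : FinQuiver n) (i : Fin n) (k : ℤ) (v : Fin n → ℤ) : refl Q i (k • v) = k • refl Q i v := by
  funext j
  by_cases h : j = i
  · subst h; simp [refl_same, zsum, mul_sum, mul_sub]
  · simp [refl_ne Q h]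
lemma refl_eZ {Q : FinQuiver n} {i : Fin n} (hs : Sink Q i) : refl Q i (eZ i : Fin n → ℤ) = (-1 : ℤ) • eZ i := by
  funext j
  by_cases h : j = i
  · subst h
    rw [refl_same, zsum, sum_eq_zero (fun a _ => by simp [eZ, hs a])]; simp
  · simp [refl_ne Q h, eZ, h]
lemma root_pos {Q : FinQuiver n} {i : Fin n} (hs : Sink Q i) (pos : ∀ v, v ≠ 0 → 0 < eul Q v v) {v : Fin n → ℤ}
    (h0 : ∀ j, j ≠ i → 0 ≤ v j) (h1 : eul Q v v = 1) (hne : v ≠ (-1 : ℤ) • eZ i) : 0 ≤ v i := by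
  by_contra hc
  push Not at hc
  let u : Fin n → ℤ := Function.update v i 0
  have hv : v = u + v i • eZ i := by
    funext j
    by_cases h : j = i
    · subst h; simp [u, eZ]
    · simp [u, h, eZ]
  have hu1 : eul Q u (eZ i) ≤ 0 := by
    rw [eul_er]
    have : 0 ≤ zsum Q i u := zsum_nonneg _ fun a _ => by simp only [u, update_of_ne (hs a)]; exact h0 _ (hs a)
    simp only [u, update_self] at this ⊢; omega
  have hu2 : eul Q (eZ i) u = 0 := by
    rw [eul_el, Finset.filter_false_of_mem (fun a _ => hs a)]; simp [u]
  have h3 := h1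
  rw [hv, eul_addl, eul_addr, eul_addr, eul_smull, eul_smull, eul_smulr, eul_smulr, eul_ee pos, hu2] at h3
  by_cases hu : u = 0
  · rw [hu] at h3 hv
    have : eul Q 0 0 = 0 := by simp [eul]
    have h4 : eul Q 0 (eZ i) = 0 := by simp [eul]
    rw [this, h4] at h3
    have : v i = -1 := by nlinarith
    apply hne; rw [hv, this]; simp
  · have := pos u hu
    nlinarith
theorem RootL.step {Q : FinQuiver n} {i : Fin n} {T : List (Fin n → ℤ)} (h : RootL Q (eZ i :: T)) (hs : Sink Q i) :
    RootL (rq Q i) (T.map (refl Q i) ++ [eZ i]) := by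
  have inj : Function.Injective (refl Q i : (Fin n → ℤ) → _) := fun a b hab => by
    rw [← refl_refl hs a, hab, refl_refl hs]
  have isq : ∀ v, eul (rq Q i) v v = eul Q (refl Q i v) (refl Q i v) := fun v => by
    rw [← eul_refl hs, refl_refl hs]
  have hnd := List.nodup_cons.mp h.nodup
  have key : ∀ v : Fin n → ℤ, (∀ j, 0 ≤ v j) → eul Q v v = 1 → v ≠ eZ i → ∀ j, 0 ≤ refl Q i v j := by
    intro v h0 h1 hne j
    by_cases hj : j = i
    · subst hj
      refine root_pos hs h.pos (fun k hk => by rw [refl_ne Q hk]; exact h0 k) ?_ (fun e => hne ?_)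
      · rw [← rq_sq Q j, eul_refl hs, h1]
      · rw [← refl_eZ hs] at e; exact inj e
    · rw [refl_ne Q hj]; exact h0 j
  refine ⟨?_, ?_, ?_, ?_⟩
  · intro v hv
    rw [isq]
    refine h.pos _ fun h0 => hv ?_
    rw [← refl_refl hs v, h0]; funext j
    by_cases hj : j = i
    · subst hj; simp [refl_same, zsum]
    · simp [refl_ne Q hj]
  · rw [List.nodup_append]
    refine ⟨hnd.2.map inj, by simp, ?_⟩
    intro a ha b hb
    simp only [List.mem_singleton] at hb
    subst hb
    rintro rfl
    obtain ⟨c, hc, hce⟩ := List.mem_map.mp ha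
    have : c = (-1 : ℤ) • eZ i := by rw [← refl_refl hs c, hce, refl_eZ hs]
    have h0 := ((h.mem c).mp (List.mem_cons_of_mem _ hc)).1 i
    rw [this] at h0; simp [eZ] at h0
  · intro b
    simp only [List.mem_append, List.mem_map, List.mem_singleton]
    constructor
    · rintro (⟨c, hc, rfl⟩ | rfl)
      · have hc' := (h.mem c).mp (List.mem_cons_of_mem _ hc)
        exact ⟨key c hc'.1 hc'.2 (fun e => hnd.1 (e ▸ hc)), by rw [isq, refl_refl hs]; exact hc'.2⟩
      · refine ⟨fun j => by simp only [eZ, Pi.single_apply]; split_ifs <;> simp, ?_⟩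
        rw [isq, refl_eZ hs, eul_smull, eul_smulr, eul_ee h.pos]; rfl
    · rintro ⟨h0, h1⟩
      by_cases hb : b = eZ i
      · exact Or.inr hb
      left
      refine ⟨refl Q i b, ?_, refl_refl hs b⟩
      rw [isq] at h1
      have hm : refl Q i b ∈ eZ i :: T := by
        rw [h.mem]
        refine ⟨fun j => ?_, h1⟩
        by_cases hj : j = i
        · subst hj
          refine root_pos hs h.pos (fun k hk => by rw [refl_ne Q hk]; exact h0 k) h1 (fun e => hb ?_)
          rw [← refl_eZ hs] at e; exact inj e
        · rw [refl_ne Q hj]; exact h0 j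
      refine (List.mem_cons.mp hm).resolve_left fun e => ?_
      have := h0 i
      rw [← refl_refl hs b, e, refl_eZ hs] at this; simp [eZ] at this
  · have ho := List.pairwise_cons.mp h.ord
    rw [List.pairwise_append]
    refine ⟨?_, by simp, ?_⟩
    · rw [List.pairwise_map]
      exact ho.2.imp fun hab => by rw [eul_refl hs, eul_refl hs]; exact hab
    · intro a ha b hb
      simp only [List.mem_singleton] at hb
      subst hb
      obtain ⟨c, hc, rfl⟩ := List.mem_map.mp ha
      have e : (eZ i : Fin n → ℤ) = refl Q i ((-1 : ℤ) • eZ i) := by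
        rw [refl_smul, refl_eZ hs, smul_smul]; simp
      rw [e, eul_refl hs, eul_refl hs, eul_smull, eul_smulr]
      have := ho.1 c hc
      omega
noncomputable def dm : L1 n →ₐ[ℚ] L2 n := aeval (fun p => X (inl p.1, p.2) - X (inr p.1, p.2))
noncomputable def nm : L1 n →ₐ[ℚ] L2 n := aeval (fun p => X (inr p.1, p.2))
lemma ev_dm (v w : Fin n → ℕ → ℚ) (g : L1 n) : ev (Sum.elim v w) (dm g) = ev (v - w) g := by
  have : (ev (Sum.elim v w)).comp dm = ev (v - w) := by
    apply MvPolynomial.algHom_ext; rintro ⟨j, k⟩; simp [dm, ev_X]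
  exact DFunLike.congr_fun this g
lemma ev_nm (v w : Fin n → ℕ → ℚ) (g : L1 n) : ev (Sum.elim v w) (nm g) = ev w g := by
  have : (ev (Sum.elim v w)).comp nm = ev w := by
    apply MvPolynomial.algHom_ext; rintro ⟨j, k⟩; simp [nm, ev_X]
  exact DFunLike.congr_fun this g
lemma refl_sub {M : Type} [AddCommGroup M] (Q : FinQuiver n) (i : Fin n) (α β : Fin n → M) :
    refl Q i (α - β) = refl Q i α - refl Q i β := by
  rw [eq_sub_iff_add_eq, ← refl_add, sub_add_cancel]
lemma ev_elim (θ : Fin n ⊕ Fin n → ℕ → ℚ) : θ = Sum.elim (fun j => θ (inl j)) (fun j => θ (inr j)) := by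
  funext j; cases j <;> rfl
lemma s2_dm (Q : FinQuiver n) (i : Fin n) (g : L1 n) : s2 Q i (dm g) = dm (sLam Q i g) :=
  ev_ext fun θ => by rw [ev_elim θ, ev_s2, ev_dm, ev_dm, ev_sLam, refl_sub]
lemma s2_nm (Q : FinQuiver n) (i : Fin n) (g : L1 n) : s2 Q i (nm g) = nm (sLam Q i g) :=
  ev_ext fun θ => by rw [ev_elim θ, ev_s2, ev_nm, ev_nm, ev_sLam]
lemma s2_s2 {Q : FinQuiver n} {i : Fin n} (hs : Sink Q i) (G : L2 n) : s2 Q i (s2 Q i G) = G :=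
  ev_ext fun θ => by rw [ev_elim θ, ev_s2, ev_s2, refl_refl hs, refl_refl hs]
inductive TP : List (Fin n → ℤ) → (Fin n → ℤ) → (Fin n → ℕ → ℚ) → Prop
  | nil : TP [] 0 0
  | cons {L γ p} (β : Fin n → ℤ) (x : Multiset ℚ) : TP L γ p →
      TP (β :: L) (γ + (x.card : ℤ) • β) (p + fun j k => (β j : ℚ) * ps x k)
lemma TP.weak {L : List (Fin n → ℤ)} {γ p} (h : TP L γ p) (β : Fin n → ℤ) : TP (β :: L) γ p := by
  have := h.cons β 0
  have e : (p + fun j k => (β j : ℚ) * ps 0 k) = p := by funext j k; simp [ps_zero]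
  rw [e] at this
  simpa using this
lemma TP.refl {L : List (Fin n → ℤ)} {γ p} (h : TP L γ p) (Q : FinQuiver n) (i : Fin n) :
    TP (L.map (refl Q i)) (refl Q i γ) (refl Q i p) := by
  induction h with
  | nil =>
    have h1 : CoH.refl Q i (0 : Fin n → ℤ) = 0 := by have := refl_sub Q i (0 : Fin n → ℤ) 0; simpa using this
    have h2 : CoH.refl Q i (0 : Fin n → ℕ → ℚ) = 0 := by have := refl_sub Q i (0 : Fin n → ℕ → ℚ) 0; simpa using this
    rw [h1, h2]; exact .nil
  | cons β x h ih =>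
    rw [refl_add, refl_add, refl_smul]
    have e : CoH.refl Q i (fun j k => (β j : ℚ) * ps x k) = fun j k => ((CoH.refl Q i β j : ℤ) : ℚ) * ps x k := by
      funext j k
      by_cases hj : j = i
      · subst hj; simp [refl_same, zsum, sum_mul, sub_mul]
      · simp [refl_ne Q hj]
    rw [e]
    exact ih.cons _ x
lemma ps_nsmul (x : Multiset ℚ) (m k : ℕ) : ps (m • x) k = m * ps x k := by
  induction m with
  | zero => simp [ps_zero]
  | succ m ih => rw [succ_nsmul, ps_add]; simp [ih]; ring
lemma TP.lim {L : List (Fin n → ℤ)} {γ p} (h : TP L γ p) (h0 : ∀ β ∈ L, ∀ j, 0 ≤ β j) :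
    ∃ m : Fin n → Multiset ℚ, (∀ i, ((m i).card : ℤ) = γ i) ∧ p = fun i => ps (m i) := by
  induction h with
  | nil => exact ⟨fun _ => 0, by simp, by funext i; simp [ps_zero]⟩
  | cons β x h ih =>
    obtain ⟨m, h1, h2⟩ := ih fun b hb => h0 b (List.mem_cons_of_mem _ hb)
    have hb := h0 β (by simp)
    refine ⟨fun i => m i + (β i).toNat • x, fun i => ?_, ?_⟩
    · simp [h1, Int.toNat_of_nonneg (hb i), mul_comm]
    · funext i k
      rw [ps_add]
      simp only [Pi.add_apply, h2, ps_nsmul]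
      congr 2
      have := Int.toNat_of_nonneg (hb i)
      exact_mod_cast this.symm
lemma TP.RR {L : List (Fin n → ℤ)} {γ p} (h : TP L γ p) (h0 : ∀ β ∈ L, ∀ j, 0 ≤ β j) {a : L1 n} (ha : a ∈ RR γ) :
    ev p a = 0 := by
  obtain ⟨m, h1, rfl⟩ := h.lim h0
  exact LIM ha m h1
def Cs (L : List (Fin n → ℤ)) : AddSubsemigroup (Fin n → ℤ) := AddSubsemigroup.closure {x | x ∈ L}
def Cm (L : List (Fin n → ℤ)) : AddSubmonoid (Fin n → ℤ) := AddSubmonoid.closure {x | x ∈ L}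
noncomputable def MM (Q : FinQuiver n) (rmv : List (Fin n → ℤ)) (A : (Fin n → ℤ) → Submodule ℚ (L1 n)) (γ δ : Fin n → ℤ) :
    Submodule ℚ (L1 n) := A γ ⊔ ⨆ c ∈ Cs rmv, IR Q γ (δ - c)
lemma MM_A {Q : FinQuiver n} {rmv : List (Fin n → ℤ)} {A : (Fin n → ℤ) → Submodule ℚ (L1 n)} {γ δ : Fin n → ℤ} :
    A γ ≤ MM Q rmv A γ δ := le_sup_left
lemma MM_I {Q : FinQuiver n} {rmv : List (Fin n → ℤ)} {A : (Fin n → ℤ) → Submodule ℚ (L1 n)} {γ δ : Fin n → ℤ}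
    {c : Fin n → ℤ} (hc : c ∈ Cs rmv) : IR Q γ (δ - c) ≤ MM Q rmv A γ δ :=
  (le_iSup₂ (f := fun c (_ : c ∈ Cs rmv) => IR Q γ (δ - c)) c hc).trans le_sup_right
lemma MM_le {Q : FinQuiver n} {rmv : List (Fin n → ℤ)} {A : (Fin n → ℤ) → Submodule ℚ (L1 n)} {γ δ : Fin n → ℤ}
    {S : Submodule ℚ (L1 n)} (h1 : A γ ≤ S) (h2 : ∀ c ∈ Cs rmv, IR Q γ (δ - c) ≤ S) : MM Q rmv A γ δ ≤ S :=
  sup_le h1 (iSup₂_le h2)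
abbrev Prj (n : ℕ) := (Fin n → ℤ) → (Fin n → ℤ) → L2 n →ₗ[ℚ] L1 n
structure St (Q : FinQuiver n) (rem rmv : List (Fin n → ℤ)) (A : (Fin n → ℤ) → Submodule ℚ (L1 n)) (Pr : Prj n) : Prop where
  root : RootL Q (rem ++ rmv)
  RL : ∀ γ, RR γ ≤ A γ
  PT : ∀ γ p, TP rem γ p → ∀ a ∈ A γ, ev p a = 0
  ID : ∀ γ δ g a b, g ∈ A (γ - δ) → IsI Q γ δ (dm g * nm a) b → b ∈ MM Q rmv A γ δ
  TR : ∀ γ δ G b, IsI Q γ δ G b → Pr γ δ G - b ∈ MM Q rmv A γ δ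
  NG : ∀ c ∈ Cm rmv, ∀ d ∈ Cm rem, c - d ≠ 0 → A (c - d) = ⊤
noncomputable def Anew (Q : FinQuiver n) (i : Fin n) (A : (Fin n → ℤ) → Submodule ℚ (L1 n)) (γ : Fin n → ℤ) : Submodule ℚ (L1 n) :=
  (A (refl Q i γ)).map (sLam Q i).toLinearMap ⊔ RR γ
noncomputable def Pnew (Q : FinQuiver n) (i : Fin n) (Pr : Prj n) : Prj n := fun γ δ =>
  (sLam Q i).toLinearMap ∘ₗ Pr (refl Q i γ) (refl Q i δ) ∘ₗ (s2 Q i).toLinearMap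
noncomputable def reflH (Q : FinQuiver n) (i : Fin n) : (Fin n → ℤ) →+ (Fin n → ℤ) where
  toFun := refl Q i
  map_zero' := by have := refl_sub Q i (0 : Fin n → ℤ) 0; simpa using this
  map_add' := refl_add Q i
lemma Cs_step {Q : FinQuiver n} {i : Fin n} {L : List (Fin n → ℤ)} {c : Fin n → ℤ} (h : c ∈ Cs L) :
    refl Q i c ∈ Cs (L.map (refl Q i) ++ [eZ i]) := by
  refine AddSubsemigroup.closure_induction (p := fun c _ => refl Q i c ∈ Cs (L.map (refl Q i) ++ [eZ i])) ?_ ?_ h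
  · intro x hx
    exact AddSubsemigroup.subset_closure (List.mem_append_left _ (List.mem_map_of_mem hx))
  · intro x y _ _ hx hy
    rw [refl_add]; exact add_mem hx hy
lemma Cs_e {i : Fin n} {L : List (Fin n → ℤ)} (k : ℕ) : ((k + 1 : ℕ) : ℤ) • eZ i ∈ Cs (L ++ [eZ i]) := by
  have he : eZ i ∈ Cs (L ++ [eZ i]) := AddSubsemigroup.subset_closure (List.mem_append_right _ (by simp))
  induction k with
  | zero => simpa using he
  | succ k ih =>
    have := add_mem ih he
    convert this using 1
    push_cast; rw [add_smul (_ + _)]; simp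
theorem St.step {Q : FinQuiver n} {i : Fin n} {rest rmv : List (Fin n → ℤ)} {A Pr}
    (h : St Q (eZ i :: rest) rmv A Pr) (hs : Sink Q i) (h1 : Single Q i) :
    St (rq Q i) (rest.map (refl Q i)) (rmv.map (refl Q i) ++ [eZ i]) (Anew Q i A) (Pnew Q i Pr) := by
  have hroot : RootL (rq Q i) (rest.map (refl Q i) ++ (rmv.map (refl Q i) ++ [eZ i])) := by
    have := RootL.step (T := rest ++ rmv) h.root hs
    rwa [List.map_append, List.append_assoc] at this
  have RL' : ∀ γ, RR γ ≤ Anew Q i A γ := fun γ => le_sup_right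
  have hA : ∀ γ, ∀ a ∈ A γ, sLam Q i a ∈ Anew Q i A (refl Q i γ) := by
    intro γ a ha
    refine Submodule.mem_sup_left ⟨a, ?_, rfl⟩
    rw [refl_refl hs]; exact ha
  have sM : ∀ γ δ a, a ∈ MM Q rmv A γ δ →
      sLam Q i a ∈ MM (rq Q i) (rmv.map (refl Q i) ++ [eZ i]) (Anew Q i A) (refl Q i γ) (refl Q i δ) := by
    intro γ δ a ha
    refine MM_le (S := (MM (rq Q i) (rmv.map (refl Q i) ++ [eZ i]) (Anew Q i A) (refl Q i γ) (refl Q i δ)).comap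
      (sLam Q i).toLinearMap) ?_ ?_ ha
    · exact fun a ha => MM_A (hA _ _ ha)
    · rintro c hc a ⟨G, hG⟩
      obtain ⟨b', hb'⟩ := exists_IsI (rq Q i) (refl Q i γ) (refl Q i (δ - c)) (s2 Q i G)
      have h2 := Bp hs h1 hG hb' (MM (rq Q i) (rmv.map (refl Q i) ++ [eZ i]) (Anew Q i A) (refl Q i γ) (refl Q i δ))
        (fun a ha => MM_A (hA _ _ (h.RL _ ha))) ((RL' _).trans MM_A) (fun k => by
          rw [refl_sub, sub_sub]; exact MM_I (add_mem (Cs_step hc) (Cs_e k)))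
      have h3 : b' ∈ MM (rq Q i) (rmv.map (refl Q i) ++ [eZ i]) (Anew Q i A) (refl Q i γ) (refl Q i δ) := by
        apply MM_I (Cs_step (Q := Q) (i := i) hc)
        rw [← refl_sub]; exact ⟨_, hb'⟩
      have := add_mem h2 h3
      rwa [sub_add_cancel] at this
  have bM : ∀ γ δ G b b', IsI Q γ δ G b → IsI (rq Q i) (refl Q i γ) (refl Q i δ) (s2 Q i G) b' →
      sLam Q i b - b' ∈ MM (rq Q i) (rmv.map (refl Q i) ++ [eZ i]) (Anew Q i A) (refl Q i γ) (refl Q i δ) :=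
    fun γ δ G b b' hb hb' => Bp hs h1 hb hb' _
        (fun a ha => MM_A (hA _ _ (h.RL _ ha))) ((RL' _).trans MM_A) (fun k => MM_I (Cs_e k))
  refine ⟨hroot, RL', ?_, ?_, ?_, ?_⟩
  · intro γ p hp a ha
    obtain ⟨x, ⟨y, hy, rfl⟩, z, hz, rfl⟩ := Submodule.mem_sup.mp ha
    rw [map_add, hp.RR (fun β hβ => ((hroot.mem β).mp (List.mem_append_left _ hβ)).1) hz, add_zero]
    show ev p (sLam Q i y) = 0
    rw [ev_sLam]
    refine h.PT _ _ ?_ _ hy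
    have := (hp.refl Q i).weak (eZ i)
    rw [List.map_map] at this
    have e : (refl Q i ∘ refl Q i : (Fin n → ℤ) → Fin n → ℤ) = id := funext fun v => refl_refl hs v
    rwa [e, List.map_id] at this
  · intro γ δ g a b hg hb
    obtain ⟨x, ⟨y, hy, rfl⟩, z, hz, rfl⟩ := Submodule.mem_sup.mp hg
    obtain ⟨b0, hb0⟩ := exists_IsI Q (refl Q i γ) (refl Q i δ) (dm y * nm (sLam Q i a))
    have m1 := sM _ _ _ (h.ID _ _ _ _ _ (by rw [← refl_sub]; exact hy) hb0)
    rw [refl_refl hs, refl_refl hs] at m1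
    have hb' : IsI (rq Q i) γ δ (s2 Q i (dm y * nm (sLam Q i a))) b := by
      intro ω hω
      rw [hb ω hω, map_mul, s2_dm, s2_nm, sLam_sLam hs]
      refine sum_congr rfl fun N hN => ?_
      congr 1
      rw [map_mul, map_mul, ev_dm, ev_dm]
      congr 1
      have hN := mem_subs.mp hN
      have e : psv ω - psv N = psv (fun j => ω j \ N j) := by
        funext j k; exact (ps_sdiff (hN j).1 k).symm
      rw [e, map_add, hz (fun j => ω j \ N j), add_zero]; rfl
      intro j
      rw [card_sdiff_of_subset (hN j).1, Nat.cast_sub (card_le_card (hN j).1), hω j, (hN j).2]; rfl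
    have m2 := bM (refl Q i γ) (refl Q i δ) _ b0 b hb0 (by rw [refl_refl hs, refl_refl hs]; exact hb')
    rw [refl_refl hs, refl_refl hs] at m2
    have := sub_mem m1 m2
    rwa [sub_sub_cancel] at this
  · intro γ δ G b' hb'
    obtain ⟨b, hb⟩ := exists_IsI Q (refl Q i γ) (refl Q i δ) (s2 Q i G)
    have m1 := sM _ _ _ (h.TR _ _ _ _ hb)
    have m2 := bM _ _ _ b b' hb (by rw [refl_refl hs, refl_refl hs, s2_s2 hs]; exact hb')
    rw [refl_refl hs, refl_refl hs] at m1 m2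
    have := add_mem m1 m2
    rw [map_sub, sub_add_sub_cancel] at this
    exact this
  · intro c hc d hd hne
    have e1 : ∀ d, d ∈ Cm (rest.map (refl Q i)) → refl Q i d ∈ Cm (eZ i :: rest) := by
      intro d hd
      refine AddSubmonoid.closure_induction (motive := fun d _ => reflH Q i d ∈ Cm (eZ i :: rest)) ?_ ?_ ?_ hd
      · intro x hx
        obtain ⟨y, hy, rfl⟩ := List.mem_map.mp hx
        show refl Q i _ ∈ _
        rw [refl_refl hs]; exact AddSubmonoid.subset_closure (List.mem_cons_of_mem _ hy)
      · rw [map_zero]; exact zero_mem _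
      · intro x y _ _ hx hy; rw [map_add]; exact add_mem hx hy
    have e2 : ∃ c' ∈ Cm rmv, ∃ d' ∈ Cm (eZ i :: rest), refl Q i c = c' - d' := by
      refine AddSubmonoid.closure_induction (motive := fun c _ => ∃ c' ∈ Cm rmv, ∃ d' ∈ Cm (eZ i :: rest), reflH Q i c = c' - d') ?_ ?_ ?_ hc
      · intro x hx
        rcases List.mem_append.mp hx with hx | hx
        · obtain ⟨y, hy, rfl⟩ := List.mem_map.mp hx
          exact ⟨y, AddSubmonoid.subset_closure hy, 0, zero_mem _, by rw [sub_zero]; exact refl_refl hs y⟩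
        · rw [List.mem_singleton] at hx
          subst hx
          exact ⟨0, zero_mem _, eZ i, AddSubmonoid.subset_closure (by simp), (refl_eZ hs).trans (by simp)⟩
      · exact ⟨0, zero_mem _, 0, zero_mem _, by simp⟩
      · rintro x y _ _ ⟨c, hc, d, hd, e⟩ ⟨c', hc', d', hd', e'⟩
        exact ⟨_, add_mem hc hc', _, add_mem hd hd', by rw [map_add, e, e']; abel⟩
    obtain ⟨c', hc', d', hd', e⟩ := e2
    have e3 : refl Q i (c - d) = c' - (d' + refl Q i d) := by rw [refl_sub, e]; abel
    have := h.NG c' hc' _ (add_mem hd' (e1 d hd)) (by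
      rw [← e3]; intro h0; apply hne
      rw [← refl_refl hs (c - d), h0]; exact map_zero (reflH Q i))
    rw [eq_top_iff]
    intro a _
    refine Submodule.mem_sup_left ⟨sLam Q i a, ?_, sLam_sLam hs a⟩
    rw [e3, this]; trivial
lemma MM_e {Q : FinQuiver n} {i : Fin n} {rest rmv : List (Fin n → ℤ)} {A Pr}
    (h : St Q (eZ i :: rest) rmv A Pr) (γ : Fin n → ℤ) (m : ℤ) : MM Q rmv A γ (m • eZ i) ≤ A γ := by
  refine MM_le le_rfl fun c hc => ?_
  have : (∀ j, 0 ≤ c j) ∧ ∃ j, j ≠ i ∧ 0 < c j := by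
    refine AddSubsemigroup.closure_induction (p := fun c _ => (∀ j, 0 ≤ c j) ∧ ∃ j, j ≠ i ∧ 0 < c j) ?_ ?_ hc
    · intro x hx
      have hm := (h.root.mem x).mp (List.mem_append_right _ hx)
      refine ⟨hm.1, ?_⟩
      by_contra hcon
      push Not at hcon
      have e : x = x i • eZ i := by
        funext j
        by_cases hj : j = i
        · subst hj; simp [eZ]
        · simp [eZ, hj, le_antisymm (hcon j hj) (hm.1 j)]
      have e1 := hm.2
      rw [e, eul_smull, eul_smulr, eul_ee h.root.pos] at e1
      have e2 : x i = 1 := by have := hm.1 i; nlinarith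
      rw [e2, one_smul] at e
      have hnd := h.root.nodup
      rw [List.cons_append, List.nodup_cons] at hnd
      exact hnd.1 (List.mem_append_right _ (e ▸ hx))
    · rintro x y _ _ ⟨hx, j, hj, hj'⟩ ⟨hy, _⟩
      exact ⟨fun k => add_nonneg (hx k) (hy k), j, hj, add_pos_of_pos_of_nonneg hj' (hy j)⟩
  obtain ⟨_, j, hj, hc'⟩ := this
  exact (IR_neg (j := j) (Or.inl (by simp [eZ, hj]; exact hc'))).trans (h.RL γ)
noncomputable def Zb (Q : FinQuiver n) (i : Fin n) (ω : Fin n → Finset ℚ) : Multiset ℚ := ∑ a ∈ inA Q i, (ω (Q.tl a)).val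
lemma ps_sum {α : Type} (s : Finset α) (f : α → Multiset ℚ) (k : ℕ) : ps (∑ a ∈ s, f a) k = ∑ a ∈ s, ps (f a) k := by
  induction s using Finset.induction_on with
  | empty => simp [ps_zero]
  | insert a s ha ih => rw [sum_insert ha, sum_insert ha, ps_add]; simp [ih]
lemma card_Zb {Q : FinQuiver n} {i : Fin n} {γ : Fin n → ℤ} {ω : Fin n → Finset ℚ} (h : pts γ ω) :
    ((Zb Q i ω).card : ℤ) = zsum Q i γ := by
  simp only [Zb, zsum, ← h _]; simp
lemma prod_Zb (Q : FinQuiver n) (i : Fin n) (ω : Fin n → Finset ℚ) (y : ℚ) :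
    ((Zb Q i ω).map (fun b => y - b)).prod = ∏ a ∈ inA Q i, ∏ x ∈ ω (Q.tl a), (y - x) := by
  unfold Zb
  generalize inA Q i = s
  induction s using Finset.induction_on with
  | empty => simp
  | insert a s ha ih => rw [sum_insert ha, prod_insert ha, Multiset.map_add, Multiset.prod_add, ih]; rfl
lemma shp_e (ω : Fin n → Finset ℚ) (i : Fin n) (Y : Finset ℚ) :
    shp (Sum.elim (psv ω) 0) (tauI i) (ps Y.val) = Sum.elim (psv ω) (psv (Function.update (fun _ => ∅) i Y)) := by
  funext j k
  rcases j with j | j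
  · simp [shp, tauI]
  · by_cases hj : j = i
    · subst hj; simp [shp, tauI, psv]
    · simp [shp, tauI, psv, hj, ps_zero]
lemma Isum_e {Q : FinQuiver n} {i : Fin n} (hs : Sink Q i) (ω : Fin n → Finset ℚ) (m : ℕ) (G : L2 n) :
    Isum Q ω ((m : ℤ) • eZ i) G = ∑ Y ∈ (ω i).powersetCard m,
      (∏ y ∈ Y, ((Zb Q i ω).map (fun b => y - b)).prod) * WW (ω i) Y *
        ev (shp (Sum.elim (psv ω) 0) (tauI i) (ps Y.val)) G := by
  symm
  unfold Isum
  refine sum_bij' (fun Y _ => Function.update (fun _ => ∅) i Y) (fun N _ => N i) ?_ ?_ ?_ ?_ ?_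
  · intro Y hY
    rw [mem_powersetCard] at hY
    rw [mem_subs]
    intro j
    by_cases hj : j = i
    · subst hj; simp [eZ, hY]
    · simp [eZ, hj]
  · intro N hN
    rw [mem_subs] at hN
    have := hN i
    rw [mem_powersetCard]
    simp [eZ] at this
    exact this
  · intro Y hY; simp
  · intro N hN
    rw [mem_subs] at hN
    funext j
    by_cases hj : j = i
    · subst hj; simp
    · have := (hN j).2
      simp [eZ, hj] at this
      simp [hj, this]
  · intro Y hY
    rw [shp_e]
    congr 1
    unfold kern arr
    congr 1
    · simp_rw [prod_Zb]
      rw [prod_comm, ← Finset.prod_subset (subset_univ (inA Q i))]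
      · refine prod_congr rfl fun a ha => ?_
        rw [mem_inA] at ha
        simp [ha, hs a]
      · intro a _ ha
        rw [mem_inA] at ha
        simp [ha]
    · rw [Finset.prod_eq_single i]
      · simp
      · intro j _ hj; simp [WW, hj]
      · simp
lemma reidx (R : Finset ℚ) (m : ℕ) (f : Finset ℚ → ℚ → ℚ) :
    ∑ Y ∈ R.powersetCard m, ∑ x ∈ R \ Y, f Y x = ∑ Y ∈ R.powersetCard (m + 1), ∑ x ∈ Y, f (Y.erase x) x := by
  rw [sum_sigma', sum_sigma']
  refine sum_bij' (fun p _ => ⟨insert p.2 p.1, p.2⟩) (fun p _ => ⟨p.1.erase p.2, p.2⟩) ?_ ?_ ?_ ?_ ?_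
  · rintro ⟨Y, x⟩ h
    simp only [mem_sigma, mem_powersetCard, mem_sdiff] at h ⊢
    refine ⟨⟨Finset.insert_subset h.2.1 h.1.1, ?_⟩, by simp⟩
    rw [card_insert_of_notMem h.2.2, h.1.2]
  · rintro ⟨Y, x⟩ h
    simp only [mem_sigma, mem_powersetCard, mem_sdiff] at h ⊢
    refine ⟨⟨(Finset.erase_subset _ _).trans h.1.1, ?_⟩, h.1.1 h.2, by simp⟩
    rw [card_erase_of_mem h.2, h.1.2]; rfl
  · rintro ⟨Y, x⟩ h
    simp only [mem_sigma, mem_powersetCard, mem_sdiff] at h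
    simp [h.2.2]
  · rintro ⟨Y, x⟩ h
    simp only [mem_sigma, mem_powersetCard, mem_sdiff] at h
    simp [insert_erase h.2]
  · rintro ⟨Y, x⟩ h
    simp only [mem_sigma, mem_powersetCard, mem_sdiff] at h
    simp [h.2.2]
lemma WW_wt {R Y : Finset ℚ} {x : ℚ} (hY : Y ⊆ R) (hx : x ∈ R) (hxY : x ∉ Y) :
    WW R Y * wt (R \ Y) x = (-1) ^ Y.card * (WW R (insert x Y) * wt (insert x Y) x) := by
  rw [WW_insert hY hx hxY]
  have h1 : wt R x * ∏ y ∈ Y, (x - y) = wt (R \ Y) x := by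
    unfold wt
    have : R.erase x = (R \ Y).erase x ∪ Y := by
      ext z
      simp only [mem_erase, mem_union, mem_sdiff]
      constructor
      · tauto
      · rintro (h | h)
        · tauto
        · exact ⟨fun e => hxY (e ▸ h), hY h⟩
    rw [this, prod_union, mul_assoc, ← prod_mul_distrib, prod_eq_one (s := Y), mul_one]
    · rintro y hy
      exact inv_mul_cancel₀ (sub_ne_zero.mpr fun e => hxY (e ▸ hy))
    · rw [disjoint_left]; intro z hz hz'; simp [hz'] at hz
  have h2 : wt (insert x Y) x * ∏ y ∈ Y, (x - y) = 1 := by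
    unfold wt
    rw [Finset.erase_insert hxY, ← prod_mul_distrib, prod_eq_one]
    intro y hy
    exact inv_mul_cancel₀ (sub_ne_zero.mpr fun e => hxY (e ▸ hy))
  have h3 : ((-1 : ℚ) ^ Y.card) * (-1) ^ Y.card = 1 := by rw [← mul_pow]; simp
  rw [← h1]
  linear_combination (-(WW R Y * wt R x * ∏ y ∈ Y, (x - y))) * h3
    - ((-1 : ℚ) ^ Y.card) * (-1) ^ Y.card * (WW R Y * wt R x * ∏ y ∈ Y, (x - y)) * h2
lemma assoc {Q : FinQuiver n} {i : Fin n} (hs : Sink Q i) {γ : Fin n → ℤ} {m : ℕ} {d : ℤ} {g a b : L1 n}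
    (hd : zsum Q i γ < d + (γ i - m)) (hb : IsI Q γ ((m : ℤ) • eZ i) (dm (g * EE Q i d) * nm a) b) :
    ∃ G', IsI Q γ (((m + 1 : ℕ) : ℤ) • eZ i) G' b := by
  obtain ⟨s, hs'⟩ : ∃ s : ℕ, (s : ℤ) = d - zsum Q i γ + (γ i - m) - 1 := ⟨(d - zsum Q i γ + (γ i - m) - 1).toNat, by omega⟩
  refine ⟨(-1 : ℚ) ^ m • Dop (-tauI i) (-tauI i) ((s : ℤ) - (m + 1 : ℕ)) (dm g * nm a), fun ω hω => ?_⟩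
  rw [hb ω hω, Isum_e hs, Isum_e hs]
  set h : ℚ → ℚ := fun y => ((Zb Q i ω).map (fun b => y - b)).prod with hh
  set θ : Fin n ⊕ Fin n → ℕ → ℚ := Sum.elim (psv ω) 0 with hθ
  have key : ∀ Y ∈ (ω i).powersetCard m, (∏ y ∈ Y, h y) * WW (ω i) Y * ev (shp θ (tauI i) (ps Y.val)) (dm (g * EE Q i d) * nm a)
      = ∑ x ∈ ω i \ Y, (∏ y ∈ insert x Y, h y) * ((-1) ^ m * (WW (ω i) (insert x Y) * wt (insert x Y) x)) * x ^ s *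
        ev (shp θ (tauI i) (ps Y.val)) (dm g * nm a) := by
    intro Y hY
    rw [mem_powersetCard] at hY
    have e1 : ev (shp θ (tauI i) (ps Y.val)) (dm (EE Q i d)) = ∑ x ∈ ω i \ Y, wt (ω i \ Y) x * x ^ s * h x := by
      rw [residue, hθ, shp_e, ev_dm, EE, map_Ez]
      have ec : ((s : ℤ) + 1 + (Zb Q i ω).card - (ω i \ Y).card) = d := by
        rw [card_Zb hω, card_sdiff_of_subset hY.1, Nat.cast_sub (card_le_card hY.1), hω i, hY.2]; omega
      rw [ec]
      refine Ez_congr (fun k => ?_) d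
      rw [ps_sdiff hY.1, Zb, ps_sum]
      simp only [map_sub, zsum, map_sum, ev_X]
      congr 1
      · refine sum_congr rfl fun a ha => ?_
        simp [psv, hs a, ps_zero]
      · simp [psv]
    rw [map_mul dm, map_mul, map_mul, e1, map_mul (ev _) (dm g), mul_sum, sum_mul, mul_sum]
    refine sum_congr rfl fun x hx => ?_
    rw [mem_sdiff] at hx
    rw [← hY.2, ← WW_wt hY.1 hx.1 hx.2, prod_insert hx.2]
    ring
  rw [sum_congr rfl key, reidx (ω i) m (fun Y x => (∏ y ∈ insert x Y, h y) * ((-1) ^ m * (WW (ω i) (insert x Y) * wt (insert x Y) x)) * x ^ s *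
        ev (shp θ (tauI i) (ps Y.val)) (dm g * nm a))]
  refine sum_congr rfl fun Y hY => ?_
  rw [mem_powersetCard] at hY
  rw [map_smul, ev_Dop (-tauI i) (-tauI i) _ _ _ Y (Multiset.replicate s 0), smul_eq_mul, mul_sum, mul_sum]
  · refine sum_congr rfl fun x hx => ?_
    rw [insert_erase hx]
    have : shp (shp θ (tauI i) (ps Y.val)) (-tauI i) (fun k => x ^ (k + 1)) = shp θ (tauI i) (ps (Y.erase x).val) := by
      funext j k
      have : ps (Y.erase x).val k = ps Y.val k - x ^ (k + 1) := by
        rw [ps_finset, ps_finset, ← add_sum_erase Y _ hx]; ring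
      simp only [shp, this, Pi.neg_apply]; ring
    rw [this]
    simp
    ring
  · intro k
    have : ∀ j, (-tauI i) j * shp θ (tauI i) (ps Y.val) j k = - ((Pi.single (inr i) 1 : Fin n ⊕ Fin n → ℚ) j * shp θ (tauI i) (ps Y.val) j k) := by
      intro j; simp [tauI]
    rw [sum_congr rfl fun j _ => this j, Finset.sum_neg_distrib, single_dot (inr i) (fun j => shp θ (tauI i) (ps Y.val) j k)]
    simp [ps, shp, tauI, hθ]
  · simp [hY.2]
abbrev PN := MvPolynomial ℕ ℚ
noncomputable def pm (m : ℕ) : PN →ₐ[ℚ] MvPolynomial (Fin m) ℚ := aeval (fun k => psum (Fin m) ℚ (k + 1))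
lemma eval_pm {m : ℕ} (x : Fin m → ℚ) (f : PN) : eval x (pm m f) = aeval (ps (Finset.univ.val.map x)) f := by
  have : ((aeval x : MvPolynomial (Fin m) ℚ →ₐ[ℚ] ℚ).comp (pm m)) = aeval (ps (Finset.univ.val.map x)) := by
    apply MvPolynomial.algHom_ext; intro k; simp only [AlgHom.comp_apply, pm, aeval_X, psum, ps, map_sum, map_pow, Multiset.map_map]; rfl
  have := DFunLike.congr_fun this f
  simpa [MvPolynomial.coe_aeval_eq_eval] using this
lemma enum {m : ℕ} (s : Multiset ℚ) (h : s.card = m) : ∃ x : Fin m → ℚ, Finset.univ.val.map x = s := by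
  obtain ⟨l, rfl⟩ : ∃ l : List ℚ, s = l := ⟨s.toList, by simp⟩
  rw [Multiset.coe_card] at h
  subst h
  exact ⟨l.get, by rw [Fin.univ_val_map, List.ofFn_get l]⟩
lemma pm_ker {m : ℕ} {f : PN} (h : pm m f = 0) (s : Multiset ℚ) (hs : s.card = m) : aeval (ps s) f = 0 := by
  obtain ⟨x, rfl⟩ := enum s hs
  rw [← eval_pm, h, map_zero]
lemma exJ (m : ℕ) : ∃ J : Set (ℕ →₀ ℕ), (∀ f, ∃ f' ∈ Submodule.span ℚ ((fun s => (monomial s 1 : PN)) '' J), pm m (f - f') = 0) ∧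
    LinearIndepOn ℚ (fun s => pm m (monomial s 1)) J := by
  obtain ⟨κ, a, ha, h1, h2⟩ := exists_linearIndependent' ℚ (fun s : ℕ →₀ ℕ => pm m (monomial s 1))
  refine ⟨Set.range a, fun f => ?_, ?_⟩
  · have hf : pm m f ∈ Submodule.span ℚ (Set.range fun s : ℕ →₀ ℕ => pm m (monomial s 1)) := by
      rw [f.as_sum, map_sum]
      refine Submodule.sum_mem _ fun s _ => ?_
      have : (monomial s (coeff s f) : PN) = coeff s f • monomial s 1 := by simp [smul_monomial]
      rw [this, map_smul]
      exact Submodule.smul_mem _ _ (Submodule.subset_span ⟨s, rfl⟩)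
    rw [← h1, show Set.range ((fun s : ℕ →₀ ℕ => pm m (monomial s 1)) ∘ a) = (pm m).toLinearMap '' ((fun s => (monomial s 1 : PN)) '' Set.range a) by
      rw [← Set.range_comp, ← Set.range_comp]; rfl, ← Submodule.map_span] at hf
    obtain ⟨f', h3, h4⟩ := hf
    exact ⟨f', h3, by rw [map_sub, sub_eq_zero]; exact h4.symm⟩
  · exact (linearIndepOn_range_iff ha _).mpr h2
noncomputable def J (m : ℕ) : Set (ℕ →₀ ℕ) := (exJ m).choose
lemma J1 (m : ℕ) (f : PN) : ∃ f' ∈ Submodule.span ℚ ((fun s => (monomial s 1 : PN)) '' J m), pm m (f - f') = 0 := (exJ m).choose_spec.1 f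
lemma J2 (m : ℕ) : LinearIndepOn ℚ (fun s => pm m (monomial s 1)) (J m) := (exJ m).choose_spec.2
abbrev PLn (n : ℕ) := (Fin n → ℤ) × (PN →ₐ[ℚ] L1 n)
def Cp (q : PLn n) : Prop := ∀ (x : ℕ → ℚ) f, ev (fun j k => (q.1 j : ℚ) * x k) (q.2 f) = aeval x f
noncomputable def stp (Q : FinQuiver n) (i : Fin n) (q : PLn n) : PLn n := (refl Q i q.1, (sLam Q i).comp q.2)
lemma Cp.stp {q : PLn n} (h : Cp q) {Q : FinQuiver n} {i : Fin n} (hs : Sink Q i) : Cp (stp Q i q) := by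
  intro x f
  simp only [CoH.stp, AlgHom.comp_apply, ev_sLam]
  rw [← h x f]
  congr 1
  have e : (fun (j : Fin n) (k : ℕ) => ((CoH.refl Q i q.1 j : ℤ) : ℚ) * x k) = CoH.refl Q i (fun j k => (q.1 j : ℚ) * x k) := by
    funext j k
    by_cases hj : j = i
    · subst hj; simp [refl_same, zsum, sum_mul, sub_mul]
    · simp [refl_ne Q hj]
  rw [e, refl_refl hs]
noncomputable def Dm : List (PLn n) → List (ℕ × (ℕ →₀ ℕ)) → (Fin n → ℤ)
  | q :: L, x :: js => Dm L js + (x.1 : ℤ) • q.1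
  | _, _ => 0
noncomputable def Psi (Pr : Prj n) : List (PLn n) → List (ℕ × (ℕ →₀ ℕ)) → L1 n
  | q :: L, x :: js => Pr (Dm L js + (x.1 : ℤ) • q.1) ((x.1 : ℤ) • q.1) (dm (Psi Pr L js) * nm (q.2 (monomial x.2 1)))
  | _, _ => 1
def Val (PL : List (PLn n)) (js : List (ℕ × (ℕ →₀ ℕ))) : Prop := js.length = PL.length ∧ ∀ x ∈ js, x.2 ∈ J x.1
lemma refl_zero' {M : Type} [AddCommGroup M] (Q : FinQuiver n) (i : Fin n) : refl Q i (0 : Fin n → M) = 0 := by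
  have := refl_sub Q i (0 : Fin n → M) 0; simpa using this
lemma Dm_stp (Q : FinQuiver n) (i : Fin n) (PL : List (PLn n)) (js) : Dm (PL.map (stp Q i)) js = refl Q i (Dm PL js) := by
  induction PL generalizing js with
  | nil => simp [Dm, refl_zero']
  | cons q L ih =>
    cases js with
    | nil => simp [Dm, refl_zero']
    | cons x js => simp only [List.map_cons, Dm, ih, refl_add, refl_smul]; rfl
lemma Psi_stp {Q : FinQuiver n} {i : Fin n} (hs : Sink Q i) (Pr : Prj n) (PL : List (PLn n)) (js) :
    Psi (Pnew Q i Pr) (PL.map (stp Q i)) js = sLam Q i (Psi Pr PL js) := by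
  induction PL generalizing js with
  | nil => simp [Psi]
  | cons q L ih =>
    cases js with
    | nil => simp [Psi]
    | cons x js =>
      simp only [List.map_cons, Psi, ih, Dm_stp, Pnew, stp, ← refl_smul, ← refl_add, refl_refl hs]
      simp [s2_dm, s2_nm, sLam_sLam hs]
def PsiS (Pr : Prj n) (PL : List (PLn n)) (γ : Fin n → ℤ) : Set (L1 n) := {x | ∃ js, Val PL js ∧ Dm PL js = γ ∧ Psi Pr PL js = x}
lemma L2span (T : Submodule ℚ (L2 n)) (h : ∀ g a, dm g * nm a ∈ T) (G : L2 n) : G ∈ T := by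
  have hle : Submodule.span ℚ {x | ∃ g a : L1 n, x = dm g * nm a} ≤ T := by
    rw [Submodule.span_le]; rintro _ ⟨g, a, rfl⟩; exact h g a
  apply hle
  have hX : ∀ (p : L2 n), p ∈ Submodule.span ℚ {x | ∃ g a : L1 n, x = dm g * nm a} → ∀ g a : L1 n,
      p * (dm g * nm a) ∈ Submodule.span ℚ {x | ∃ g a : L1 n, x = dm g * nm a} := by
    intro p hp g a
    refine Submodule.span_induction (p := fun p _ => p * (dm g * nm a) ∈ Submodule.span ℚ {x | ∃ g a : L1 n, x = dm g * nm a}) ?_ ?_ ?_ ?_ hp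
    · rintro _ ⟨g', a', rfl⟩
      exact Submodule.subset_span ⟨g' * g, a' * a, by rw [map_mul, map_mul]; ring⟩
    · simp
    · intro x y _ _ hx hy; rw [add_mul]; exact add_mem hx hy
    · intro c x _ hx; rw [smul_mul_assoc]; exact Submodule.smul_mem _ _ hx
  induction G using MvPolynomial.induction_on with
  | C c => exact Submodule.subset_span ⟨C c, 1, by rw [map_one, mul_one]; exact (algHom_C dm c).symm⟩
  | add p q hp hq => exact add_mem hp hq
  | mul_X p j hp =>
    obtain ⟨j | j, k⟩ := j
    · have e : (X (inl j, k) : L2 n) = dm (X (j, k)) * nm 1 + dm 1 * nm (X (j, k)) := by simp [dm, nm]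
      rw [e, mul_add]
      exact add_mem (hX _ hp _ _) (hX _ hp _ _)
    · have e : (X (inr j, k) : L2 n) = dm 1 * nm (X (j, k)) := by simp [dm, nm]
      rw [e]
      exact hX _ hp _ _
def Tsub (Q : FinQuiver n) (γ δ : Fin n → ℤ) (U : Submodule ℚ (L1 n)) : Submodule ℚ (L2 n) where
  carrier := {G | ∃ b ∈ U, IsI Q γ δ G b}
  add_mem' := by rintro G G' ⟨b, h1, h2⟩ ⟨b', h1', h2'⟩; exact ⟨b + b', add_mem h1 h1', h2.add h2'⟩
  zero_mem' := ⟨0, U.zero_mem, fun ω _ => by simp [Isum]⟩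
  smul_mem' := by rintro c G ⟨b, h1, h2⟩; exact ⟨c • b, U.smul_mem c h1, h2.smul c⟩
lemma Tsub_mem {Q : FinQuiver n} {γ δ : Fin n → ℤ} {U : Submodule ℚ (L1 n)} {G : L2 n} (h : ∀ b, IsI Q γ δ G b → b ∈ U) :
    G ∈ Tsub Q γ δ U := by
  obtain ⟨b, hb⟩ := exists_IsI Q γ δ G
  exact ⟨b, h b hb, hb⟩
lemma pts_refl {Q : FinQuiver n} {i : Fin n} {γ : Fin n → ℤ} {ω : Fin n → Finset ℚ} (hω : pts γ ω) (hd : DisjAt Q i ω)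
    (hsub : ω i ⊆ zset Q i ω) : pts (refl Q i γ) (Function.update ω i (zset Q i ω \ ω i)) := by
  intro j
  by_cases hj : j = i
  · subst hj
    rw [update_self, card_sdiff_of_subset hsub, Nat.cast_sub (card_le_card hsub), hω, refl_same, card_zset hd]
    congr 1
    simp only [zsum, ← hω _]; simp
  · rw [update_of_ne hj, refl_ne Q hj]; exact hω j
noncomputable def phI (i : Fin n) : L1 n →ₐ[ℚ] PN := aeval (fun p => if p.1 = i then X p.2 else 0)
lemma ev_phI (i : Fin n) (x : ℕ → ℚ) (a : L1 n) : aeval x (phI i a) = ev (fun j k => ((eZ i j : ℤ) : ℚ) * x k) a := by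
  have : (aeval x : PN →ₐ[ℚ] ℚ).comp (phI i) = ev (fun j k => ((eZ i j : ℤ) : ℚ) * x k) := by
    apply MvPolynomial.algHom_ext; rintro ⟨j, k⟩
    by_cases hj : j = i
    · subst hj; simp [phI, ev_X, eZ]
    · simp [phI, ev_X, eZ, hj]
  exact DFunLike.congr_fun this a
lemma ev_shp_nm (ω : Fin n → Finset ℚ) (i : Fin n) (Y : Finset ℚ) (a : L1 n) :
    ev (shp (Sum.elim (psv ω) 0) (tauI i) (ps Y.val)) (nm a) = ev (fun j k => ((eZ i j : ℤ) : ℚ) * ps Y.val k) a := by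
  rw [shp_e, ev_nm]
  refine ev_congr (fun j k => ?_) a
  by_cases hj : j = i
  · subst hj; simp [psv, eZ]
  · simp [psv, eZ, hj, ps_zero]
theorem Sthm (l : ℕ) : ∀ (PL : List (PLn n)) Q rmv A Pr, PL.length = l → St Q (PL.map Prod.fst) rmv A Pr → (∀ q ∈ PL, Cp q) →
    ∀ γ a, a ∈ Submodule.span ℚ (PsiS Pr PL γ) ⊔ A γ := by
  induction l with
  | zero =>
    intro PL Q rmv A Pr hl h hc γ a
    obtain rfl := List.length_eq_zero_iff.mp hl
    by_cases h0 : γ = 0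
    · subst h0
      have e : a = (ev 0 a) • (1 : L1 n) + (a - (ev 0 a) • (1 : L1 n)) := by ring
      rw [e]
      refine Submodule.add_mem_sup (Submodule.smul_mem _ _ (Submodule.subset_span ⟨[], ⟨rfl, by simp⟩, by simp [Dm], by simp [Psi]⟩)) (h.RL 0 ?_)
      intro ω hω
      have : psv ω = 0 := by
        funext j k
        have := hω j
        simp at this
        simp [psv, this, ps_zero]
      simp [this]
    · refine Submodule.mem_sup_right ?_
      by_cases hn : ∃ j, γ j < 0
      · obtain ⟨j, hj⟩ := hn
        exact h.RL γ (by rw [RR_top hj]; trivial)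
      · push Not at hn
        have hm : γ ∈ Cm rmv := by
          rw [eq_sum_eZ γ]
          refine AddSubmonoid.sum_mem _ fun j _ => ?_
          have : eZ j ∈ Cm rmv := AddSubmonoid.subset_closure ((h.root.mem (eZ j)).mpr ⟨fun k => by
            by_cases hk : k = j <;> simp [eZ, Pi.single_apply, hk], eul_ee h.root.pos j⟩)
          obtain ⟨k, hk⟩ := Int.eq_ofNat_of_zero_le (hn j)
          rw [hk, natCast_zsmul]
          exact AddSubmonoid.nsmul_mem _ this k
        have := h.NG γ hm 0 (zero_mem _) (by simpa using h0)
        rw [sub_zero] at this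
        rw [this]; trivial
  | succ l ih =>
    intro PL Q rmv A Pr hl h hc γ a
    obtain _ | ⟨⟨e, c⟩, L⟩ := PL
    · simp at hl
    obtain ⟨i, rfl, hs, h1⟩ := head_simple (T := L.map Prod.fst ++ rmv) h.root
    have h' := h.step hs h1
    have hmp : (L.map (stp Q i)).map Prod.fst = (L.map Prod.fst).map (refl Q i) := by
      rw [List.map_map, List.map_map]; rfl
    rw [← hmp] at h'
    have IH := ih (L.map (stp Q i)) _ _ _ _ (by simpa using hl) h' (by
      intro q hq
      obtain ⟨q, hq', rfl⟩ := List.mem_map.mp hq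
      exact (hc q (List.mem_cons_of_mem _ hq')).stp hs)
    have hLam : ∀ γ' g, ∀ S : Submodule ℚ (L1 n), (∀ js, Val L js → Dm L js = γ' → Psi Pr L js ∈ S) → A γ' ≤ S →
        (∀ g d, zsum Q i γ' < d + γ' i → g * EE Q i d ∈ S) → g ∈ S := by
      intro γ' g S hS1 hS2 hS3
      have h3 := IH (refl Q i γ') (sLam Q i g)
      suffices hh : Submodule.span ℚ (PsiS (Pnew Q i Pr) (L.map (stp Q i)) (refl Q i γ')) ⊔ Anew Q i A (refl Q i γ') ≤ S.comap (sLam Q i).toLinearMap by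
        have := hh h3
        simpa [sLam_sLam hs] using this
      refine sup_le (Submodule.span_le.mpr ?_) (sup_le ?_ ?_)
      · rintro _ ⟨js, hv, hD, rfl⟩
        rw [Dm_stp] at hD
        have hD' : Dm L js = γ' := by rw [← refl_refl hs (Dm L js), hD, refl_refl hs]
        have := hS1 js ⟨by simpa using hv.1, hv.2⟩ hD'
        simpa [Psi_stp hs, sLam_sLam hs] using this
      · rw [Submodule.map_le_iff_le_comap, refl_refl hs]
        intro x hx
        have := hS2 hx
        simpa [sLam_sLam hs] using this
      · intro x hx
        refine kernel_lemma hs h1 γ' _ ?_ S ((h.RL γ').trans hS2) hS3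
        intro ω hω hd hsub
        simp only [AlgHom.toLinearMap_apply, ev_sLam]
        rw [← refl_psv hd hsub]
        exact hx _ (pts_refl hω hd hsub)
    set U := Submodule.span ℚ (PsiS Pr ((eZ i, c) :: L) γ) ⊔ A γ with hU
    have hAU : A γ ≤ U := le_sup_right
    have main : ∀ k m : ℕ, γ i < m + k → ∀ G b, IsI Q γ ((m : ℤ) • eZ i) G b → b ∈ U := by
      intro k
      induction k with
      | zero =>
        intro m hm G b hb
        exact hAU (h.RL γ (IR_neg (j := i) (Or.inr (by simpa [eZ] using hm)) ⟨G, hb⟩))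
      | succ k ihk =>
        intro m hm G b hb
        have hT : G ∈ Tsub Q γ ((m : ℤ) • eZ i) U := by
          refine L2span _ (fun g a => ?_) G
          refine hLam (γ - (m : ℤ) • eZ i) g ((Tsub Q γ ((m : ℤ) • eZ i) U).comap ((LinearMap.mulRight ℚ (nm a)) ∘ₗ dm.toLinearMap)) ?_ ?_ ?_
          · intro js hv hD
            obtain ⟨f', hf', hp⟩ := J1 m (phI i a)
            have hmem : dm (Psi Pr L js) * nm (c f') ∈ Tsub Q γ ((m : ℤ) • eZ i) U := by
              suffices hh : Submodule.span ℚ ((fun s => (monomial s 1 : PN)) '' J m) ≤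
                  (Tsub Q γ ((m : ℤ) • eZ i) U).comap ((LinearMap.mulLeft ℚ (dm (Psi Pr L js))) ∘ₗ nm.toLinearMap ∘ₗ c.toLinearMap) from hh hf'
              rw [Submodule.span_le]
              rintro _ ⟨s, hsJ, rfl⟩
              refine Tsub_mem fun b hb => ?_
              have h5 := MM_e h γ m (h.TR _ _ _ _ hb)
              have h6 : Pr γ ((m : ℤ) • eZ i) (dm (Psi Pr L js) * nm (c (monomial s 1))) ∈ U := by
                refine Submodule.mem_sup_left (Submodule.subset_span ⟨(m, s) :: js, ⟨?_, ?_⟩, ?_, ?_⟩)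
                · simp [hv.1]
                · simpa [hsJ] using hv.2
                · simp [Dm, hD]
                · simp [Psi, hD]
              have := sub_mem h6 (hAU h5)
              simpa using this
            obtain ⟨b, hbU, hb⟩ := hmem
            refine ⟨b, hbU, fun ω hω => ?_⟩
            rw [hb ω hω, Isum_e hs, Isum_e hs]
            refine sum_congr rfl fun Y hY => ?_
            rw [mem_powersetCard] at hY
            congr 1
            simp only [LinearMap.comp_apply, AlgHom.toLinearMap_apply, LinearMap.mulRight_apply, map_mul]
            congr 1
            rw [ev_shp_nm, ev_shp_nm, ← ev_phI i _ a]
            have h7 := hc (eZ i, c) (by simp) (ps Y.val) f'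
            simp only at h7
            rw [h7]
            have h8 := pm_ker hp Y.val hY.2
            rw [map_sub, sub_eq_zero] at h8
            exact h8.symm
          · intro g hg
            exact Tsub_mem fun b hb => hAU (MM_e h γ m (h.ID _ _ _ _ _ hg hb))
          · intro g d hd
            refine Tsub_mem fun b hb => ?_
            obtain ⟨G', hG'⟩ := assoc hs (d := d) (by
              rw [zsum_congr hs (β := γ) (fun j hj => by simp [eZ, hj])] at hd
              simpa [eZ] using hd) hb
            exact ihk (m + 1) (by push_cast at hm ⊢; omega) G' b hG'
        obtain ⟨b', hb', hI⟩ := hT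
        have := add_mem (hAU (h.RL γ (hb.sub_mem hI))) hb'
        simpa using this
    refine main (γ i).toNat.succ 0 (by push_cast; have := Int.self_le_toNat (γ i); omega) (dm a) a ?_
    intro ω hω
    rw [Isum_e hs]
    simp only [powersetCard_zero, sum_singleton]
    rw [shp_e, ev_dm]
    simp only [Finset.prod_empty, WW, one_mul]
    refine ev_congr (fun j k => ?_) a
    have : psv (Function.update (fun _ => (∅ : Finset ℚ)) i ∅) = 0 := by funext j k; simp [psv, ps_zero]
    rw [this, sub_zero]
noncomputable def ellJ (Q : FinQuiver n) (i : Fin n) : Fin n ⊕ Fin n → ℚ :=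
  fun j => 2 * (Pi.single (inr i) 1 : Fin n ⊕ Fin n → ℚ) j - (Pi.single (inl i) 1 : Fin n ⊕ Fin n → ℚ) j +
    ∑ a ∈ inA Q i, (Pi.single (inl (Q.tl a)) 1 : Fin n ⊕ Fin n → ℚ) j
lemma ellJ_dot (Q : FinQuiver n) (i : Fin n) (θ : Fin n ⊕ Fin n → ℚ) :
    ∑ j, ellJ Q i j * θ j = 2 * θ (inr i) - θ (inl i) + ∑ a ∈ inA Q i, θ (inl (Q.tl a)) := by
  simp only [ellJ, add_mul, sub_mul, sum_add_distrib, sum_sub_distrib, mul_assoc, ← mul_sum, single_dot,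
    sum_mul]
  rw [sum_comm]
  simp only [single_dot]
lemma sign_sq (k : ℕ) : ((-1 : ℚ) ^ k) * (-1) ^ k = 1 := by rw [← mul_pow]; simp
lemma EVAL {Q : FinQuiver n} {i : Fin n} (hs : Sink Q i) {γ : Fin n → ℤ} {m' : ℕ} {G : L2 n} {b : L1 n} {p0 p : Fin n → ℕ → ℚ}
    {x : Finset ℚ} {B : Multiset ℚ} (hB : ∀ k, ps B k = refl Q i p0 i k) (hBc : (B.card : ℤ) = zsum Q i γ - γ i + x.card)
    (hb : IsI Q γ ((m' : ℤ) • eZ i) G b) (hp : p = p0 + fun j k => ((eZ i j : ℤ) : ℚ) * ps x.val k)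
    (hlim : ∀ a ∈ RR γ, ev p a = 0) :
    ev p b = (-1) ^ (m'.choose 2) * ∑ Y ∈ x.powersetCard m', tm (tauI i) x B (Sum.elim p 0) Y G := by
  obtain ⟨H, hH⟩ := SS_univ (tauI i) (ellJ Q i) (by rw [ellJ_dot]; simp [tauI]) (zsum Q i γ - γ i) m' G
  have h1 : b - (-1 : ℚ) ^ (m'.choose 2) • res0 H ∈ RR γ := by
    intro ω hω
    rw [map_sub, map_smul, ev_res0, ← hH (ω i) (Zb Q i ω), hb ω hω, Isum_e hs, smul_eq_mul, mul_sum, sub_eq_zero]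
    · refine sum_congr rfl fun Y hY => ?_
      rw [mem_powersetCard] at hY
      rw [tm, hY.2]
      linear_combination (-((∏ y ∈ Y, ((Zb Q i ω).map (fun b => y - b)).prod) * WW (ω i) Y *
        ev (shp (Sum.elim (psv ω) 0) (tauI i) (ps Y.val)) G)) * sign_sq (m'.choose 2)
    · intro k
      rw [ellJ_dot Q i (fun j => (Sum.elim (psv ω) 0 : Fin n ⊕ Fin n → ℕ → ℚ) j k), Zb, ps_sum]
      simp [psv]; ring
    · rw [card_Zb hω, hω]
  have h2 := hlim _ h1
  rw [map_sub, sub_eq_zero, map_smul, ev_res0, ← hH x B, smul_eq_mul] at h2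
  · exact h2
  · intro k
    rw [ellJ_dot Q i (fun j => (Sum.elim p 0 : Fin n ⊕ Fin n → ℕ → ℚ) j k), hB, refl_same, hp]
    have e : ∀ a ∈ inA Q i, (p0 + fun j k => ((eZ i j : ℤ) : ℚ) * ps x.val k) (Q.tl a) k = p0 (Q.tl a) k := by
      intro a _
      simp [eZ, hs a]
    simp only [Sum.elim_inl, Sum.elim_inr]
    rw [sum_congr rfl e]
    simp [zsum, eZ]; ring
  · rw [hBc]; ring
theorem Ithm (l : ℕ) : ∀ (PL : List (PLn n)) Q rmv A Pr, PL.length = l → St Q (PL.map Prod.fst) rmv A Pr → (∀ q ∈ PL, Cp q) →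
    ∀ γ (F : Finset (List (ℕ × (ℕ →₀ ℕ)))) (c : List (ℕ × (ℕ →₀ ℕ)) → ℚ), (∀ js ∈ F, Val PL js ∧ Dm PL js = γ) →
    (∀ p, TP (PL.map Prod.fst) γ p → ∑ js ∈ F, c js * ev p (Psi Pr PL js) = 0) → ∀ js ∈ F, c js = 0 := by
  induction l with
  | zero =>
    intro PL Q rmv A Pr hl h hc γ F c hF hz js hjs
    obtain rfl := List.length_eq_zero_iff.mp hl
    have hnil : ∀ js ∈ F, js = [] := fun js hjs => List.length_eq_zero_iff.mp (hF js hjs).1.1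
    have hF1 : F = {[]} := Finset.eq_singleton_iff_unique_mem.mpr ⟨hnil js hjs ▸ hjs, hnil⟩
    have hg : γ = 0 := by rw [← (hF js hjs).2, hnil js hjs]; simp [Dm]
    have := hz 0 (hg ▸ TP.nil)
    rw [hnil js hjs]
    simpa [hF1, Psi] using this
  | succ l ih =>
    intro PL Q rmv A Pr hl h hc γ F c hF hz
    obtain _ | ⟨⟨e, cc⟩, L⟩ := PL
    · simp at hl
    obtain ⟨i, rfl, hs, h1⟩ := head_simple (T := L.map Prod.fst ++ rmv) h.root
    have h' := h.step hs h1
    have hmp : (L.map (stp Q i)).map Prod.fst = (L.map Prod.fst).map (refl Q i) := by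
      rw [List.map_map, List.map_map]; rfl
    have hmp2 : ((L.map (stp Q i)).map Prod.fst).map (refl Q i) = L.map Prod.fst := by
      rw [hmp, List.map_map]
      convert List.map_id _
      funext v; exact refl_refl hs v
    rw [← hmp] at h'
    have IH := ih (L.map (stp Q i)) _ _ _ _ (by simpa using hl) h' (by
      intro q hq
      obtain ⟨q, hq', rfl⟩ := List.mem_map.mp hq
      exact (hc q (List.mem_cons_of_mem _ hq')).stp hs)
    have hposL : ∀ β ∈ eZ i :: L.map Prod.fst, ∀ j, 0 ≤ β j := fun β hβ =>
      ((h.root.mem β).mp (List.mem_append_left _ hβ)).1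
    have hposL' : ∀ β ∈ (L.map Prod.fst).map (refl Q i), ∀ j, 0 ≤ β j := fun β hβ =>
      ((h'.root.mem β).mp (List.mem_append_left _ (hmp ▸ hβ))).1
    let hdj : List (ℕ × (ℕ →₀ ℕ)) → ℕ × (ℕ →₀ ℕ) := fun js => js.headD (0, 0)
    have hcons : ∀ js ∈ F, js = hdj js :: js.tail := by
      intro js hjs
      have := (hF js hjs).1.1
      cases js with
      | nil => simp at this
      | cons x js => rfl
    have hVal : ∀ js ∈ F, (hdj js).2 ∈ J (hdj js).1 ∧ Val L js.tail ∧ Dm L js.tail = γ - ((hdj js).1 : ℤ) • eZ i := by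
      intro js hjs
      have hh := hF js hjs
      rw [hcons js hjs] at hh
      refine ⟨hh.1.2 _ (by simp), ⟨by simpa using hh.1.1, fun x hx => hh.1.2 x (List.mem_cons_of_mem _ hx)⟩, ?_⟩
      rw [← hh.2]; simp [Dm]
    have hPsi : ∀ js ∈ F, Psi Pr ((eZ i, cc) :: L) js = Pr γ (((hdj js).1 : ℤ) • eZ i) (dm (Psi Pr L js.tail) * nm (cc (monomial (hdj js).2 1))) := by
      intro js hjs
      have e : Dm ((eZ i, cc) :: L) js = γ := (hF js hjs).2
      rw [hcons js hjs] at e ⊢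
      simp only [Psi]
      simp only [Dm] at e
      rw [e]
      rfl
    suffices hm : ∀ m : ℕ, ∀ js ∈ F, (hdj js).1 = m → c js = 0 from fun js hjs => hm _ js hjs rfl
    intro m
    induction m using Nat.strong_induction_on with
    | _ m ihm =>
    let Fm := F.filter fun js => (hdj js).1 = m
    -- vanishing for each T-point
    have step1 : ∀ p0, TP (L.map Prod.fst) (γ - (m : ℤ) • eZ i) p0 → ∃ B : Multiset ℚ, ∀ x : Finset ℚ, x.card = m →
        (∏ y ∈ x, (B.map (fun b => y - b)).prod) *
          ∑ js ∈ Fm, c js * ev p0 (Psi Pr L js.tail) * aeval (ps x.val) (monomial (hdj js).2 1 : PN) = 0 := by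
      intro p0 hp0
      obtain ⟨M, hM1, hM2⟩ := (hp0.refl Q i).lim hposL'
      refine ⟨M i, fun x hx => ?_⟩
      have hTP := hp0.cons (eZ i) x.val
      rw [show Multiset.card x.val = m from hx, sub_add_cancel] at hTP
      set p := p0 + fun j k => ((eZ i j : ℤ) : ℚ) * ps x.val k with hp
      have hz' := hz p hTP
      have hEv : ∀ js ∈ F, c js * ev p (Psi Pr ((eZ i, cc) :: L) js) =
          if (hdj js).1 = m then (∏ y ∈ x, ((M i).map (fun b => y - b)).prod) *
            (c js * ev p0 (Psi Pr L js.tail) * aeval (ps x.val) (monomial (hdj js).2 1 : PN)) else 0 := by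
        intro js hjs
        by_cases hlt : (hdj js).1 < m
        · rw [ihm _ hlt js hjs rfl, if_neg hlt.ne, zero_mul]
        obtain ⟨b, hb⟩ := exists_IsI Q γ (((hdj js).1 : ℤ) • eZ i) (dm (Psi Pr L js.tail) * nm (cc (monomial (hdj js).2 1)))
        have hA := h.PT γ p hTP _ (MM_e h γ _ (h.TR _ _ _ _ hb))
        rw [map_sub, sub_eq_zero] at hA
        rw [hPsi js hjs, hA, EVAL hs (B := M i) (fun k => (congrFun (congrFun hM2 i) k).symm) (by
          rw [hM1, refl_same, zsum_congr hs (β := γ) (fun j hj => by simp [eZ, hj]), hx]; simp [eZ]; ring) hb hp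
          (fun a ha => hTP.RR hposL ha)]
        by_cases heq : (hdj js).1 = m
        · rw [if_pos heq, heq, ← hx, Finset.powersetCard_self, sum_singleton, tm]
          have e1 : shp (Sum.elim p 0) (tauI i) (ps x.val) = Sum.elim p (fun j k => ((eZ i j : ℤ) : ℚ) * ps x.val k) := by
            funext j k
            rcases j with j | j
            · simp [shp, tauI]
            · by_cases hj : j = i
              · subst hj; simp [shp, tauI, eZ]
              · simp [shp, tauI, eZ, hj]
          have e2 : p - (fun j k => ((eZ i j : ℤ) : ℚ) * ps x.val k) = p0 := by rw [hp]; simp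
          have e3 := hc (eZ i, cc) (by simp) (ps x.val) (monomial (hdj js).2 1)
          have e4 : WW x x = 1 := by simp [WW]
          rw [e1, map_mul, ev_dm, ev_nm, e2, e4]
          simp only at e3
          rw [e3]
          linear_combination (c js * ((∏ y ∈ x, ((M i).map (fun b => y - b)).prod) * 
            (ev p0 (Psi Pr L js.tail) * aeval (ps x.val) (monomial (hdj js).2 1 : PN)))) * sign_sq (x.card.choose 2)
        · rw [if_neg heq, Finset.powersetCard_eq_empty.mpr (by omega)]
          simp
      rw [sum_congr rfl hEv, ← sum_filter, ← mul_sum] at hz'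
      exact hz'
    have step2 : ∀ p0, TP (L.map Prod.fst) (γ - (m : ℤ) • eZ i) p0 → ∀ s ∈ Fm.image (fun js => (hdj js).2),
        ∑ js ∈ Fm with (hdj js).2 = s, c js * ev p0 (Psi Pr L js.tail) = 0 := by
      intro p0 hp0
      obtain ⟨B, hB⟩ := step1 p0 hp0
      have hP : ∑ js ∈ Fm, (c js * ev p0 (Psi Pr L js.tail)) • pm m (monomial (hdj js).2 1 : PN) = 0 := by
        have h0 : (∏ j : Fin m, (B.map (fun b => (X j - C b : MvPolynomial (Fin m) ℚ))).prod) *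
            ∑ js ∈ Fm, (c js * ev p0 (Psi Pr L js.tail)) • pm m (monomial (hdj js).2 1 : PN) = 0 := by
          refine dens _ fun x hx => ?_
          have hB' := hB (Finset.univ.map ⟨x, hx⟩) (by simp)
          rw [map_mul, ← hB']
          congr 1
          · rw [Finset.prod_map, map_prod]
            refine prod_congr rfl fun j _ => ?_
            rw [map_multiset_prod, Multiset.map_map]
            simp
          · rw [map_sum]
            refine sum_congr rfl fun js _ => ?_
            rw [smul_eval, eval_pm]
            rfl
        refine (mul_eq_zero.mp h0).resolve_left (prod_ne_zero_iff.mpr fun j _ => ?_)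
        intro hc0
        rw [Multiset.prod_eq_zero_iff, Multiset.mem_map] at hc0
        obtain ⟨b, _, hb⟩ := hc0
        have := congrArg (eval (fun _ => b + 1)) hb
        simp at this
      rw [← Finset.sum_fiberwise_of_maps_to (g := fun js => (hdj js).2) (t := Fm.image (fun js => (hdj js).2)) (fun js hjs => Finset.mem_image_of_mem (fun js => (hdj js).2) hjs)] at hP
      have hli := (linearIndepOn_iff'.mp (J2 m)) (Fm.image (fun js => (hdj js).2))
        (fun s => ∑ js ∈ Fm with (hdj js).2 = s, c js * ev p0 (Psi Pr L js.tail)) (by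
          intro s hs'
          obtain ⟨js, hjs, rfl⟩ := mem_image.mp (mem_coe.mp hs')
          have h2 := mem_filter.mp hjs
          have := (hVal js h2.1).1
          rwa [h2.2] at this) (by
          rw [← hP]
          refine sum_congr rfl fun s _ => ?_
          rw [Finset.sum_smul]
          refine sum_congr rfl fun js hjs => ?_
          rw [(mem_filter.mp hjs).2])
      exact hli
    intro js hjs hjm
    have hjF : js ∈ Fm := mem_filter.mpr ⟨hjs, hjm⟩
    set s := (hdj js).2 with hsdef
    have hform : ∀ t ∈ Fm.filter (fun t => (hdj t).2 = s), t = (m, s) :: t.tail := by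
      intro t ht
      rw [mem_filter] at ht
      have ht2 := mem_filter.mp ht.1
      conv_lhs => rw [hcons t ht2.1]
      congr 1
      exact Prod.ext ht2.2 ht.2
    have hfin := IH (refl Q i (γ - (m : ℤ) • eZ i)) ((Fm.filter (fun t => (hdj t).2 = s)).image List.tail)
      (fun t => c ((m, s) :: t)) (by
        intro t ht
        obtain ⟨u, hu, rfl⟩ := mem_image.mp ht
        have hu2 := mem_filter.mp (mem_filter.mp hu).1
        have hv := (hVal u hu2.1).2
        rw [hu2.2] at hv
        exact ⟨⟨by simpa using hv.1.1, hv.1.2⟩, by rw [Dm_stp, hv.2]⟩) (by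
        intro p hp
        have hp' := hp.refl Q i
        rw [hmp2, refl_refl hs] at hp'
        rw [sum_image (by
          intro t ht t' ht' e
          rw [hform t ht, hform t' ht']; simp only [e])]
        rw [← step2 _ hp' s (mem_image.mpr ⟨js, hjF, rfl⟩)]
        refine sum_congr rfl fun t ht => ?_
        rw [Psi_stp hs, ev_sLam, ← hform t ht]) js.tail (mem_image.mpr ⟨js, mem_filter.mpr ⟨hjF, rfl⟩, rfl⟩)
    rw [hform js (mem_filter.mpr ⟨hjF, rfl⟩)]
    exact hfin
lemma exPr (Q : FinQuiver n) (γ δ : Fin n → ℤ) : ∃ Pr : L2 n →ₗ[ℚ] L1 n, ∀ G, IsI Q γ δ G (Pr G) := by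
  choose f hf using fun s : (Fin n ⊕ Fin n) × ℕ →₀ ℕ => exists_IsI Q γ δ (monomial s 1)
  let Pr := (basisMonomials ((Fin n ⊕ Fin n) × ℕ) ℚ).constr ℚ f
  refine ⟨Pr, fun G => ?_⟩
  let T : Submodule ℚ (L2 n) :=
    { carrier := {G | IsI Q γ δ G (Pr G)}
      add_mem' := fun h h' => by simp only [Set.mem_ofPred_eq, map_add] at *; exact h.add h'
      zero_mem' := fun ω _ => by simp [Isum]
      smul_mem' := fun c G h => by simp only [Set.mem_ofPred_eq, map_smul] at *; exact h.smul c }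
  change G ∈ T
  rw [G.as_sum]
  refine Submodule.sum_mem _ fun s _ => ?_
  have : (monomial s (coeff s G) : L2 n) = coeff s G • monomial s 1 := by simp [smul_monomial]
  rw [this]
  refine T.smul_mem _ ?_
  change IsI Q γ δ (monomial s 1) (Pr (monomial s 1))
  have e : Pr (monomial s 1) = f s := by
    have := (basisMonomials ((Fin n ⊕ Fin n) × ℕ) ℚ).constr_basis ℚ f s
    rwa [coe_basisMonomials] at this
  rw [e]; exact hf s
noncomputable def Pr0 (Q : FinQuiver n) : Prj n := fun γ δ => (exPr Q γ δ).choose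
lemma Pr0_I (Q : FinQuiver n) (γ δ : Fin n → ℤ) (G) : IsI Q γ δ G (Pr0 Q γ δ G) := (exPr Q γ δ).choose_spec G
lemma psv_sdiff {ω N : Fin n → Finset ℚ} (h : ∀ i, N i ⊆ ω i) : psv (fun i => ω i \ N i) = psv ω - psv N := by
  funext i k; exact ps_sdiff (h i) k
lemma St0 {Q : FinQuiver n} {L : List (Fin n → ℤ)} (h : RootL Q L) : St Q L [] RR (Pr0 Q) where
  root := by simpa using h
  RL _ := le_rfl
  PT γ p hp a ha := hp.RR (fun β hβ => ((h.mem β).mp hβ).1) ha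
  ID γ δ g a b hg hb := by
    refine MM_A fun ω hω => ?_
    rw [hb ω hω, Isum, sum_eq_zero]
    intro N hN
    rw [mem_subs] at hN
    rw [map_mul, ev_dm, ← psv_sdiff (fun i => (hN i).1), hg _ (fun i => by
      rw [card_sdiff_of_subset (hN i).1, Nat.cast_sub (card_le_card (hN i).1), hω, (hN i).2]; rfl)]
    simp
  TR γ δ G b hb := MM_A ((Pr0_I Q γ δ G).sub_mem hb)
  NG c hc d hd hcd := by
    have hc0 : c = 0 := by
      have : Cm ([] : List (Fin n → ℤ)) = ⊥ := by simp [Cm]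
      rw [this] at hc
      exact AddSubmonoid.mem_bot.mp hc
    have hd0 : ∀ j, 0 ≤ d j := by
      refine AddSubmonoid.closure_induction (motive := fun d _ => ∀ j, 0 ≤ d j) ?_ ?_ ?_ hd
      · intro x hx; exact ((h.mem x).mp hx).1
      · simp
      · intro x y _ _ hx hy j; exact add_nonneg (hx j) (hy j)
    subst hc0
    obtain ⟨j, hj⟩ : ∃ j, d j ≠ 0 := by
      by_contra hcon
      push Not at hcon
      exact hcd (by rw [zero_sub, neg_eq_zero]; funext j; exact hcon j)
    have := hd0 j
    exact RR_top (i := j) (by simp; omega)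
noncomputable def qh {Q : FinQuiver n} {ℓ : ℕ} (P : SubqPartition Q ℓ) : FinQuiver n where
  Arr := {a // a ∈ P.arrs}
  hd a := Q.hd a.1
  tl a := Q.tl a.1
lemma part_eq {Q : FinQuiver n} {ℓ : ℕ} (P : SubqPartition Q ℓ) {i : Fin n} {j k : Fin ℓ} (hj : i ∈ (P.part j).verts)
    (hk : i ∈ (P.part k).verts) : j = k := (P.cover i).unique hj hk
lemma eul_qh {Q : FinQuiver n} {ℓ : ℕ} (P : SubqPartition Q ℓ) (α β : Fin n → ℤ) :
    eul (qh P) α β = ∑ j, (P.part j).eulerZ α β := by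
  unfold eul Subquiver.eulerZ
  rw [sum_sub_distrib]
  congr 1
  · rw [← sum_biUnion]
    · congr 1
      ext i
      obtain ⟨j, hj, _⟩ := P.cover i
      simp only [mem_univ, mem_biUnion, true_and, true_iff]
      exact ⟨j, hj⟩
    · intro j _ k _ hjk
      exact disjoint_left.mpr fun i hi hi' => hjk (part_eq P hi hi')
  · rw [← sum_biUnion]
    · exact Finset.sum_coe_sort P.arrs (fun a => α (Q.tl a) * β (Q.hd a))
    · intro j _ k _ hjk
      exact disjoint_left.mpr fun a ha ha' => hjk (part_eq P ((P.part j).hd_mem a ha) ((P.part k).hd_mem a ha'))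
noncomputable def rst {Q : FinQuiver n} (S : Subquiver Q) (v : Fin n → ℤ) : Fin n → ℤ := fun i => if i ∈ S.verts then v i else 0
lemma rst_eul {Q : FinQuiver n} (S : Subquiver Q) (v : Fin n → ℤ) : S.eulerZ (rst S v) (rst S v) = S.eulerZ v v := by
  unfold Subquiver.eulerZ
  congr 1
  · exact sum_congr rfl fun i hi => by simp [rst, hi]
  · exact sum_congr rfl fun a ha => by simp [rst, S.hd_mem a ha, S.tl_mem a ha]
lemma eulZ_nonneg {Q : FinQuiver n} {S : Subquiver Q} (h : S.PosDefTits) (v : Fin n → ℤ) :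
    0 ≤ S.eulerZ v v ∧ (rst S v ≠ 0 → 0 < S.eulerZ v v) := by
  have h2 : rst S v ≠ 0 → 0 < S.eulerZ v v := fun hne => by
    rw [← rst_eul]; exact h _ (fun i hi => by simp [rst, hi]) hne
  refine ⟨?_, h2⟩
  by_cases h0 : rst S v = 0
  · rw [← rst_eul, h0]; simp [Subquiver.eulerZ]
  · exact (h2 h0).le
lemma eulZ_supp {Q : FinQuiver n} {ℓ : ℕ} (P : SubqPartition Q ℓ) {j k : Fin ℓ} (hjk : j ≠ k) {α β : Fin n → ℤ}
    (h : (∀ i, i ∉ (P.part j).verts → α i = 0) ∨ (∀ i, i ∉ (P.part j).verts → β i = 0)) : (P.part k).eulerZ α β = 0 := by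
  have hn : ∀ i, i ∈ (P.part k).verts → i ∉ (P.part j).verts := fun i hi hi' => hjk (part_eq P hi' hi)
  unfold Subquiver.eulerZ
  rw [sum_eq_zero, sum_eq_zero, sub_zero]
  · intro a ha
    rcases h with h | h
    · rw [h _ (hn _ ((P.part k).tl_mem a ha)), zero_mul]
    · rw [h _ (hn _ ((P.part k).hd_mem a ha)), mul_zero]
  · intro i hi
    rcases h with h | h
    · rw [h _ (hn _ hi), zero_mul]
    · rw [h _ (hn _ hi), mul_zero]
def cst (b : Fin n → ℕ) : Fin n → ℤ := fun i => (b i : ℤ)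
lemma root0 {Q : FinQuiver n} {ℓ r : ℕ} (P : SubqPartition Q ℓ) (hDyn : P.Dynkin)
    (β : Fin r → Fin n → ℕ) (blk : Fin r → Fin ℓ) (hR : IsReinekeOrder P β blk) :
    RootL (qh P) (List.ofFn fun u => cst (β u)).reverse := by
  obtain ⟨hmono, hroot, hinj, hall, hord⟩ := hR
  have hsupp : ∀ u i, i ∉ (P.part (blk u)).verts → cst (β u) i = 0 := fun u i hi => by simp [cst, (hroot u).1 i hi]
  have heu : ∀ u v, eul (qh P) (cst (β u)) (cst (β v)) = (P.part (blk u)).eulerZ (cst (β u)) (cst (β v)) := by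
    intro u v
    rw [eul_qh, Finset.sum_eq_single (blk u)]
    · intro k _ hk; exact eulZ_supp P hk.symm (Or.inl (hsupp u))
    · simp
  refine ⟨?_, ?_, ?_, ?_⟩
  · intro v hv
    rw [eul_qh]
    obtain ⟨i, hi⟩ : ∃ i, v i ≠ 0 := by
      by_contra hcon; push Not at hcon; exact hv (funext hcon)
    obtain ⟨j, hj, _⟩ := P.cover i
    refine Finset.sum_pos' (fun k _ => (eulZ_nonneg (hDyn k).2.2 v).1) ⟨j, mem_univ _, (eulZ_nonneg (hDyn j).2.2 v).2 ?_⟩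
    intro h0
    have := congrFun h0 i
    simp [rst, hj] at this
    exact hi this
  · rw [List.nodup_reverse, List.nodup_ofFn]
    intro u v huv
    refine hinj (funext fun i => ?_)
    have := congrFun huv i
    simpa [cst] using this
  · intro b
    rw [List.mem_reverse, List.mem_ofFn]
    constructor
    · rintro ⟨u, rfl⟩
      refine ⟨fun j => by simp [cst], ?_⟩
      rw [heu]; exact (hroot u).2.2
    · rintro ⟨h0, h1⟩
      rw [eul_qh] at h1
      obtain ⟨j, hj⟩ : ∃ j, rst (P.part j) b ≠ 0 := by
        by_contra hcon; push Not at hcon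
        rw [sum_eq_zero] at h1
        · simp at h1
        · intro j _; rw [← rst_eul, hcon j]; simp [Subquiver.eulerZ]
      have hpos := (eulZ_nonneg (hDyn j).2.2 b).2 hj
      rw [← add_sum_erase _ _ (mem_univ j)] at h1
      have hrest := sum_nonneg (s := Finset.univ.erase j) (fun k _ => (eulZ_nonneg (hDyn k).2.2 b).1)
      have hz : ∑ k ∈ Finset.univ.erase j, (P.part k).eulerZ b b = 0 := by omega
      have hz' := (Finset.sum_eq_zero_iff_of_nonneg (fun k _ => (eulZ_nonneg (hDyn k).2.2 b).1)).mp hz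
      have hsb : ∀ i, i ∉ (P.part j).verts → b i = 0 := by
        intro i hi
        obtain ⟨k, hk, _⟩ := P.cover i
        have hkj : k ≠ j := fun e => hi (e ▸ hk)
        by_contra hbi
        have := (eulZ_nonneg (hDyn k).2.2 b).2 (fun h0 => by
          have := congrFun h0 i
          simp [rst, hk] at this
          exact hbi this)
        have := hz' k (by simp [hkj])
        omega
      have hcb : b = cst (fun i => (b i).toNat) := by
        funext i; simp [cst, h0 i]
      obtain ⟨u, hu⟩ := hall j (fun i => (b i).toNat) ⟨fun i hi => by simp [hsb i hi], fun h00 => by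
        apply hj
        rw [hcb, h00]
        funext i; simp [rst, cst], by
        have : (fun i => (((b i).toNat : ℕ) : ℤ)) = b := hcb.symm
        rw [this]; omega⟩
      exact ⟨u, by rw [hu, ← hcb]⟩
  · rw [List.pairwise_reverse, List.pairwise_ofFn]
    intro u v huv
    by_cases hb : blk u = blk v
    · have hE : ∀ u v, blk u = blk v → Q.euler (β u) (β v) = eul (qh P) (cst (β u)) (cst (β v)) := by
        intro u v hb
        rw [heu, FinQuiver.euler, Subquiver.eulerZ]
        congr 1
        · symm
          refine sum_subset (subset_univ _) fun i _ hi => ?_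
          rw [hsupp u i hi, zero_mul]
        · symm
          refine sum_subset (subset_univ _) fun a _ ha => ?_
          by_cases h1 : Q.tl a ∈ (P.part (blk u)).verts
          · by_cases h2 : Q.hd a ∈ (P.part (blk u)).verts
            · exact absurd ((hDyn (blk u)).2.1 a h2 h1) ha
            · rw [hb] at h2; rw [hsupp v _ h2, mul_zero]
          · rw [hsupp u _ h1, zero_mul]
      have := hord u v huv hb
      rw [FinQuiver.lam, hE u v hb, hE v u hb.symm] at this
      omega
    · rw [heu u v, heu v u, eulZ_supp P (Ne.symm hb) (Or.inr (hsupp v)), eulZ_supp P hb (Or.inr (hsupp u))]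
noncomputable def toHS (S : Fin n → Finset ℕ) : L1 n →ₐ[ℚ] PolyQ n := aeval (fun p => ∑ s ∈ S p.1, X (p.1, s) ^ (p.2 + 1))
noncomputable def toH (g : Fin n → ℕ) : L1 n →ₐ[ℚ] PolyQ n := toHS (fun i => Finset.range (g i))
def io (g : Fin n → ℕ) : ((i : Fin n) × Fin (g i)) → Fin n × ℕ := fun p => (p.1, p.2)
lemma io_inj (g : Fin n → ℕ) : Function.Injective (io g) := by
  rintro ⟨i, j⟩ ⟨i', j'⟩ h
  simp only [io, Prod.mk.injEq] at h
  obtain ⟨rfl, h⟩ := h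
  rw [Fin.ext h]
lemma toH_pf (g : Fin n → ℕ) (a : L1 n) : toH g a = rename (io g) (pf g a) := by
  have : toH g = (rename (io g)).comp (pf g) := by
    apply MvPolynomial.algHom_ext
    intro p
    simp [toH, toHS, pf, io, sum_range]
  rw [this]; rfl
lemma toH_zero {g : Fin n → ℕ} {a : L1 n} : toH g a = 0 ↔ a ∈ RR (cst g) := by
  rw [toH_pf, map_eq_zero_iff _ (rename_injective _ (io_inj g))]; exact (mem_RR_iff g a).symm
lemma toH_mem (g : Fin n → ℕ) (a : L1 n) : toH g a ∈ Hspace g := by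
  constructor
  · intro p hp
    rw [toH_pf] at hp
    have := vars_rename _ _ hp
    rw [mem_image] at this
    obtain ⟨q, _, rfl⟩ := this
    exact q.2.2
  · intro i σ hσ
    have : (rename (vertexPerm i σ)).comp (toH g) = toH g := by
      apply MvPolynomial.algHom_ext
      intro p
      simp only [toH, toHS, AlgHom.comp_apply, aeval_X, map_sum, map_pow, rename_X, vertexPerm]
      split_ifs with h
      · subst h
        exact Equiv.Perm.sum_comp σ _ (fun s => (X (p.1, s) : PolyQ n) ^ (p.2 + 1)) (fun j hj => by simpa using hσ j hj)
      · rfl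
    exact DFunLike.congr_fun this a
lemma toH_surj {g : Fin n → ℕ} {f : PolyQ n} (hf : f ∈ Hspace g) : ∃ a, toH g a = f := by
  obtain ⟨h1, h2⟩ := hf
  obtain ⟨F, rfl⟩ := exists_rename_eq_of_vars_subset_range f (io g) (io_inj g) (fun p hp => ⟨⟨p.1, ⟨p.2, h1 p hp⟩⟩, rfl⟩)
  let H : Submonoid (∀ i, Equiv.Perm (Fin (g i))) :=
    { carrier := {σ | rename (pact σ) F = F}
      one_mem' := by
        have : pact (1 : ∀ i, Equiv.Perm (Fin (g i))) = id := rfl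
        simp only [Set.mem_ofPred_eq, this, rename_id_apply]
      mul_mem' := fun {σ τ} hs ht => by
        simp only [Set.mem_ofPred_eq] at *
        have : pact (σ * τ) = pact σ ∘ pact τ := rfl
        rw [this, ← rename_rename, ht, hs] }
  have hH : ∀ σ, σ ∈ H := by
    intro σ
    refine Submonoid.pi_mem_of_mulSingle_mem _ fun i => ?_
    change rename _ F = F
    apply rename_injective _ (io_inj g)
    have hh := h2 i ((σ i).extendDomain Fin.equivSubtype) (fun j hj => by
      by_contra hc
      exact hj (Equiv.Perm.extendDomain_apply_not_subtype _ _ hc))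
    rw [rename_rename] at hh ⊢
    refine Eq.trans ?_ hh
    congr 1
    congr 1
    funext ⟨i', j⟩
    by_cases hi : i' = i
    · subst hi
      have := Equiv.Perm.extendDomain_apply_image (σ i') Fin.equivSubtype j
      simp only [Function.comp, io, pact, vertexPerm, Pi.mulSingle_eq_same, if_true]
      rw [Prod.mk.injEq]
      exact ⟨rfl, this.symm⟩
    · simp [io, pact, vertexPerm, hi, Pi.mulSingle_eq_of_ne hi]
  obtain ⟨a, ha⟩ := av_mem F
  exact ⟨a, by rw [toH_pf, ha, av_self F hH]⟩
lemma sum_getD {M : Type} [AddCommMonoid M] (f : ℕ → M) (l : List ℕ) : ∑ j ∈ Finset.range l.length, f (l.getD j 0) = (l.map f).sum := by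
  induction l with
  | nil => simp
  | cons a l ih => simp only [List.length_cons, sum_range_succ', List.getD_cons_succ, ih, List.getD_cons_zero, List.map_cons, List.sum_cons, add_comm]
lemma subst_toH {g : Fin n → ℕ} {S : Fin n → Finset ℕ} (h : ∀ i, (S i).card = g i) (a : L1 n) : substAlong S (toH g a) = toHS S a := by
  have : (substAlong S).comp (toH g) = toHS S := by
    apply MvPolynomial.algHom_ext
    intro p
    simp only [substAlong, toH, toHS, AlgHom.comp_apply, aeval_X, map_sum, map_pow]
    have e := sum_getD (fun s => (X (p.1, s) : PolyQ n) ^ (p.2 + 1)) ((S p.1).sort (· ≤ ·))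
    rw [Finset.length_sort, h] at e
    rw [e, ← List.sum_toFinset _ (Finset.sort_nodup _ _), Finset.sort_toFinset]
  exact DFunLike.congr_fun this a
lemma eval_toHS {S : Fin n → Finset ℕ} {x : Fin n × ℕ → ℚ} (h : ∀ i, Set.InjOn (fun j => x (i, j)) (S i)) (a : L1 n) :
    eval x (toHS S a) = ev (psv (fun i => (S i).image (fun j => x (i, j)))) a := by
  have : (aeval x).comp (toHS S) = ev (psv (fun i => (S i).image (fun j => x (i, j)))) := by
    apply MvPolynomial.algHom_ext
    intro p
    rw [ev_X, psv, ps_finset, sum_image (h p.1)]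
    simp [toHS]
  exact DFunLike.congr_fun this a
lemma rat_eq {ι : Type} (s : Finset ι) (N D : ι → PolyQ n) (b V : PolyQ n) (hV : V ≠ 0)
    (hD : ∀ S ∈ s, ∀ x, eval x V ≠ 0 → eval x (D S) ≠ 0)
    (h : ∀ x, eval x V ≠ 0 → eval x b = ∑ S ∈ s, eval x (N S) / eval x (D S)) :
    algebraMap (PolyQ n) (FractionRing (PolyQ n)) b =
      ∑ S ∈ s, algebraMap (PolyQ n) (FractionRing (PolyQ n)) (N S) / algebraMap (PolyQ n) (FractionRing (PolyQ n)) (D S) := by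
  have inj : Function.Injective (algebraMap (PolyQ n) (FractionRing (PolyQ n))) := IsFractionRing.injective _ _
  obtain ⟨x0, hx0⟩ : ∃ x, eval x V ≠ 0 := by
    by_contra hc; push Not at hc
    exact hV (MvPolynomial.funext fun x => by rw [hc x, map_zero])
  have hD0 : ∀ S ∈ s, D S ≠ 0 := fun S hS h0 => hD S hS x0 hx0 (by rw [h0, map_zero])
  have key : b * ∏ S ∈ s, D S = ∑ S ∈ s, N S * ∏ T ∈ s.erase S, D T := by
    apply mul_right_cancel₀ hV
    apply MvPolynomial.funext
    intro x
    by_cases hx : eval x V = 0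
    · simp [hx]
    · rw [map_mul, map_mul (eval x) _ V, map_mul, h x hx, sum_mul, map_sum]
      congr 1
      refine sum_congr rfl fun S hS => ?_
      rw [← mul_prod_erase s D hS, map_mul, map_mul]
      have := hD S hS x hx
      field_simp
  have hT : algebraMap (PolyQ n) (FractionRing (PolyQ n)) (∏ S ∈ s, D S) ≠ 0 := by
    rw [Ne, map_eq_zero_iff _ inj, Finset.prod_eq_zero_iff]
    rintro ⟨S, hS, h0⟩; exact hD0 S hS h0
  apply mul_right_cancel₀ hT
  rw [← map_mul, key, map_sum, sum_mul]
  refine sum_congr rfl fun S hS => ?_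
  have : algebraMap (PolyQ n) (FractionRing (PolyQ n)) (D S) ≠ 0 := by
    rw [Ne, map_eq_zero_iff _ inj]; exact hD0 S hS
  rw [← mul_prod_erase s D hS, map_mul, map_mul]
  field_simp
noncomputable def VV (g : Fin n → ℕ) : PolyQ n := ∏ i, ∏ p ∈ (Finset.range (g i)).offDiag, (X (i, p.1) - X (i, p.2))
lemma VV_ne (g : Fin n → ℕ) : VV g ≠ 0 := by
  unfold VV
  rw [prod_ne_zero_iff]
  intro i _
  rw [prod_ne_zero_iff]
  intro p hp h
  rw [sub_eq_zero] at h
  have := X_injective h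
  simp at this
  exact (Finset.mem_offDiag.mp hp).2.2 this
lemma VV_inj {g : Fin n → ℕ} {x : Fin n × ℕ → ℚ} (h : eval x (VV g) ≠ 0) (i : Fin n) : Set.InjOn (fun j => x (i, j)) (Finset.range (g i)) := by
  intro j hj j' hj' he
  by_contra hne
  apply h
  unfold VV
  rw [map_prod]
  refine prod_eq_zero (mem_univ i) ?_
  rw [map_prod]
  refine prod_eq_zero (i := (j, j')) (Finset.mem_offDiag.mpr ⟨hj, hj', hne⟩) ?_
  simp at he
  simp [he]
lemma mem_shuf {g1 g2 : Fin n → ℕ} {S : Fin n → Finset ℕ} : S ∈ shuffles g1 g2 ↔ ∀ i, S i ⊆ Finset.range (g1 i + g2 i) ∧ (S i).card = g1 i := by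
  simp [shuffles, Fintype.mem_piFinset]
lemma cohaMul_eq {Q : FinQuiver n} {g1 g2 : Fin n → ℕ} {f1 f2 P : PolyQ n}
    (h : algebraMap (PolyQ n) (FractionRing (PolyQ n)) P = cohaMulRat Q g1 g2 f1 f2) : cohaMul Q g1 g2 f1 f2 = P := by
  have hh : ∃ P : PolyQ n, algebraMap (PolyQ n) (FractionRing (PolyQ n)) P = cohaMulRat Q g1 g2 f1 f2 := ⟨P, h⟩
  rw [cohaMul, dif_pos hh]
  exact IsFractionRing.injective _ _ (hh.choose_spec.trans h.symm)
lemma mult_rat {Q : FinQuiver n} {g1 g2 : Fin n → ℕ} {a1 a2 b : L1 n} (h : IsI Q (cst (g1 + g2)) (cst g2) (dm a1 * nm a2) b) :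
    algebraMap (PolyQ n) (FractionRing (PolyQ n)) (toH (g1 + g2) b) = cohaMulRat Q g1 g2 (toH g1 a1) (toH g2 a2) := by
  refine rat_eq _ _ _ _ (VV (g1 + g2)) (VV_ne _) ?_ ?_
  · intro S hS x hx
    rw [mem_shuf] at hS
    simp only [interactionDen, map_prod, map_sub, eval_X, shuffleCompl, prod_ne_zero_iff]
    intro i _ j' hj' j hj
    rw [sub_ne_zero]
    intro he
    rw [mem_sdiff] at hj'
    have := VV_inj hx i (mem_coe.mpr hj'.1) (mem_coe.mpr ((hS i).1 hj)) he
    exact hj'.2 (this ▸ hj)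
  · intro x hx
    have hi : ∀ i, Set.InjOn (fun j => x (i, j)) (Finset.range (g1 i + g2 i)) := VV_inj hx
    set ω : Fin n → Finset ℚ := fun i => (Finset.range ((g1 + g2) i)).image (fun j => x (i, j)) with hω
    rw [toH, eval_toHS (VV_inj hx), h ω (fun i => by
      rw [hω, card_image_of_injOn (VV_inj hx i), Finset.card_range]; rfl), Isum]
    symm
    refine Finset.sum_nbij' (fun S i => (shuffleCompl g1 g2 S i).image (fun j => x (i, j)))
      (fun N i => (Finset.range (g1 i + g2 i)).filter (fun j => x (i, j) ∉ N i)) ?_ ?_ ?_ ?_ ?_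
    · intro S hS
      rw [mem_shuf] at hS
      rw [mem_subs]
      intro i
      have hs : shuffleCompl g1 g2 S i ⊆ Finset.range (g1 i + g2 i) := sdiff_subset
      refine ⟨Finset.image_subset_image hs, ?_⟩
      rw [card_image_of_injOn ((hi i).mono (coe_subset.mpr hs)), shuffleCompl, card_sdiff_of_subset (hS i).1, (hS i).2]
      simp [cst]
    · intro N hN
      rw [mem_subs] at hN
      rw [mem_shuf]
      intro i
      refine ⟨Finset.filter_subset _ _, ?_⟩
      have e1 : ((Finset.range (g1 i + g2 i)).filter (fun j => x (i, j) ∈ N i)).card = (N i).card := by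
        rw [← card_image_of_injOn (f := fun j => x (i, j)) (fun j hj k hk => hi i (mem_coe.mpr (mem_filter.mp hj).1) (mem_coe.mpr (mem_filter.mp hk).1))]
        congr 1
        ext y
        simp only [mem_image, mem_filter]
        constructor
        · rintro ⟨j, ⟨_, h2⟩, rfl⟩; exact h2
        · intro hy
          obtain ⟨j, hj, rfl⟩ := mem_image.mp ((hN i).1 hy)
          exact ⟨j, ⟨hj, hy⟩, rfl⟩
      have e2 := Finset.card_filter_add_card_filter_not (s := Finset.range (g1 i + g2 i)) (fun j => x (i, j) ∈ N i)
      have e3 := (hN i).2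
      rw [Finset.card_range] at e2
      simp only [cst] at e3
      omega
    · intro S hS
      rw [mem_shuf] at hS
      funext i
      ext j
      simp only [mem_filter, mem_image, shuffleCompl, mem_sdiff, not_exists, not_and, and_imp]
      constructor
      · rintro ⟨h1, h2⟩
        by_contra hc
        exact h2 j h1 hc rfl
      · intro hj
        refine ⟨(hS i).1 hj, fun k hk hkS he => hkS ?_⟩
        rw [hi i (mem_coe.mpr hk) (mem_coe.mpr ((hS i).1 hj)) he]; exact hj
    · intro N hN
      rw [mem_subs] at hN
      funext i
      ext y
      simp only [mem_image, shuffleCompl, mem_sdiff, mem_filter, not_and, not_not]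
      constructor
      · rintro ⟨j, ⟨h1, h2⟩, rfl⟩; exact h2 h1
      · intro hy
        obtain ⟨j, hj, rfl⟩ := mem_image.mp ((hN i).1 hy)
        exact ⟨j, ⟨hj, fun _ => hy⟩, rfl⟩
    · intro S hS
      rw [mem_shuf] at hS
      have hc : ∀ i, shuffleCompl g1 g2 S i ⊆ Finset.range (g1 i + g2 i) := fun i => sdiff_subset
      have hcc : ∀ i, (shuffleCompl g1 g2 S i).card = g2 i := fun i => by
        rw [shuffleCompl, card_sdiff_of_subset (hS i).1, (hS i).2]; simp
      have iS : ∀ i, Set.InjOn (fun j => x (i, j)) (S i) := fun i => (hi i).mono (coe_subset.mpr (hS i).1)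
      have iC : ∀ i, Set.InjOn (fun j => x (i, j)) (shuffleCompl g1 g2 S i) := fun i => (hi i).mono (coe_subset.mpr (hc i))
      have hsd : ∀ i, ω i \ (shuffleCompl g1 g2 S i).image (fun j => x (i, j)) = (S i).image (fun j => x (i, j)) := by
        intro i
        rw [hω]
        simp only
        rw [← Finset.image_sdiff_of_injOn (VV_inj hx i) (hc i)]
        congr 1
        exact Finset.sdiff_sdiff_eq_self (hS i).1
      rw [subst_toH (fun i => (hS i).2), subst_toH hcc, map_mul, map_mul, eval_toHS iS, eval_toHS iC, map_mul, ev_dm, ev_nm,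
        ← psv_sdiff (ω := ω) (fun i => Finset.image_subset_image (hc i))]
      simp only [hsd]
      have e1 : eval x (interactionNum Q g1 g2 S) = arr Q ω (fun i => (shuffleCompl g1 g2 S i).image (fun j => x (i, j))) := by
        simp only [interactionNum, arrowFactor, arr, map_prod, hsd, map_sub, eval_X]
        refine prod_congr rfl fun a _ => ?_
        rw [prod_image (iC _)]
        refine prod_congr rfl fun j _ => ?_
        rw [prod_image (iS _)]
      have e2 : (eval x (interactionDen g1 g2 S))⁻¹ = ∏ i, WW (ω i) ((shuffleCompl g1 g2 S i).image (fun j => x (i, j))) := by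
        simp only [interactionDen, WW, map_prod, hsd, map_sub, eval_X, ← Finset.prod_inv_distrib]
        refine prod_congr rfl fun a _ => ?_
        rw [prod_image (iC _)]
        refine prod_congr rfl fun j _ => ?_
        rw [prod_image (iS _)]
      rw [div_eq_mul_inv, e1, e2, kern]
      ring
lemma mul_toH (Q : FinQuiver n) (g1 g2 : Fin n → ℕ) (a1 a2 : L1 n) : cohaMul Q g1 g2 (toH g1 a1) (toH g2 a2) =
    toH (g1 + g2) (Pr0 Q (cst (g1 + g2)) (cst g2) (dm a1 * nm a2)) := cohaMul_eq (mult_rat (Pr0_I _ _ _ _))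
lemma mul_mem {Q : FinQuiver n} {g1 g2 : Fin n → ℕ} {f1 f2 : PolyQ n} (h1 : f1 ∈ Hspace g1) (h2 : f2 ∈ Hspace g2) :
    cohaMul Q g1 g2 f1 f2 ∈ Hspace (g1 + g2) := by
  obtain ⟨a1, rfl⟩ := toH_surj h1
  obtain ⟨a2, rfl⟩ := toH_surj h2
  rw [mul_toH]; exact toH_mem _ _
lemma mul_lin1 {Q : FinQuiver n} {g1 g2 : Fin n → ℕ} {x y z : PolyQ n} (hx : x ∈ Hspace g1) (hy : y ∈ Hspace g1) (hz : z ∈ Hspace g2)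
    (c d : ℚ) : cohaMul Q g1 g2 (c • x + d • y) z = c • cohaMul Q g1 g2 x z + d • cohaMul Q g1 g2 y z := by
  obtain ⟨x, rfl⟩ := toH_surj hx
  obtain ⟨y, rfl⟩ := toH_surj hy
  obtain ⟨z, rfl⟩ := toH_surj hz
  rw [← map_smul, ← map_smul, ← map_add, mul_toH, mul_toH, mul_toH]
  simp only [map_add, map_smul, add_mul, smul_mul_assoc]
lemma mul_lin2 {Q : FinQuiver n} {g1 g2 : Fin n → ℕ} {x y z : PolyQ n} (hx : x ∈ Hspace g2) (hy : y ∈ Hspace g2) (hz : z ∈ Hspace g1)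
    (c d : ℚ) : cohaMul Q g1 g2 z (c • x + d • y) = c • cohaMul Q g1 g2 z x + d • cohaMul Q g1 g2 z y := by
  obtain ⟨x, rfl⟩ := toH_surj hx
  obtain ⟨y, rfl⟩ := toH_surj hy
  obtain ⟨z, rfl⟩ := toH_surj hz
  rw [← map_smul, ← map_smul, ← map_add, mul_toH, mul_toH, mul_toH]
  simp only [map_add, map_smul, mul_add, mul_smul_comm]
lemma one_mul' {Q : FinQuiver n} {g : Fin n → ℕ} {f : PolyQ n} (hf : f ∈ Hspace g) : cohaMul Q (fun _ => 0) g 1 f = f := by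
  obtain ⟨a, rfl⟩ := toH_surj hf
  have e : (fun _ => 0 : Fin n → ℕ) + g = g := zero_add g
  have h : IsI Q (cst ((fun _ => 0) + g)) (cst g) (dm 1 * nm a) a := by
    intro ω hω
    rw [e] at hω
    have hs : subs ω (cst g) = {ω} := by
      ext N
      rw [mem_subs, Finset.mem_singleton]
      constructor
      · intro h
        funext i
        refine Finset.eq_of_subset_of_card_le (h i).1 ?_
        have h1 := (h i).2
        have h2 := hω i
        omega
      · rintro rfl i; exact ⟨subset_rfl, hω i⟩
    rw [Isum, hs, sum_singleton, map_mul, ev_nm]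
    simp [kern, arr, WW]
  have := mult_rat h
  rw [map_one, e] at this
  exact cohaMul_eq this
lemma prod_concat {Q : FinQuiver n} (l : List ((Fin n → ℕ) × PolyQ n)) (y : (Fin n → ℕ) × PolyQ n) (hy : y.2 ∈ Hspace y.1) :
    cohaProd Q (l ++ [y]) = ((cohaProd Q l).1 + y.1, cohaMul Q (cohaProd Q l).1 y.1 (cohaProd Q l).2 y.2) := by
  cases l with
  | nil =>
    simp only [List.nil_append, cohaProd, List.foldl_nil, one_mul' hy]
    ext1
    · exact (zero_add y.1).symm
    · rfl
  | cons x xs => simp [cohaProd, List.foldl_append]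
lemma prod_rec0 {Q : FinQuiver n} {r : ℕ} (γ : Fin (r + 1) → Fin n → ℕ) (f : Fin (r + 1) → PolyQ n) (hf : ∀ u, f u ∈ Hspace (γ u)) :
    cohaProd Q (List.ofFn fun u => (γ u, f u)) = ((cohaProd Q (List.ofFn fun u : Fin r => (γ u.castSucc, f u.castSucc))).1 + γ (Fin.last r),
      cohaMul Q (cohaProd Q (List.ofFn fun u : Fin r => (γ u.castSucc, f u.castSucc))).1 (γ (Fin.last r))
        (cohaProd Q (List.ofFn fun u : Fin r => (γ u.castSucc, f u.castSucc))).2 (f (Fin.last r))) := by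
  rw [List.ofFn_succ', List.concat_eq_append]
  exact prod_concat _ _ (hf _)
lemma prod_fst {Q : FinQuiver n} {r : ℕ} : ∀ (γ : Fin r → Fin n → ℕ) (f : Fin r → PolyQ n), (∀ u, f u ∈ Hspace (γ u)) →
    (cohaProd Q (List.ofFn fun u => (γ u, f u))).1 = ∑ u, γ u := by
  induction r with
  | zero => intro γ f _; simp [cohaProd]; rfl
  | succ r ih =>
    intro γ f hf
    rw [prod_rec0 γ f hf, Fin.sum_univ_castSucc]
    simp only
    rw [ih (fun u => γ u.castSucc) (fun u => f u.castSucc) (fun u => hf _)]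
lemma prod_rec {Q : FinQuiver n} {r : ℕ} (γ : Fin (r + 1) → Fin n → ℕ) (f : Fin (r + 1) → PolyQ n) (hf : ∀ u, f u ∈ Hspace (γ u)) :
    cohaProdFin Q γ f = cohaMul Q (∑ u : Fin r, γ u.castSucc) (γ (Fin.last r))
        (cohaProdFin Q (fun u : Fin r => γ u.castSucc) (fun u => f u.castSucc)) (f (Fin.last r)) := by
  rw [cohaProdFin, prod_rec0 γ f hf]
  simp only
  rw [prod_fst (fun u => γ u.castSucc) (fun u => f u.castSucc) (fun u => hf _)]
  rfl
lemma prod_mem {Q : FinQuiver n} {r : ℕ} : ∀ (γ : Fin r → Fin n → ℕ) (f : Fin r → PolyQ n), (∀ u, f u ∈ Hspace (γ u)) →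
    cohaProdFin Q γ f ∈ Hspace (∑ u, γ u) := by
  induction r with
  | zero =>
    intro γ f _
    have : cohaProdFin Q γ f = toH (∑ u, γ u) 1 := by simp [cohaProdFin, cohaProd]
    rw [this]; exact toH_mem _ _
  | succ r ih =>
    intro γ f hf
    rw [prod_rec γ f hf, Fin.sum_univ_castSucc]
    exact mul_mem (ih _ _ fun u => hf _) (hf _)
lemma prod_lin {Q : FinQuiver n} {r : ℕ} (c d : ℚ) : ∀ (γ : Fin r → Fin n → ℕ) (f x y : Fin r → PolyQ n), (∀ u, f u ∈ Hspace (γ u)) →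
    (∀ u, x u ∈ Hspace (γ u)) → (∀ u, y u ∈ Hspace (γ u)) → ∀ u0, f u0 = c • x u0 + d • y u0 → (∀ u, u ≠ u0 → f u = x u ∧ f u = y u) →
    cohaProdFin Q γ f = c • cohaProdFin Q γ x + d • cohaProdFin Q γ y := by
  induction r with
  | zero => intro γ f x y _ _ _ u0; exact u0.elim0
  | succ r ih =>
    intro γ f x y hf hx hy u0 h0 h1
    rw [prod_rec γ f hf, prod_rec γ x hx, prod_rec γ y hy]
    induction u0 using Fin.lastCases with
    | last =>
      have e1 : (fun u : Fin r => x u.castSucc) = fun u => f u.castSucc := funext fun u => ((h1 _ (Fin.castSucc_ne_last u)).1).symm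
      have e2 : (fun u : Fin r => y u.castSucc) = fun u => f u.castSucc := funext fun u => ((h1 _ (Fin.castSucc_ne_last u)).2).symm
      rw [e1, e2, h0]
      exact mul_lin2 (hx _) (hy _) (prod_mem _ _ fun u => hf _) c d
    | cast u0 =>
      have hl := h1 (Fin.last r) (Fin.castSucc_ne_last u0).symm
      rw [ih (fun u => γ u.castSucc) (fun u => f u.castSucc) (fun u => x u.castSucc) (fun u => y u.castSucc) (fun u => hf _) (fun u => hx _)
        (fun u => hy _) u0 h0 (fun u hu => h1 _ (fun e => hu (Fin.castSucc_injective _ e))), ← hl.1, ← hl.2]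
      exact mul_lin1 (prod_mem _ _ fun u => hx _) (prod_mem _ _ fun u => hy _) (hf _) c d
lemma mul_qh {Q : FinQuiver n} {ℓ : ℕ} (P : SubqPartition Q ℓ) {g1 g2 : Fin n → ℕ} (h : ∀ a, a ∉ P.arrs → g1 (Q.tl a) = 0 ∨ g2 (Q.hd a) = 0)
    (f1 f2 : PolyQ n) : cohaMul Q g1 g2 f1 f2 = cohaMul (qh P) g1 g2 f1 f2 := by
  have : cohaMulRat Q g1 g2 f1 f2 = cohaMulRat (qh P) g1 g2 f1 f2 := by
    unfold cohaMulRat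
    refine sum_congr rfl fun S hS => ?_
    rw [mem_shuf] at hS
    have : interactionNum Q g1 g2 S = interactionNum (qh P) g1 g2 S := by
      refine Eq.trans ?_ (Finset.prod_coe_sort P.arrs (fun a => arrowFactor Q g1 g2 S a)).symm
      symm
      refine Finset.prod_subset (subset_univ _) fun a _ ha => ?_
      unfold arrowFactor
      rcases h a ha with h0 | h0
      · have : S (Q.tl a) = ∅ := card_eq_zero.mp (by rw [(hS _).2, h0])
        simp [this]
      · have : shuffleCompl g1 g2 S (Q.hd a) = ∅ := card_eq_zero.mp (by
          rw [shuffleCompl, card_sdiff_of_subset (hS _).1, (hS _).2, h0]; simp)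
        simp [this]
    rw [this]
  simp only [cohaMul, this]
lemma rev_ofFn {α : Type} {r : ℕ} (F : Fin (r + 1) → α) : (List.ofFn F).reverse = F (Fin.last r) :: (List.ofFn fun u : Fin r => F u.castSucc).reverse := by
  rw [List.ofFn_succ', List.concat_eq_append, List.reverse_append]; rfl
lemma PROD {Q : FinQuiver n} {ℓ : ℕ} (P : SubqPartition Q ℓ) {r : ℕ} : ∀ (β : Fin r → Fin n → ℕ)
    (_ : ∀ u v, u < v → ∀ a, a ∉ P.arrs → β u (Q.tl a) = 0 ∨ β v (Q.hd a) = 0) (c : Fin r → PN →ₐ[ℚ] L1 n) (m : Fin r → ℕ) (s : Fin r → ℕ →₀ ℕ),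
    Dm (List.ofFn fun u => ((cst (β u), c u) : PLn n)).reverse (List.ofFn fun u => (m u, s u)).reverse = cst (∑ u, fun v => m u * β u v) ∧
    cohaProdFin Q (fun u v => m u * β u v) (fun u => toH (fun v => m u * β u v) (c u (monomial (s u) 1))) =
      toH (∑ u, fun v => m u * β u v)
        (Psi (Pr0 (qh P)) (List.ofFn fun u => ((cst (β u), c u) : PLn n)).reverse (List.ofFn fun u => (m u, s u)).reverse) := by
  induction r with
  | zero =>
    intro β _ c m s
    refine ⟨?_, ?_⟩
    · funext i; simp [Dm, cst]
    · simp [cohaProdFin, cohaProd, Psi]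
  | succ r ih =>
    intro β hc c m s
    obtain ⟨ih1, ih2⟩ := ih (fun u => β u.castSucc) (fun u v huv => hc _ _ (Fin.castSucc_lt_castSucc_iff.mpr huv)) (fun u => c u.castSucc)
      (fun u => m u.castSucc) (fun u => s u.castSucc)
    have hm : ((m (Fin.last r) : ℕ) : ℤ) • cst (β (Fin.last r)) = cst (fun v => m (Fin.last r) * β (Fin.last r) v) := by
      funext i; simp [cst]
    have ha : ∀ g h : Fin n → ℕ, cst g + cst h = cst (g + h) := fun g h => by funext i; simp [cst]
    rw [rev_ofFn, rev_ofFn, Dm, Psi, Fin.sum_univ_castSucc, ih1, hm, ha]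
    refine ⟨rfl, ?_⟩
    rw [prod_rec _ _ (fun u => toH_mem _ _), ih2, mul_qh P, mul_toH]
    intro a haa
    by_cases h0 : β (Fin.last r) (Q.hd a) = 0
    · right; simp [h0]
    · left
      rw [Finset.sum_apply]
      refine sum_eq_zero fun u _ => ?_
      rw [(hc _ _ (Fin.castSucc_lt_last u) a haa).resolve_right h0, mul_zero]
noncomputable def cI (i : Fin n) : PN →ₐ[ℚ] L1 n := aeval (fun k => X (i, k))
lemma cI_Cp {b : Fin n → ℕ} {i : Fin n} (h : b i = 1) : Cp ((cst b, cI i) : PLn n) := by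
  intro x f
  have : (ev (fun j k => (cst b j : ℚ) * x k)).comp (cI i) = aeval x := by
    apply MvPolynomial.algHom_ext
    intro k
    simp [cI, ev_X, cst, h]
  exact DFunLike.congr_fun this f
lemma toH_cI {b : Fin n → ℕ} {i : Fin n} (h : b i = 1) (m : ℕ) (f : PN) :
    toH (fun v => m * b v) (cI i f) = rename (fun j : Fin m => ((i, (j : ℕ)) : Fin n × ℕ)) (pm m f) := by
  have : (toH (fun v => m * b v)).comp (cI i) = (rename (fun j : Fin m => ((i, (j : ℕ)) : Fin n × ℕ))).comp (pm m) := by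
    apply MvPolynomial.algHom_ext
    intro k
    simp only [cI, toH, toHS, pm, psum, h, AlgHom.comp_apply, aeval_X, mul_one, map_sum, map_pow, rename_X]
    exact sum_range _
  exact DFunLike.congr_fun this f
lemma ei_inj (i : Fin n) (m : ℕ) : Function.Injective (fun j : Fin m => ((i, (j : ℕ)) : Fin n × ℕ)) := fun j k h => by
  simpa [Fin.ext_iff] using h
lemma A_mem {b : Fin n → ℕ} {i : Fin n} (h : b i = 1) (m : ℕ) (f : PN) : toH (fun v => m * b v) (cI i f) ∈ Aspace b i m := by
  refine ⟨toH_mem _ _, fun p hp => ?_⟩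
  rw [toH_cI h] at hp
  have := vars_rename _ _ hp
  rw [mem_image] at this
  obtain ⟨q, _, rfl⟩ := this
  rfl
noncomputable def LA {b : Fin n → ℕ} {i : Fin n} (h : b i = 1) (m : ℕ) : PN →ₗ[ℚ] Aspace b i m :=
  LinearMap.codRestrict _ ((toH (fun v => m * b v)).comp (cI i)).toLinearMap (A_mem h m)
lemma LA_coe {b : Fin n → ℕ} {i : Fin n} (h : b i = 1) (m : ℕ) (f : PN) : (LA h m f : PolyQ n) = toH (fun v => m * b v) (cI i f) := rfl
lemma LA_surj {b : Fin n → ℕ} {i : Fin n} (h : b i = 1) (m : ℕ) (f : Aspace b i m) : ∃ p, LA h m p = f := by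
  obtain ⟨f, ⟨h1, h2⟩, h3⟩ := f
  obtain ⟨F, rfl⟩ := exists_rename_eq_of_vars_subset_range f (fun j : Fin m => ((i, (j : ℕ)) : Fin n × ℕ)) (ei_inj i m) (fun p hp => by
    have e := h3 p hp
    have := h1 p hp
    rw [e] at this
    exact ⟨⟨p.2, by simpa [h] using this⟩, Prod.ext e.symm rfl⟩)
  have hs : F.IsSymmetric := by
    intro σ
    apply rename_injective _ (ei_inj i m)
    have hh := h2 i (σ.extendDomain Fin.equivSubtype) (fun j hj => by
      by_contra hc
      exact hj (Equiv.Perm.extendDomain_apply_not_subtype _ _ (by simpa [h] using hc)))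
    rw [rename_rename] at hh ⊢
    refine Eq.trans ?_ hh
    congr 1
    congr 1
    funext j
    have := Equiv.Perm.extendDomain_apply_image σ Fin.equivSubtype j
    simp only [Function.comp, vertexPerm, if_true]
    rw [Prod.mk.injEq]
    exact ⟨rfl, this.symm⟩
  have hr : Algebra.adjoin ℚ (Set.range fun k : ℕ => psum (Fin m) ℚ (k + 1)) ≤ (pm m).range := by
    apply Algebra.adjoin_le
    rintro _ ⟨k, rfl⟩
    exact ⟨X k, by simp [pm]⟩
  obtain ⟨p, hp⟩ := hr (sym_one F hs)
  refine ⟨p, Subtype.ext ?_⟩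
  rw [LA_coe, toH_cI h]
  exact congrArg _ hp
lemma LA_li {b : Fin n → ℕ} {i : Fin n} (h : b i = 1) (m : ℕ) : LinearIndependent ℚ (fun s : J m => LA h m (monomial s.1 1)) := by
  rw [linearIndependent_iff']
  intro t g hg s hs
  refine linearIndependent_iff'.mp (J2 m) t g ?_ s hs
  apply rename_injective _ (ei_inj i m)
  have h1 := congrArg (Submodule.subtype (Aspace b i m)) hg
  rw [map_sum, map_zero] at h1
  rw [map_sum, map_zero, ← h1]
  refine sum_congr rfl fun x _ => ?_
  rw [map_smul, map_smul]
  exact congrArg (g x • ·) (toH_cI h m _).symm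
lemma LA_sp {b : Fin n → ℕ} {i : Fin n} (h : b i = 1) (m : ℕ) : ⊤ ≤ Submodule.span ℚ (Set.range (fun s : J m => LA h m (monomial s.1 1))) := by
  rintro f -
  obtain ⟨p, rfl⟩ := LA_surj h m f
  obtain ⟨p', hp', h0⟩ := J1 m p
  have e : LA h m p = LA h m p' := by
    apply Subtype.ext
    rw [map_sub, sub_eq_zero] at h0
    rw [LA_coe, LA_coe, toH_cI h, toH_cI h, h0]
  rw [e]
  have := Submodule.mem_map_of_mem (f := LA h m) hp'
  rw [Submodule.map_span] at this
  refine Submodule.span_mono ?_ this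
  rintro _ ⟨_, ⟨s, hs, rfl⟩, rfl⟩
  exact ⟨⟨s, hs⟩, rfl⟩
noncomputable def BA {b : Fin n → ℕ} {i : Fin n} (h : b i = 1) (m : ℕ) : Module.Basis (J m) ℚ (Aspace b i m) := Module.Basis.mk (LA_li h m) (LA_sp h m)
lemma BA_apply {b : Fin n → ℕ} {i : Fin n} (h : b i = 1) (m : ℕ) (s : J m) : BA h m s = LA h m (monomial s.1 1) := by simp [BA]
lemma sum_dim {r : ℕ} (β : Fin r → Fin n → ℕ) (m : Fin r → ℕ) : (∑ u, fun v => m u * β u v) = fun v => ∑ u, m u * β u v := by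
  funext v; simp
noncomputable def MP (Q : FinQuiver n) {r : ℕ} (β : Fin r → Fin n → ℕ) (iv : Fin r → Fin n) (m : Fin r → ℕ) :
    MultilinearMap ℚ (fun u => ↥(Aspace (β u) (iv u) (m u))) ↥(Hspace (fun v => ∑ u, m u * β u v)) where
  toFun f := ⟨cohaProdFin Q (fun u v => m u * β u v) (fun u => (f u : PolyQ n)), by
    rw [← sum_dim]; exact prod_mem _ _ (fun u => (f u).2.1)⟩
  map_update_add' f u x y := by
    apply Subtype.ext
    have := prod_lin (Q := Q) 1 1 (fun u v => m u * β u v) (fun w => (Function.update f u (x + y) w : PolyQ n)) (fun w => (Function.update f u x w : PolyQ n))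
      (fun w => (Function.update f u y w : PolyQ n)) (fun w => (Function.update f u (x + y) w).2.1) (fun w => (Function.update f u x w).2.1)
      (fun w => (Function.update f u y w).2.1) u (by simp) (fun w hw => by simp [hw])
    simpa using this
  map_update_smul' f u c x := by
    apply Subtype.ext
    have := prod_lin (Q := Q) c 0 (fun u v => m u * β u v) (fun w => (Function.update f u (c • x) w : PolyQ n)) (fun w => (Function.update f u x w : PolyQ n))
      (fun w => (Function.update f u x w : PolyQ n)) (fun w => (Function.update f u (c • x) w).2.1) (fun w => (Function.update f u x w).2.1)
      (fun w => (Function.update f u x w).2.1) u (by simp) (fun w hw => by simp [hw])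
    simpa using this
lemma dbasis {ι : Type} [dd : DecidableEq ι] {M : ι → Type} [∀ i, AddCommMonoid (M i)] [∀ i, Module ℚ (M i)] {η : ι → Type} (b : ∀ i, Module.Basis (η i) ℚ (M i)) (x : (i : ι) × η i) :
    DFinsupp.basis b x = DFinsupp.single x.1 (b x.1 x.2) := by
  have hdd : dd = fun a b => Classical.propDecidable (a = b) := Subsingleton.elim _ _
  subst hdd
  rw [Module.Basis.apply_eq_iff]
  apply (sigmaFinsuppLequivDFinsupp ℚ).injective
  simp [DFinsupp.basis]
lemma ex_ofFn {α : Type} (l : List α) : ∀ {r : ℕ}, l.length = r → ∃ F : Fin r → α, l = (List.ofFn F).reverse := by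
  induction l with
  | nil => rintro _ rfl; exact ⟨Fin.elim0, by simp⟩
  | cons a l ih =>
    rintro _ rfl
    obtain ⟨F, hF⟩ := ih rfl
    refine ⟨Fin.snoc (α := fun _ => α) F a, ?_⟩
    have : (fun u : Fin l.length => Fin.snoc (α := fun _ => α) F a u.castSucc) = F := funext fun u => by simp
    refine Eq.trans ?_ (rev_ofFn _).symm
    rw [this, ← hF]
    simp
theorem main {ℓ r : ℕ} (Q : FinQuiver n)
    (P : SubqPartition Q ℓ) (hord : P.Ordered) (hDyn : P.Dynkin)
    (β : Fin r → Fin n → ℕ) (blk : Fin r → Fin ℓ) (hR : IsReinekeOrder P β blk)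
    (iv : Fin r → Fin n) (hiv : ∀ u, β u (iv u) = 1) :
    ∃ Φ : (⨁ m : Fin r → ℕ, ⨂[ℚ] u : Fin r, ↥(Aspace (β u) (iv u) (m u)))
        →ₗ[ℚ] ⨁ γ : Fin n → ℕ, ↥(Hspace γ),
      (∀ (m : Fin r → ℕ) (f : (u : Fin r) → ↥(Aspace (β u) (iv u) (m u))),
        ∃ hmem : cohaProdFin Q (fun u v => m u * β u v) (fun u => (f u : PolyQ n)) ∈
            Hspace (fun v => ∑ u, m u * β u v),
          Φ (DirectSum.of (fun m' : Fin r → ℕ =>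
                ⨂[ℚ] u : Fin r, ↥(Aspace (β u) (iv u) (m' u))) m
              (PiTensorProduct.tprod ℚ f)) =
            DirectSum.of (fun γ : Fin n → ℕ => ↥(Hspace γ))
              (fun v => ∑ u, m u * β u v)
              ⟨cohaProdFin Q (fun u v => m u * β u v) (fun u => (f u : PolyQ n)), hmem⟩) ∧
      Function.Bijective Φ := by
  let Φ : (⨁ m : Fin r → ℕ, ⨂[ℚ] u : Fin r, ↥(Aspace (β u) (iv u) (m u))) →ₗ[ℚ] ⨁ γ : Fin n → ℕ, ↥(Hspace γ) :=
    DirectSum.toModule ℚ _ _ fun m => (DirectSum.lof ℚ (Fin n → ℕ) (fun γ => ↥(Hspace γ)) (fun v => ∑ u, m u * β u v)).comp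
      (PiTensorProduct.lift (MP Q β iv m))
  have hΦ : ∀ (m : Fin r → ℕ) (f : (u : Fin r) → ↥(Aspace (β u) (iv u) (m u))),
      Φ (DirectSum.of (fun m' : Fin r → ℕ => ⨂[ℚ] u : Fin r, ↥(Aspace (β u) (iv u) (m' u))) m (PiTensorProduct.tprod ℚ f)) =
        DirectSum.of (fun γ : Fin n → ℕ => ↥(Hspace γ)) (fun v => ∑ u, m u * β u v) (MP Q β iv m f) := by
    intro m f
    rw [← DirectSum.lof_eq_of ℚ, DirectSum.toModule_lof, LinearMap.comp_apply, PiTensorProduct.lift.tprod, DirectSum.lof_eq_of]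
  refine ⟨Φ, fun m f => ⟨(MP Q β iv m f).2, hΦ m f⟩, ?_⟩
  have hcomp : ∀ u v, u < v → ∀ a, a ∉ P.arrs → β u (Q.tl a) = 0 ∨ β v (Q.hd a) = 0 := by
    intro u v huv a ha
    by_contra hc
    push Not at hc
    have h1 : Q.tl a ∈ (P.part (blk u)).verts := by
      by_contra hh; exact hc.1 ((hR.2.1 u).1 _ hh)
    have h2 : Q.hd a ∈ (P.part (blk v)).verts := by
      by_contra hh; exact hc.2 ((hR.2.1 v).1 _ hh)
    exact absurd (hR.1 huv.le) (not_le.mpr (hord a ha _ _ h2 h1))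
  set PL : List (PLn n) := (List.ofFn fun u => ((cst (β u), cI (iv u)) : PLn n)).reverse with hPL
  have hPLl : PL.length = r := by simp [hPL]
  have hfst : PL.map Prod.fst = (List.ofFn fun u => cst (β u)).reverse := by
    rw [hPL, List.map_reverse, List.map_ofFn]; rfl
  have hroot := root0 P hDyn β blk hR
  have hSt : St (qh P) (PL.map Prod.fst) [] RR (Pr0 (qh P)) := by rw [hfst]; exact St0 hroot
  have hCp : ∀ q ∈ PL, Cp q := by
    intro q hq
    rw [hPL, List.mem_reverse, List.mem_ofFn] at hq
    obtain ⟨u, rfl⟩ := hq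
    exact cI_Cp (hiv u)
  let γ_ : (Fin r → ℕ) → Fin n → ℕ := fun m v => ∑ u, m u * β u v
  let jl : ((m : Fin r → ℕ) × (∀ u, J (m u))) → List (ℕ × (ℕ →₀ ℕ)) := fun x => (List.ofFn fun u => (x.1 u, (x.2 u).1)).reverse
  have jl_inj : Function.Injective jl := by
    rintro ⟨m, s⟩ ⟨m', s'⟩ h
    have h := List.ofFn_injective (List.reverse_injective h)
    have hm : m = m' := funext fun u => (Prod.ext_iff.mp (congrFun h u)).1
    subst hm
    have hs : s = s' := funext fun u => Subtype.ext (Prod.ext_iff.mp (congrFun h u)).2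
    rw [hs]
  have hDm : ∀ x, Dm PL (jl x) = cst (γ_ x.1) := fun x => by
    have := (PROD P β hcomp (fun u => cI (iv u)) x.1 (fun u => (x.2 u).1)).1
    rw [sum_dim] at this; exact this
  have hVal : ∀ x, Val PL (jl x) := fun x => by
    refine ⟨by simp [jl, hPLl], fun y hy => ?_⟩
    simp only [jl, List.mem_reverse, List.mem_ofFn] at hy
    obtain ⟨u, rfl⟩ := hy
    exact (x.2 u).2
  let el : ∀ (x : (m : Fin r → ℕ) × (∀ u, J (m u))) u, ↥(Aspace (β u) (iv u) (x.1 u)) := fun x u => LA (hiv u) (x.1 u) (monomial (x.2 u).1 1)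
  have hMP : ∀ x, (MP Q β iv x.1 (el x) : PolyQ n) = toH (γ_ x.1) (Psi (Pr0 (qh P)) PL (jl x)) := fun x => by
    have := (PROD P β hcomp (fun u => cI (iv u)) x.1 (fun u => (x.2 u).1)).2
    rw [sum_dim] at this; exact this
  constructor
  · intro v w hvw
    let B := DFinsupp.basis (fun m : Fin r → ℕ => Basis.piTensorProduct (fun u => BA (hiv u) (m u)))
    have hB : ∀ x, B x = DirectSum.of (fun m' : Fin r → ℕ => ⨂[ℚ] u : Fin r, ↥(Aspace (β u) (iv u) (m' u))) x.1 (PiTensorProduct.tprod ℚ (el x)) := fun x => by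
      refine (dbasis _ x).trans ?_
      rw [Basis.piTensorProduct_apply]
      simp only [BA_apply]
      rfl
    set d := B.repr v - B.repr w with hd
    have hz : ∀ x0 ∈ d.support, d x0 = 0 := by
      intro x0 hx0
      let π : (⨁ γ : Fin n → ℕ, ↥(Hspace γ)) →ₗ[ℚ] PolyQ n := (Hspace (γ_ x0.1)).subtype.comp
        (DirectSum.component ℚ (Fin n → ℕ) (fun γ => ↥(Hspace γ)) (γ_ x0.1))
      have h0 : ∀ v, Finsupp.linearCombination ℚ (fun x => π (Φ (B x))) (B.repr v) = π (Φ v) := fun v => by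
        conv_rhs => rw [← B.linearCombination_repr v]
        exact (Finsupp.apply_linearCombination ℚ (π.comp Φ) B (B.repr v)).symm
      have h1 : Finsupp.linearCombination ℚ (fun x => π (Φ (B x))) d = 0 := by
        rw [hd, map_sub, h0, h0, hvw, sub_self]
      rw [Finsupp.linearCombination_apply, Finsupp.sum] at h1
      have h2 : ∑ x ∈ d.support with γ_ x.1 = γ_ x0.1, d x • toH (γ_ x0.1) (Psi (Pr0 (qh P)) PL (jl x)) = 0 := by
        rw [← h1, sum_filter]
        refine sum_congr rfl fun x _ => ?_
        rw [hB, hΦ]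
        change _ = d x • ((DirectSum.of (fun γ : Fin n → ℕ => ↥(Hspace γ)) (γ_ x.1) (MP Q β iv x.1 (el x)) (γ_ x0.1) : ↥(Hspace (γ_ x0.1))) : PolyQ n)
        rw [DirectSum.coe_of_apply]
        split_ifs with hh
        · rw [hMP, hh]
        · simp
      simp only [← map_smul, ← map_sum] at h2
      rw [toH_zero] at h2
      have h3 := Ithm r PL (qh P) [] RR (Pr0 (qh P)) hPLl hSt hCp (cst (γ_ x0.1)) ((d.support.filter fun x => γ_ x.1 = γ_ x0.1).image jl)
        (Function.extend jl d 0) (by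
          intro js hjs
          rw [mem_image] at hjs
          obtain ⟨x, hx, rfl⟩ := hjs
          exact ⟨hVal x, by rw [hDm, (mem_filter.mp hx).2]⟩) (by
          intro p hp
          rw [hfst] at hp
          have := hp.RR (fun b hb => ((hroot.mem b).mp hb).1) h2
          rw [sum_image jl_inj.injOn, ← this, map_sum]
          refine sum_congr rfl fun x _ => ?_
          rw [jl_inj.extend_apply, map_smul, smul_eq_mul])
      have h4 := h3 (jl x0) (Finset.mem_image_of_mem _ (mem_filter.mpr ⟨hx0, rfl⟩))
      rwa [jl_inj.extend_apply] at h4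
    have hr : d = 0 := by
      rw [← Finsupp.support_eq_empty, Finset.eq_empty_iff_forall_notMem]
      intro x hx
      exact Finsupp.mem_support_iff.mp hx (hz x hx)
    exact B.repr.injective (sub_eq_zero.mp hr)
  · rw [← LinearMap.range_eq_top, eq_top_iff]
    rintro z -
    induction z using DirectSum.induction_on with
    | zero => exact Submodule.zero_mem _
    | add x y hx hy => exact Submodule.add_mem _ hx hy
    | of γ f =>
      obtain ⟨f, hf⟩ := f
      obtain ⟨a, rfl⟩ := toH_surj hf
      let T : L1 n →ₗ[ℚ] ⨁ γ : Fin n → ℕ, ↥(Hspace γ) := (DirectSum.lof ℚ (Fin n → ℕ) (fun γ => ↥(Hspace γ)) γ).comp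
        (LinearMap.codRestrict (Hspace γ) (toH γ).toLinearMap (toH_mem γ))
      have hT : ∀ a, T a = DirectSum.of (fun γ : Fin n → ℕ => ↥(Hspace γ)) γ ⟨toH γ a, toH_mem γ a⟩ := fun a => rfl
      have key : Submodule.span ℚ (PsiS (Pr0 (qh P)) PL (cst γ)) ⊔ RR (cst γ) ≤ (LinearMap.range Φ).comap T := by
        refine sup_le (Submodule.span_le.mpr ?_) ?_
        · rintro _ ⟨js, hv, hd, rfl⟩
          obtain ⟨F, rfl⟩ := ex_ofFn js (hv.1.trans hPLl)
          let x : (m : Fin r → ℕ) × (∀ u, J (m u)) := ⟨fun u => (F u).1, fun u => ⟨(F u).2, hv.2 _ (by simp)⟩⟩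
          have hx : (List.ofFn F).reverse = jl x := rfl
          rw [hx] at hd ⊢
          rw [hDm] at hd
          have hg : γ_ x.1 = γ := funext fun i => Nat.cast_injective (R := ℤ) (congrFun hd i)
          subst hg
          refine ⟨_, (hΦ x.1 (el x)).trans ?_⟩
          rw [hT]
          exact congrArg _ (Subtype.ext (hMP x))
        · intro a ha
          have : T a = 0 := by
            rw [hT]
            have : (⟨toH γ a, toH_mem γ a⟩ : ↥(Hspace γ)) = 0 := Subtype.ext (toH_zero.mpr ha)
            rw [this, map_zero]
          rw [Submodule.mem_comap, this]; exact Submodule.zero_mem _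
      exact key (Sthm r PL (qh P) [] RR (Pr0 (qh P)) hPLl hSt hCp (cst γ) a)
end CoH
/-- **Main theorem.** Let `𝒬•` be an admissible, ordered, Dynkin
subquiver partition of the acyclic quiver `Q`, `β₁,…,β_r` a Reineke order on
`Φ₊(𝒬•)` with chosen vertices `iv u` satisfying `β_u (iv u) = 1`.  Then the
`ℚ`-linear map `⊕_m (𝒜_{β₁,m₁} ⊗ ⋯ ⊗ 𝒜_{β_r,m_r}) → ℋ(Q) = ⊕_γ ℋ_γ`, induced on
each summand by the left-to-right CoHA product `(f₁,…,f_r) ↦ f₁ * ⋯ * f_r`, is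
bijective: the `*`-multiplication induces an isomorphism
`𝒜_{β₁} ⊗ ⋯ ⊗ 𝒜_{β_r} ≅ ℋ(Q)`. -/
theorem coha_structure_theorem {n ℓ r : ℕ} (Q : FinQuiver n) (hQ : Q.Acyclic)
    (P : SubqPartition Q ℓ) (hord : P.Ordered) (hDyn : P.Dynkin)
    (β : Fin r → Fin n → ℕ) (blk : Fin r → Fin ℓ) (hR : IsReinekeOrder P β blk)
    (iv : Fin r → Fin n) (hiv : ∀ u, β u (iv u) = 1) :
    ∃ Φ : (⨁ m : Fin r → ℕ, ⨂[ℚ] u : Fin r, ↥(Aspace (β u) (iv u) (m u)))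
        →ₗ[ℚ] ⨁ γ : Fin n → ℕ, ↥(Hspace γ),
      (∀ (m : Fin r → ℕ) (f : (u : Fin r) → ↥(Aspace (β u) (iv u) (m u))),
        ∃ hmem : cohaProdFin Q (fun u v => m u * β u v) (fun u => (f u : PolyQ n)) ∈
            Hspace (fun v => ∑ u, m u * β u v),
          Φ (DirectSum.of (fun m' : Fin r → ℕ =>
                ⨂[ℚ] u : Fin r, ↥(Aspace (β u) (iv u) (m' u))) m
              (PiTensorProduct.tprod ℚ f)) =
            DirectSum.of (fun γ : Fin n → ℕ => ↥(Hspace γ))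
              (fun v => ∑ u, m u * β u v)
              ⟨cohaProdFin Q (fun u v => m u * β u v) (fun u => (f u : PolyQ n)), hmem⟩) ∧
      Function.Bijective Φ := by
  exact CoH.main Q P hord hDyn β blk hR iv hiv
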